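/- arXiv:2102.10352 — 6 statements merged into one kernel-verified Lean document; each statement's English description precedes it below -/
import Mathlib

section
/- Let r > 0 and s ≥ 20000 r. In the Euclidean plane ℝ², let A, B, C, D be the vertices (in cyclic order) of a square of side length 3s, and let S be the square of side length s concentric with ABCD and with sides parallel to those of ABCD. Let ρ_B, ρ_D > 0 be such that 𝒟(B, ρ_B, ρ_B + s/6) ∩ 𝒟(D, ρ_D, ρ_D + s/6) ∩ S ≠ ∅. Then there is a line ℓ in ℝ² parallel to the diagonal line AC such that 𝒟(B, ρ_B, ρ_B + s/6) ∩ 𝒟(D, ρ_D, ρ_D + s/6) is contained in the strip {x ∈ ℝ² : dist(x, ℓ) ≤ (s/4 − 2r)/2} of width s/4 − 2r. -/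
open scoped RealInnerProductSpace

section Parallelogram

variable {V : Type*} [NormedAddCommGroup V] [InnerProductSpace ℝ V]

/-- If the squared side lengths of a quadrilateral add up to the squared lengths of the diagonals,
then the quadrilateral is a parallelogram. -/
theorem add_eq_add_of_sum_dist_sq_eq {A B C D : V}
    (h : dist A B ^ 2 + dist B C ^ 2 + dist C D ^ 2 + dist D A ^ 2 =
      dist A C ^ 2 + dist B D ^ 2) : A + C = B + D := by
  have key : ‖(A + C) - (B + D)‖ ^ 2 = 0 := by
    simp only [dist_eq_norm, ← real_inner_self_eq_norm_sq, inner_add_left, inner_add_right,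
      inner_sub_left, inner_sub_right] at h ⊢
    linarith [real_inner_comm A B, real_inner_comm A C, real_inner_comm A D,
      real_inner_comm B C, real_inner_comm B D, real_inner_comm C D]
  exact sub_eq_zero.mp (norm_eq_zero.mp (pow_eq_zero_iff two_ne_zero |>.mp key))

theorem norm_sq_smul_add_smul_of_inner_eq_zero {E F : V} {k : ℝ} (hE : ‖E‖ ^ 2 = k)
    (hF : ‖F‖ ^ 2 = k) (hEF : ⟪E, F⟫ = 0) (a b : ℝ) :
    ‖a • E + b • F‖ ^ 2 = (a ^ 2 + b ^ 2) * k := by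
  have hFE : ⟪F, E⟫ = 0 := by rw [real_inner_comm]; exact hEF
  rw [← real_inner_self_eq_norm_sq] at hE hF ⊢
  simp only [inner_add_left, inner_add_right, real_inner_smul_left, real_inner_smul_right,
    hE, hF, hEF, hFE]
  ring

end Parallelogram

/-- Two nonzero orthogonal vectors span the plane. -/
theorem exists_eq_smul_add_smul_of_inner_eq_zero {E F : EuclideanSpace ℝ (Fin 2)}
    (hE : E ≠ 0) (hF : F ≠ 0) (hEF : ⟪E, F⟫ = 0) (y : EuclideanSpace ℝ (Fin 2)) :
    ∃ a b : ℝ, y = a • E + b • F := by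
  have hE' : 0 < ‖E‖ ^ 2 := by positivity
  have hF' : 0 < ‖F‖ ^ 2 := by positivity
  have hdet : E 0 * F 1 - E 1 * F 0 ≠ 0 := by
    intro h
    simp only [EuclideanSpace.real_norm_sq_eq, PiLp.inner_apply, Fin.sum_univ_two, RCLike.inner_apply,
      conj_trivial] at hE' hF' hEF
    nlinarith [mul_pos hE' hF']
  refine ⟨(y 0 * F 1 - y 1 * F 0) / (E 0 * F 1 - E 1 * F 0),
    (E 0 * y 1 - E 1 * y 0) / (E 0 * F 1 - E 1 * F 0), ?_⟩
  ext i
  fin_cases i <;> simp <;>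
    rw [div_mul_eq_mul_div, div_mul_eq_mul_div, ← add_div, eq_div_iff hdet] <;> ring

/-- Claim 1: if the two crowns centered at the opposite corners `B`, `D`
of a square `ABCD` of side `3s` meet the central square `S` of side `s`, then their
intersection lies in a strip of width `s/4 − 2r` parallel to the diagonal `AC`.

The square `ABCD` (in cyclic order, side length `3s`) is encoded by its side lengths and
diagonal lengths; `S` is the concentric axis-aligned-with-`ABCD` square of side `s`,
described via the coordinates in the directions of the sides `AB` and `BC`. -/
theorem stmt2 (r s : ℝ) (hr : 0 < r) (hs : 20000 * r ≤ s)
    (A B C D : EuclideanSpace ℝ (Fin 2))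
    (hAB : dist A B = 3 * s) (hBC : dist B C = 3 * s)
    (hCD : dist C D = 3 * s) (hDA : dist D A = 3 * s)
    (hAC : dist A C = 3 * Real.sqrt 2 * s) (hBD : dist B D = 3 * Real.sqrt 2 * s)
    (S : Set (EuclideanSpace ℝ (Fin 2)))
    (hS : S = {x | |⟪x - midpoint ℝ A C, (3 * s)⁻¹ • (B - A)⟫| ≤ s / 2 ∧
                   |⟪x - midpoint ℝ A C, (3 * s)⁻¹ • (C - B)⟫| ≤ s / 2})
    (ρB ρD : ℝ) (hρB : 0 < ρB) (hρD : 0 < ρD)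
    (hne : ((Metric.closedBall B (ρB + s / 6) \ Metric.closedBall B ρB) ∩
            (Metric.closedBall D (ρD + s / 6) \ Metric.closedBall D ρD) ∩ S).Nonempty) :
    ∃ ℓ : AffineSubspace ℝ (EuclideanSpace ℝ (Fin 2)),
      ℓ.direction = (affineSpan ℝ {A, C}).direction ∧
      (Metric.closedBall B (ρB + s / 6) \ Metric.closedBall B ρB) ∩
        (Metric.closedBall D (ρD + s / 6) \ Metric.closedBall D ρD) ⊆
        {x | Metric.infDist x (ℓ : Set (EuclideanSpace ℝ (Fin 2))) ≤ (s / 4 - 2 * r) / 2} := by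
  have hs0 : 0 < s := by linarith
  have h2 : Real.sqrt 2 ^ 2 = 2 := Real.sq_sqrt (by norm_num)
  have hpar : A + C = B + D := add_eq_add_of_sum_dist_sq_eq (by
    rw [hAB, hBC, hCD, hDA, hAC, hBD]; linear_combination (-18 * s ^ 2) * h2)
  have hO : midpoint ℝ A C + midpoint ℝ A C = A + C := midpoint_add_self ℝ A C
  generalize midpoint ℝ A C = O at hO hS
  obtain ⟨E, rfl⟩ : ∃ E, D = O + E := ⟨D - O, by abel⟩
  obtain ⟨F, rfl⟩ : ∃ F, C = O + F := ⟨C - O, by abel⟩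
  obtain rfl : A = O - F := by
    rw [eq_sub_iff_add_eq]
    exact add_right_cancel (b := O) (by rw [hO]; abel)
  obtain rfl : B = O - E := by
    rw [eq_sub_iff_add_eq]
    exact add_right_cancel (b := O) (by
      rw [show B + E + O = B + (O + E) by abel, ← hpar, hO])
  have hE : ‖E‖ ^ 2 = 9 * s ^ 2 / 2 := by
    rw [dist_eq_norm, show O - E - (O + E) = (-2 : ℝ) • E by module, norm_smul] at hBD
    norm_num at hBD
    rw [show ‖E‖ = 3 * Real.sqrt 2 * s / 2 by linarith]
    linear_combination (9 * s ^ 2 / 4) * h2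
  have hF : ‖F‖ ^ 2 = 9 * s ^ 2 / 2 := by
    rw [dist_eq_norm, show O - F - (O + F) = (-2 : ℝ) • F by module, norm_smul] at hAC
    norm_num at hAC
    rw [show ‖F‖ = 3 * Real.sqrt 2 * s / 2 by linarith]
    linear_combination (9 * s ^ 2 / 4) * h2
  have hEF : ⟪E, F⟫ = 0 := by
    rw [dist_eq_norm, show O + F - (O + E) = F - E by abel] at hCD
    have := norm_sub_sq_real F E
    rw [hCD, hE, hF, real_inner_comm] at this
    linarith
  have hFE : ⟪F, E⟫ = 0 := by rw [real_inner_comm]; exact hEF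
  have hE0 : E ≠ 0 := by
    rintro rfl
    rw [norm_zero] at hE
    nlinarith
  have hF0 : F ≠ 0 := by
    rintro rfl
    rw [norm_zero] at hF
    nlinarith
  have hcoord (x) : ∃ a b : ℝ, x = O + (a • E + b • F) := by
    obtain ⟨a, b, h⟩ := exists_eq_smul_add_smul_of_inner_eq_zero hE0 hF0 hEF (x - O)
    exact ⟨a, b, by rw [← h]; abel⟩
  have hdB (a b : ℝ) : dist (O + (a • E + b • F)) (O - E) ^ 2 =
      ((a + 1) ^ 2 + b ^ 2) * (9 * s ^ 2 / 2) := by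
    rw [dist_eq_norm, ← norm_sq_smul_add_smul_of_inner_eq_zero hE hF hEF]
    congr 2
    module
  have hdD (a b : ℝ) : dist (O + (a • E + b • F)) (O + E) ^ 2 =
      ((a - 1) ^ 2 + b ^ 2) * (9 * s ^ 2 / 2) := by
    rw [dist_eq_norm, ← norm_sq_smul_add_smul_of_inner_eq_zero hE hF hEF]
    congr 2
    module
  have hsum : ρB + ρD + s / 6 ≤ 6 * s := by
    obtain ⟨x, ⟨⟨-, hxB⟩, ⟨-, hxD⟩⟩, hxS⟩ := hne
    obtain ⟨a, b, rfl⟩ := hcoord x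
    have e1 : ⟪O + (a • E + b • F) - O, (3 * s)⁻¹ • (O - E - (O - F))⟫ =
        (b - a) * (3 * s / 2) := by
      rw [show O + (a • E + b • F) - O = a • E + b • F by abel,
        show O - E - (O - F) = F - E by abel]
      simp only [inner_add_left, inner_sub_right, real_inner_smul_left, real_inner_smul_right,
        real_inner_self_eq_norm_sq, hE, hF, hEF, hFE]
      field_simp
      ring
    have e2 : ⟪O + (a • E + b • F) - O, (3 * s)⁻¹ • (O + F - (O - E))⟫ =
        (b + a) * (3 * s / 2) := by
      rw [show O + (a • E + b • F) - O = a • E + b • F by abel,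
        show O + F - (O - E) = F + E by abel]
      simp only [inner_add_left, inner_add_right, real_inner_smul_left, real_inner_smul_right,
        real_inner_self_eq_norm_sq, hE, hF, hEF, hFE]
      field_simp
      ring
    rw [hS, Set.mem_ofPred_eq, e1, e2, abs_mul, abs_mul,
      abs_of_pos (show 0 < 3 * s / 2 by positivity)] at hxS
    have h1 : |b - a| ≤ 1 / 3 := by
      refine le_of_mul_le_mul_right ?_ (show 0 < 3 * s / 2 by positivity)
      linarith [hxS.1]
    have h3 : |b + a| ≤ 1 / 3 := by
      refine le_of_mul_le_mul_right ?_ (show 0 < 3 * s / 2 by positivity)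
      linarith [hxS.2]
    rw [abs_le] at h1 h3
    have h1' := sq_le_sq' h1.1 h1.2
    have h3' := sq_le_sq' h3.1 h3.2
    have hab : a ^ 2 + b ^ 2 ≤ 1 / 9 := by linarith
    have hB : dist (O + (a • E + b • F)) (O - E) ≤ 2.9 * s := by
      refine le_of_pow_le_pow_left₀ two_ne_zero (by positivity) ?_
      rw [hdB]
      linarith [mul_le_mul_of_nonneg_right (show (a + 1) ^ 2 + b ^ 2 ≤ 16 / 9 by linarith)
        (sq_nonneg s), sq_nonneg s]
    have hD : dist (O + (a • E + b • F)) (O + E) ≤ 2.9 * s := by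
      refine le_of_pow_le_pow_left₀ two_ne_zero (by positivity) ?_
      rw [hdD]
      linarith [mul_le_mul_of_nonneg_right (show (a - 1) ^ 2 + b ^ 2 ≤ 16 / 9 by linarith)
        (sq_nonneg s), sq_nonneg s]
    rw [Metric.mem_closedBall, not_le] at hxB hxD
    linarith
  set c : ℝ := (ρB ^ 2 - (ρD + s / 6) ^ 2 + ((ρB + s / 6) ^ 2 - ρD ^ 2)) / (36 * s ^ 2) with hc
  have hc' : c * (36 * s ^ 2) =
      ρB ^ 2 - (ρD + s / 6) ^ 2 + ((ρB + s / 6) ^ 2 - ρD ^ 2) := by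
    rw [hc]; field_simp
  refine ⟨AffineSubspace.mk' (O + c • E) (affineSpan ℝ {O - F, O + F}).direction,
    AffineSubspace.direction_mk' _ _, ?_⟩
  rintro x ⟨⟨hxB, hxB'⟩, ⟨hxD, hxD'⟩⟩
  obtain ⟨a, b, rfl⟩ := hcoord x
  rw [Metric.mem_closedBall] at hxB hxB' hxD hxD'
  rw [not_le] at hxB' hxD'
  have hmem : O + (c • E + b • F) ∈
      AffineSubspace.mk' (O + c • E) (affineSpan ℝ {O - F, O + F}).direction := by
    rw [AffineSubspace.mem_mk', vsub_eq_sub, direction_affineSpan,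
      show O + (c • E + b • F) - (O + c • E) = (b / 2) • ((O + F) - (O - F)) by module]
    exact Submodule.smul_mem _ _ (vsub_mem_vectorSpan ℝ (by simp) (by simp))
  refine (Metric.infDist_le_dist_of_mem hmem).trans ?_
  have hpq : dist (O + (a • E + b • F)) (O - E) ^ 2 - dist (O + (a • E + b • F)) (O + E) ^ 2 =
      18 * s ^ 2 * a := by
    rw [hdB, hdD]; ring
  have b1 := pow_le_pow_left₀ dist_nonneg hxB 2
  have b2 := pow_le_pow_left₀ dist_nonneg hxD 2
  have b3 := pow_le_pow_left₀ hρB.le hxB'.le 2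
  have b4 := pow_le_pow_left₀ hρD.le hxD'.le 2
  have hs2 : 0 < 36 * s ^ 2 := by positivity
  have hw := mul_le_mul_of_nonneg_right hsum hs0.le
  have hac : |a - c| ≤ 1 / 18 := by
    rw [abs_le]
    constructor
    · refine le_of_mul_le_mul_right ?_ hs2
      linarith
    · refine le_of_mul_le_mul_right ?_ hs2
      linarith
  have hac2 : (a - c) ^ 2 ≤ (1 / 18) ^ 2 := sq_le_sq' (abs_le.mp hac).1 (abs_le.mp hac).2
  have hd : dist (O + (a • E + b • F)) (O + (c • E + b • F)) ^ 2 =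
      ((a - c) ^ 2 + 0 ^ 2) * (9 * s ^ 2 / 2) := by
    rw [dist_eq_norm, ← norm_sq_smul_add_smul_of_inner_eq_zero hE hF hEF]
    congr 2
    module
  have : dist (O + (a • E + b • F)) (O + (c • E + b • F)) ≤ 0.12 * s := by
    refine le_of_pow_le_pow_left₀ two_ne_zero (by positivity) ?_
    rw [hd]
    linarith [mul_le_mul_of_nonneg_right hac2 (sq_nonneg s), sq_nonneg s]
  linarith
end

section
/- In the Euclidean plane ℝ², let k₁ and k₂ be circles (spheres) with centers O₁ ≠ O₂ and radii 0 < r₁ ≤ r₂ respectively, such that k₁ ∩ k₂ = {A, B} with A ≠ B. Let ℓ₁ and ℓ₂ be two lines parallel to the line O₁O₂ that divide the plane into three parts such that A, O₁ and B lie in three different parts (A strictly on one side of ℓ₁, O₁ strictly between ℓ₁ and ℓ₂, B strictly on the other side of ℓ₂). Suppose ℓ₁ ∩ k₁ = {P₁, S₁}, ℓ₂ ∩ k₁ = {Q₁, R₁}, ℓ₁ ∩ k₂ = {P₂, S₂}, ℓ₂ ∩ k₂ = {Q₂, R₂}, where P₁, Q₁, P₂, Q₂ all lie strictly on the same side of the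 line AB. Then dist(P₁, Q₁) ≥ dist(P₂, Q₂). -/
/-- The determinant `d ∧ v` of two plane vectors, as a linear map in `v`. -/
noncomputable def planeCross (d : EuclideanSpace ℝ (Fin 2)) :
    EuclideanSpace ℝ (Fin 2) →ₗ[ℝ] ℝ where
  toFun v := d 0 * v 1 - d 1 * v 0
  map_add' x y := by simp; ring
  map_smul' c x := by simp; ring

theorem planeCross_apply (d v : EuclideanSpace ℝ (Fin 2)) :
    planeCross d v = d 0 * v 1 - d 1 * v 0 := rfl

theorem EuclideanSpace.sq_add_sq_pos_of_ne_zero {d : EuclideanSpace ℝ (Fin 2)} (hd : d ≠ 0) :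
    0 < d 0 ^ 2 + d 1 ^ 2 := by
  have h : 0 < ‖d‖ ^ 2 := by positivity
  simpa [EuclideanSpace.norm_sq_eq, Fin.sum_univ_two] using h

theorem mem_span_singleton_iff_planeCross_eq_zero {d v : EuclideanSpace ℝ (Fin 2)} (hd : d ≠ 0) :
    v ∈ Submodule.span ℝ {d} ↔ planeCross d v = 0 := by
  have hN := EuclideanSpace.sq_add_sq_pos_of_ne_zero hd
  rw [Submodule.mem_span_singleton, planeCross_apply]
  constructor
  · rintro ⟨a, rfl⟩
    simp; ring
  · intro h
    refine ⟨(d 0 * v 0 + d 1 * v 1) / (d 0 ^ 2 + d 1 ^ 2), ?_⟩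
    ext i
    fin_cases i
    · simp only [Fin.zero_eta, PiLp.smul_apply, smul_eq_mul]
      field_simp
      linear_combination d 1 * h
    · simp only [Fin.mk_one, PiLp.smul_apply, smul_eq_mul]
      field_simp
      linear_combination -d 0 * h

theorem AffineSubspace.mem_iff_planeCross_eq {d p x : EuclideanSpace ℝ (Fin 2)} (hd : d ≠ 0)
    {ℓ : AffineSubspace ℝ (EuclideanSpace ℝ (Fin 2))} (hℓ : ℓ.direction = Submodule.span ℝ {d})
    (hp : p ∈ ℓ) : x ∈ ℓ ↔ planeCross d x = planeCross d p := by
  rw [← AffineSubspace.vsub_right_mem_direction_iff_mem hp, hℓ,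
    mem_span_singleton_iff_planeCross_eq_zero hd, vsub_eq_sub, map_sub, sub_eq_zero]

section

variable {V : Type*} [AddCommGroup V] [Module ℝ V]

theorem SameRay.mul_map_nonneg (φ : V →ₗ[ℝ] ℝ) {x y : V} (h : SameRay ℝ x y) :
    0 ≤ φ x * φ y := by
  obtain ⟨a, b, ha, hb, -, hx, hy⟩ := h.exists_eq_smul_add
  have hx' : φ x = a * φ (x + y) := by conv_lhs => rw [hx, map_smul, smul_eq_mul]
  have hy' : φ y = b * φ (x + y) := by conv_lhs => rw [hy, map_smul, smul_eq_mul]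
  rw [hx', hy', mul_mul_mul_comm]
  exact mul_nonneg (mul_nonneg ha hb) (mul_self_nonneg _)

theorem AffineSubspace.SSameSide.mul_map_sub_pos {ℓ : AffineSubspace ℝ V} {φ : V →ₗ[ℝ] ℝ} {c : ℝ}
    (hℓ : ∀ x, x ∈ ℓ ↔ φ x = c) {x y : V} (h : ℓ.SSameSide x y) :
    0 < (φ x - c) * (φ y - c) := by
  obtain ⟨⟨p, hp, q, hq, hr⟩, hx, hy⟩ := h
  have h0 := hr.mul_map_nonneg φ
  rw [hℓ] at hp hq hx hy
  simp only [vsub_eq_sub, map_sub, hp, hq] at h0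
  exact lt_of_le_of_ne h0 (mul_ne_zero (sub_ne_zero.2 hx) (sub_ne_zero.2 hy)).symm

theorem AffineSubspace.SOppSide.mul_map_sub_neg {ℓ : AffineSubspace ℝ V} {φ : V →ₗ[ℝ] ℝ} {c : ℝ}
    (hℓ : ∀ x, x ∈ ℓ ↔ φ x = c) {x y : V} (h : ℓ.SOppSide x y) :
    (φ x - c) * (φ y - c) < 0 := by
  obtain ⟨⟨p, hp, q, hq, hr⟩, hx, hy⟩ := h
  have h0 := hr.mul_map_nonneg φ
  rw [hℓ] at hp hq hx hy
  simp only [vsub_eq_sub, map_sub, hp, hq] at h0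
  exact lt_of_le_of_ne (by linarith) (mul_ne_zero (sub_ne_zero.2 hx) (sub_ne_zero.2 hy))

end

theorem sq_sub_le_sq_sub_of_sq_sub_sq_eq {x₁ y₁ x₂ y₂ : ℝ} (hx₁ : 0 < x₁) (hy₁ : 0 < y₁)
    (hx : x₁ ≤ x₂) (hy : y₁ ≤ y₂) (h : x₁ ^ 2 - y₁ ^ 2 = x₂ ^ 2 - y₂ ^ 2) :
    (x₂ - y₂) ^ 2 ≤ (x₁ - y₁) ^ 2 := by
  have hs : (x₁ + y₁) ^ 2 ≤ (x₂ + y₂) ^ 2 := by gcongr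
  have he : (x₂ - y₂) ^ 2 * (x₂ + y₂) ^ 2 = (x₁ - y₁) ^ 2 * (x₁ + y₁) ^ 2 := by
    linear_combination -(x₁ ^ 2 - y₁ ^ 2 + (x₂ ^ 2 - y₂ ^ 2)) * h
  refine le_of_mul_le_mul_right (a := (x₁ + y₁) ^ 2) ?_ (by positivity)
  calc (x₂ - y₂) ^ 2 * (x₁ + y₁) ^ 2 ≤ (x₂ - y₂) ^ 2 * (x₂ + y₂) ^ 2 := by gcongr
    _ = _ := he

theorem sub_pos_of_sq_sub_add_sq_eq {a h s p : ℝ} (hs : s ^ 2 < h ^ 2) (hp : 0 < p)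
    (e : (p - a) ^ 2 + s ^ 2 = a ^ 2 + h ^ 2) : 0 < p - a := by
  have : 0 < p * (p - 2 * a) := by nlinarith
  linarith [pos_of_mul_pos_right this hp.le]

/-- The parallel chords inequality in coordinates where both circles, centred at `(a₁, 0)` and
`(a₂, 0)`, pass through `(0, ±h)`, for points with positive abscissae. -/
theorem sq_sub_le_sq_sub_of_coaxial_of_pos {a₁ a₂ h s t p₁ q₁ p₂ q₂ : ℝ} (ha : a₁ ^ 2 ≤ a₂ ^ 2)
    (hs : s ^ 2 < h ^ 2) (ht : t ^ 2 < h ^ 2)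
    (hp₁ : 0 < p₁) (hq₁ : 0 < q₁) (hp₂ : 0 < p₂) (hq₂ : 0 < q₂)
    (ep₁ : (p₁ - a₁) ^ 2 + s ^ 2 = a₁ ^ 2 + h ^ 2) (eq₁ : (q₁ - a₁) ^ 2 + t ^ 2 = a₁ ^ 2 + h ^ 2)
    (ep₂ : (p₂ - a₂) ^ 2 + s ^ 2 = a₂ ^ 2 + h ^ 2) (eq₂ : (q₂ - a₂) ^ 2 + t ^ 2 = a₂ ^ 2 + h ^ 2) :
    (p₂ - q₂) ^ 2 ≤ (p₁ - q₁) ^ 2 := by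
  have key := sq_sub_le_sq_sub_of_sq_sub_sq_eq
    (sub_pos_of_sq_sub_add_sq_eq hs hp₁ ep₁) (sub_pos_of_sq_sub_add_sq_eq ht hq₁ eq₁)
    (le_of_abs_le (abs_le_of_sq_le_sq (by linarith) (sub_pos_of_sq_sub_add_sq_eq hs hp₂ ep₂).le))
    (le_of_abs_le (abs_le_of_sq_le_sq (by linarith) (sub_pos_of_sq_sub_add_sq_eq ht hq₂ eq₂).le))
    (by linarith)
  simpa using key

theorem sq_sub_le_sq_sub_of_coaxial {a₁ a₂ h s t p₁ q₁ p₂ q₂ : ℝ} (ha : a₁ ^ 2 ≤ a₂ ^ 2)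
    (hs : s ^ 2 < h ^ 2) (ht : t ^ 2 < h ^ 2)
    (hpq₁ : 0 < p₁ * q₁) (hp₁p₂ : 0 < p₁ * p₂) (hp₁q₂ : 0 < p₁ * q₂)
    (ep₁ : (p₁ - a₁) ^ 2 + s ^ 2 = a₁ ^ 2 + h ^ 2) (eq₁ : (q₁ - a₁) ^ 2 + t ^ 2 = a₁ ^ 2 + h ^ 2)
    (ep₂ : (p₂ - a₂) ^ 2 + s ^ 2 = a₂ ^ 2 + h ^ 2) (eq₂ : (q₂ - a₂) ^ 2 + t ^ 2 = a₂ ^ 2 + h ^ 2) :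
    (p₂ - q₂) ^ 2 ≤ (p₁ - q₁) ^ 2 := by
  rcases lt_trichotomy p₁ 0 with hp | rfl | hp
  · have := sq_sub_le_sq_sub_of_coaxial_of_pos (a₁ := -a₁) (a₂ := -a₂) (h := h) (s := s) (t := t)
      (p₁ := -p₁) (q₁ := -q₁) (p₂ := -p₂) (q₂ := -q₂) (by linarith [neg_sq a₁, neg_sq a₂]) hs ht
      (neg_pos.2 hp) (neg_pos.2 (neg_of_mul_pos_right hpq₁ hp.le))
      (neg_pos.2 (neg_of_mul_pos_right hp₁p₂ hp.le)) (neg_pos.2 (neg_of_mul_pos_right hp₁q₂ hp.le))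
      (by linear_combination ep₁) (by linear_combination eq₁)
      (by linear_combination ep₂) (by linear_combination eq₂)
    linarith
  · simp at hpq₁
  · exact sq_sub_le_sq_sub_of_coaxial_of_pos ha hs ht hp (pos_of_mul_pos_right hpq₁ hp.le)
      (pos_of_mul_pos_right hp₁p₂ hp.le) (pos_of_mul_pos_right hp₁q₂ hp.le)
      ep₁ eq₁ ep₂ eq₂

/-- The parallel chords inequality with all points given by Cartesian coordinates. -/
theorem parallel_chords_coord
    {o₀ o₁ c₀ c₁ a₀ a₁ b₀ b₁ p₀ p₁ q₀ q₁ p₀' p₁' q₀' q₁' r₁ r₂ : ℝ} (hr : r₁ ^ 2 ≤ r₂ ^ 2)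
    (hN : 0 < (c₀ - o₀) ^ 2 + (c₁ - o₁) ^ 2) (hD : 0 < (b₀ - a₀) ^ 2 + (b₁ - a₁) ^ 2)
    (A₁ : (a₀ - o₀) ^ 2 + (a₁ - o₁) ^ 2 = r₁ ^ 2) (A₂ : (a₀ - c₀) ^ 2 + (a₁ - c₁) ^ 2 = r₂ ^ 2)
    (B₁ : (b₀ - o₀) ^ 2 + (b₁ - o₁) ^ 2 = r₁ ^ 2) (B₂ : (b₀ - c₀) ^ 2 + (b₁ - c₁) ^ 2 = r₂ ^ 2)
    (cP₁ : (p₀ - o₀) ^ 2 + (p₁ - o₁) ^ 2 = r₁ ^ 2) (cQ₁ : (q₀ - o₀) ^ 2 + (q₁ - o₁) ^ 2 = r₁ ^ 2)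
    (cP₂ : (p₀' - c₀) ^ 2 + (p₁' - c₁) ^ 2 = r₂ ^ 2)
    (cQ₂ : (q₀' - c₀) ^ 2 + (q₁' - c₁) ^ 2 = r₂ ^ 2)
    (wP : (c₀ - o₀) * p₁' - (c₁ - o₁) * p₀' = (c₀ - o₀) * p₁ - (c₁ - o₁) * p₀)
    (wQ : (c₀ - o₀) * q₁' - (c₁ - o₁) * q₀' = (c₀ - o₀) * q₁ - (c₁ - o₁) * q₀)
    (sP : ((c₀ - o₀) * a₁ - (c₁ - o₁) * a₀ - ((c₀ - o₀) * p₁ - (c₁ - o₁) * p₀)) *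
      ((c₀ - o₀) * b₁ - (c₁ - o₁) * b₀ - ((c₀ - o₀) * p₁ - (c₁ - o₁) * p₀)) < 0)
    (sQ : ((c₀ - o₀) * b₁ - (c₁ - o₁) * b₀ - ((c₀ - o₀) * q₁ - (c₁ - o₁) * q₀)) *
      ((c₀ - o₀) * a₁ - (c₁ - o₁) * a₀ - ((c₀ - o₀) * q₁ - (c₁ - o₁) * q₀)) < 0)
    (s₁ : 0 < ((b₀ - a₀) * p₁ - (b₁ - a₁) * p₀ - ((b₀ - a₀) * a₁ - (b₁ - a₁) * a₀)) *
      ((b₀ - a₀) * q₁ - (b₁ - a₁) * q₀ - ((b₀ - a₀) * a₁ - (b₁ - a₁) * a₀)))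
    (s₂ : 0 < ((b₀ - a₀) * p₁ - (b₁ - a₁) * p₀ - ((b₀ - a₀) * a₁ - (b₁ - a₁) * a₀)) *
      ((b₀ - a₀) * p₁' - (b₁ - a₁) * p₀' - ((b₀ - a₀) * a₁ - (b₁ - a₁) * a₀)))
    (s₃ : 0 < ((b₀ - a₀) * p₁ - (b₁ - a₁) * p₀ - ((b₀ - a₀) * a₁ - (b₁ - a₁) * a₀)) *
      ((b₀ - a₀) * q₁' - (b₁ - a₁) * q₀' - ((b₀ - a₀) * a₁ - (b₁ - a₁) * a₀))) :
    (p₀' - q₀') ^ 2 + (p₁' - q₁') ^ 2 ≤ (p₀ - q₀) ^ 2 + (p₁ - q₁) ^ 2 := by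
  set e₀ := c₀ - o₀ with he₀
  set e₁ := c₁ - o₁ with he₁
  set d₀ := b₀ - a₀ with hd₀
  set d₁ := b₁ - a₁ with hd₁
  obtain ⟨m₀, hm₀⟩ : ∃ m₀, m₀ = (a₀ + b₀) / 2 := ⟨_, rfl⟩
  obtain ⟨m₁, hm₁⟩ : ∃ m₁, m₁ = (a₁ + b₁) / 2 := ⟨_, rfl⟩
  have dO : d₀ * (o₀ - m₀) + d₁ * (o₁ - m₁) = 0 := by
    rw [hd₀, hd₁, hm₀, hm₁]; linear_combination (A₁ - B₁) / 2
  have dC : d₀ * (c₀ - m₀) + d₁ * (c₁ - m₁) = 0 := by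
    rw [hd₀, hd₁, hm₀, hm₁]; linear_combination (A₂ - B₂) / 2
  have dE : d₀ * e₀ + d₁ * e₁ = 0 := by linear_combination dC - dO
  have perp {x y : ℝ} (h : d₀ * x + d₁ * y = 0) : e₀ * y - e₁ * x = 0 := by
    refine (mul_eq_zero.1 ?_).resolve_left hD.ne'
    linear_combination (d₀ * y - d₁ * x) * dE + (d₁ * e₀ - d₀ * e₁) * h
  have wO := perp dO
  have wC := perp dC
  -- The coordinates `u`, `w` along and across the line of centres, relative to the midpoint.
  let u (x y : ℝ) := e₀ * (x - m₀) + e₁ * (y - m₁)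
  let w (x y : ℝ) := e₀ * (y - m₁) - e₁ * (x - m₀)
  have norm_uw (x y x' y' : ℝ) : (u x y - u x' y') ^ 2 + (w x y - w x' y') ^ 2 =
      (e₀ ^ 2 + e₁ ^ 2) * ((x - x') ^ 2 + (y - y') ^ 2) := by
    simp only [u, w]; ring
  have uA : u a₀ a₁ = 0 := by
    simp only [u, hm₀, hm₁]; linear_combination -dE / 2
  have wP' : w p₀' p₁' = w p₀ p₁ := by simp only [w]; linear_combination wP
  have wQ' : w q₀' q₁' = w q₀ q₁ := by simp only [w]; linear_combination wQ
  have wB : w b₀ b₁ = -w a₀ a₁ := by simp only [w, hm₀, hm₁]; ring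
  have hs : w p₀ p₁ ^ 2 < w a₀ a₁ ^ 2 := by
    have : (w a₀ a₁ - w p₀ p₁) * (w b₀ b₁ - w p₀ p₁) < 0 := by
      convert sP using 2 <;> simp only [w] <;> ring
    rw [wB] at this; linarith
  have ht : w q₀ q₁ ^ 2 < w a₀ a₁ ^ 2 := by
    have : (w b₀ b₁ - w q₀ q₁) * (w a₀ a₁ - w q₀ q₁) < 0 := by
      convert sQ using 2 <;> simp only [w] <;> ring
    rw [wB] at this; linarith
  have cross_u (x y : ℝ) : (e₀ ^ 2 + e₁ ^ 2) * (d₀ * y - d₁ * x - (d₀ * a₁ - d₁ * a₀)) =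
      (d₀ * e₁ - d₁ * e₀) * u x y := by
    rw [← sub_zero (u x y), ← uA]
    simp only [u]
    linear_combination (e₀ * (y - a₁) - e₁ * (x - a₀)) * dE
  have same {x y x' y' : ℝ} (h : 0 < (d₀ * y - d₁ * x - (d₀ * a₁ - d₁ * a₀)) *
      (d₀ * y' - d₁ * x' - (d₀ * a₁ - d₁ * a₀))) : 0 < u x y * u x' y' := by
    have h' := mul_pos (mul_pos hN hN) h
    rw [mul_mul_mul_comm, cross_u, cross_u, mul_mul_mul_comm] at h'
    exact pos_of_mul_pos_right h' (mul_self_nonneg _)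
  have circle₁ {x y : ℝ} (h : (x - o₀) ^ 2 + (y - o₁) ^ 2 = r₁ ^ 2) :
      (u x y - u o₀ o₁) ^ 2 + w x y ^ 2 = (e₀ ^ 2 + e₁ ^ 2) * r₁ ^ 2 := by
    have := norm_uw x y o₀ o₁
    rwa [show w o₀ o₁ = 0 from wO, sub_zero, h] at this
  have circle₂ {x y : ℝ} (h : (x - c₀) ^ 2 + (y - c₁) ^ 2 = r₂ ^ 2) :
      (u x y - u c₀ c₁) ^ 2 + w x y ^ 2 = (e₀ ^ 2 + e₁ ^ 2) * r₂ ^ 2 := by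
    have := norm_uw x y c₀ c₁
    rwa [show w c₀ c₁ = 0 from wC, sub_zero, h] at this
  have kA₁ := circle₁ A₁
  have kA₂ := circle₂ A₂
  rw [uA, zero_sub, neg_sq] at kA₁ kA₂
  have kP₂ := circle₂ cP₂
  have kQ₂ := circle₂ cQ₂
  rw [wP'] at kP₂
  rw [wQ'] at kQ₂
  have hO : u o₀ o₁ ^ 2 ≤ u c₀ c₁ ^ 2 := by
    have := mul_le_mul_of_nonneg_left hr hN.le
    linarith
  have key := sq_sub_le_sq_sub_of_coaxial hO hs ht (same s₁) (same s₂) (same s₃)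
    ((circle₁ cP₁).trans kA₁.symm) ((circle₁ cQ₁).trans kA₁.symm)
    (kP₂.trans kA₂.symm) (kQ₂.trans kA₂.symm)
  refine le_of_mul_le_mul_left ?_ hN
  rw [← norm_uw, ← norm_uw, wP', wQ']
  linarith


/-- Lemma on parallel chords: two circles `k₁`, `k₂` with centers
`O₁ ≠ O₂` and radii `0 < r₁ ≤ r₂` meet in exactly the two points `A ≠ B`; two lines
`ℓ₁`, `ℓ₂` parallel to the line `O₁O₂` separate the plane into three parts with `A`,
`O₁`, `B` in different parts; `ℓ₁ ∩ k₁ = {P₁, S₁}`, `ℓ₂ ∩ k₁ = {Q₁, R₁}`,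
`ℓ₁ ∩ k₂ = {P₂, S₂}`, `ℓ₂ ∩ k₂ = {Q₂, R₂}` with `P₁, Q₁, P₂, Q₂` strictly on the same
side of the line `AB`. Then `|P₁Q₁| ≥ |P₂Q₂|`. -/
theorem stmt11 (r₁ r₂ : ℝ) (hr₁ : 0 < r₁) (hr₁₂ : r₁ ≤ r₂)
    (O₁ O₂ A B P₁ S₁ Q₁ R₁ P₂ S₂ Q₂ R₂ : EuclideanSpace ℝ (Fin 2))
    (hO : O₁ ≠ O₂) (hABne : A ≠ B)
    (hk : Metric.sphere O₁ r₁ ∩ Metric.sphere O₂ r₂ = {A, B})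
    (ℓ₁ ℓ₂ : AffineSubspace ℝ (EuclideanSpace ℝ (Fin 2)))
    (hpar₁ : ℓ₁.direction = (affineSpan ℝ {O₁, O₂}).direction)
    (hpar₂ : ℓ₂.direction = (affineSpan ℝ {O₁, O₂}).direction)
    -- `A`, `O₁`, `B` lie in the three different parts determined by `ℓ₁` and `ℓ₂`:
    (hsep₁ : ℓ₁.SOppSide A O₁) (hsep₁' : ℓ₁.SOppSide A B)
    (hsep₂ : ℓ₂.SOppSide B O₁) (hsep₂' : ℓ₂.SOppSide B A)
    (h₁₁ : (ℓ₁ : Set (EuclideanSpace ℝ (Fin 2))) ∩ Metric.sphere O₁ r₁ = {P₁, S₁})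
    (h₂₁ : (ℓ₂ : Set (EuclideanSpace ℝ (Fin 2))) ∩ Metric.sphere O₁ r₁ = {Q₁, R₁})
    (h₁₂ : (ℓ₁ : Set (EuclideanSpace ℝ (Fin 2))) ∩ Metric.sphere O₂ r₂ = {P₂, S₂})
    (h₂₂ : (ℓ₂ : Set (EuclideanSpace ℝ (Fin 2))) ∩ Metric.sphere O₂ r₂ = {Q₂, R₂})
    (hside₁ : (affineSpan ℝ {A, B}).SSameSide P₁ Q₁)
    (hside₂ : (affineSpan ℝ {A, B}).SSameSide P₁ P₂)
    (hside₃ : (affineSpan ℝ {A, B}).SSameSide P₁ Q₂) :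
    dist P₂ Q₂ ≤ dist P₁ Q₁ := by
  have hdist (X Y : EuclideanSpace ℝ (Fin 2)) :
      dist X Y ^ 2 = (X 0 - Y 0) ^ 2 + (X 1 - Y 1) ^ 2 := by
    rw [EuclideanSpace.dist_sq_eq, Fin.sum_univ_two, Real.dist_eq, Real.dist_eq, sq_abs, sq_abs]
  have hsphere {X O : EuclideanSpace ℝ (Fin 2)} {r : ℝ} (hX : X ∈ Metric.sphere O r) :
      (X 0 - O 0) ^ 2 + (X 1 - O 1) ^ 2 = r ^ 2 := by
    rw [← hdist, Metric.mem_sphere.1 hX]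
  have hA : A ∈ Metric.sphere O₁ r₁ ∩ Metric.sphere O₂ r₂ := hk ▸ Set.mem_insert _ _
  have hB : B ∈ Metric.sphere O₁ r₁ ∩ Metric.sphere O₂ r₂ :=
    hk ▸ Set.mem_insert_of_mem _ (Set.mem_singleton _)
  have hP₁ : P₁ ∈ (ℓ₁ : Set _) ∩ Metric.sphere O₁ r₁ := h₁₁ ▸ Set.mem_insert _ _
  have hQ₁ : Q₁ ∈ (ℓ₂ : Set _) ∩ Metric.sphere O₁ r₁ := h₂₁ ▸ Set.mem_insert _ _
  have hP₂ : P₂ ∈ (ℓ₁ : Set _) ∩ Metric.sphere O₂ r₂ := h₁₂ ▸ Set.mem_insert _ _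
  have hQ₂ : Q₂ ∈ (ℓ₂ : Set _) ∩ Metric.sphere O₂ r₂ := h₂₂ ▸ Set.mem_insert _ _
  have he : O₂ - O₁ ≠ 0 := sub_ne_zero.2 hO.symm
  have hd : B - A ≠ 0 := sub_ne_zero.2 hABne.symm
  have hdir (X Y : EuclideanSpace ℝ (Fin 2)) :
      (affineSpan ℝ {X, Y}).direction = Submodule.span ℝ {Y - X} := by
    rw [direction_affineSpan, vectorSpan_pair_rev, vsub_eq_sub]
  rw [hdir] at hpar₁ hpar₂
  have mℓ₁ X := AffineSubspace.mem_iff_planeCross_eq (x := X) he hpar₁ hP₁.1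
  have mℓ₂ X := AffineSubspace.mem_iff_planeCross_eq (x := X) he hpar₂ hQ₁.1
  have mAB X := AffineSubspace.mem_iff_planeCross_eq (x := X) hd (hdir A B)
    (left_mem_affineSpan_pair ℝ A B)
  have wP₂ := (mℓ₁ P₂).1 hP₂.1
  have wQ₂ := (mℓ₂ Q₂).1 hQ₂.1
  have oA := hsep₁'.mul_map_sub_neg mℓ₁
  have oB := hsep₂'.mul_map_sub_neg mℓ₂
  have s₁ := hside₁.mul_map_sub_pos mAB
  have s₂ := hside₂.mul_map_sub_pos mAB
  have s₃ := hside₃.mul_map_sub_pos mAB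
  have hN := EuclideanSpace.sq_add_sq_pos_of_ne_zero he
  have hD := EuclideanSpace.sq_add_sq_pos_of_ne_zero hd
  have A₁ := hsphere hA.1
  have A₂ := hsphere hA.2
  have B₁ := hsphere hB.1
  have B₂ := hsphere hB.2
  have cP₁ := hsphere hP₁.2
  have cQ₁ := hsphere hQ₁.2
  have cP₂ := hsphere hP₂.2
  have cQ₂ := hsphere hQ₂.2
  have hr : r₁ ^ 2 ≤ r₂ ^ 2 := by gcongr
  refine le_of_abs_le (abs_le_of_sq_le_sq ?_ dist_nonneg)
  rw [hdist, hdist]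
  clear mℓ₁ mℓ₂ mAB
  simp only [planeCross_apply, PiLp.sub_apply] at wP₂ wQ₂ oA oB s₁ s₂ s₃ hN hD
  exact parallel_chords_coord hr hN hD A₁ A₂ B₁ B₂ cP₁ cQ₁ cP₂ cQ₂ wP₂ wQ₂ oA oB s₁ s₂ s₃
end

section
/- In the setting of the parallel-lines lemma (circles k₁, k₂ with centers O₁ ≠ O₂ and radii 0 < r₁ ≤ r₂, k₁ ∩ k₂ = {A,B} with A ≠ B; lines ℓ₁, ℓ₂ parallel to O₁O₂ with A, O₁, B in three different parts of the plane; ℓ₁ ∩ k₁ = {P₁, S₁}, ℓ₂ ∩ k₁ = {Q₁, R₁}, ℓ₁ ∩ k₂ = {P₂, S₂}, ℓ₂ ∩ k₂ = {Q₂, R₂}, with P₁, Q₁, P₂, Q₂ all strictly on the same side of line AB), the length of the arc of k₁ from Q₁ to P₁ lying on that side is at least the length of the arc of k₂ from P₂ to Q₂ lying on that side; equivalently, r₁ · ∠P₁O₁Q₁ ≥ r₂ · ∠P₂O₂Q₂, where ∠XOY ∈ [0, π] denotes the unsigned angle at O between X and Y. -/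
open Real

section Hyperplane

variable {V P : Type*} [AddCommGroup V] [Module ℝ V] [AddTorsor V P]

/-- The value of a functional on `q -ᵥ p` decides membership of `q` in a hyperplane through `p`. -/
lemma AffineSubspace.mem_iff_of_direction_eq_ker {s : AffineSubspace ℝ P} {f : V →ₗ[ℝ] ℝ}
    (hs : s.direction = LinearMap.ker f) {p q : P} (hp : p ∈ s) :
    q ∈ s ↔ f (q -ᵥ p) = 0 := by
  rw [← LinearMap.mem_ker, ← hs, AffineSubspace.vsub_right_mem_direction_iff_mem hp]

lemma SameRay.mul_nonneg {a b : ℝ} (h : SameRay ℝ a b) : 0 ≤ a * b := by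
  rcases h with rfl | rfl | ⟨s, t, hs, ht, h⟩
  · simp
  · simp
  · simp only [smul_eq_mul] at h
    have : 0 ≤ s * (a * b) := by
      rw [← mul_assoc, h, mul_assoc]
      exact _root_.mul_nonneg ht.le (mul_self_nonneg b)
    exact nonneg_of_mul_nonneg_right this hs

/-- A functional whose kernel directs a hyperplane has a constant strict sign on each side. -/
lemma AffineSubspace.SSameSide.mul_pos {s : AffineSubspace ℝ P} {f : V →ₗ[ℝ] ℝ}
    (hs : s.direction = LinearMap.ker f) {p x y : P} (hp : p ∈ s) (h : s.SSameSide x y) :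
    0 < f (x -ᵥ p) * f (y -ᵥ p) := by
  obtain ⟨⟨p₁, hp₁, p₂, hp₂, hr⟩, hx, hy⟩ := h
  rw [mem_iff_of_direction_eq_ker hs hp] at hp₁ hp₂ hx hy
  have hr' := (hr.map f).mul_nonneg
  rw [← vsub_sub_vsub_cancel_right x p₁ p, ← vsub_sub_vsub_cancel_right y p₂ p, map_sub, map_sub,
    hp₁, hp₂, sub_zero, sub_zero] at hr'
  exact lt_of_le_of_ne hr' (mul_ne_zero hx hy).symm

/-- A functional whose kernel directs a hyperplane has strictly opposite signs on its sides. -/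
lemma AffineSubspace.SOppSide.mul_neg {s : AffineSubspace ℝ P} {f : V →ₗ[ℝ] ℝ}
    (hs : s.direction = LinearMap.ker f) {p x y : P} (hp : p ∈ s) (h : s.SOppSide x y) :
    f (x -ᵥ p) * f (y -ᵥ p) < 0 := by
  obtain ⟨⟨p₁, hp₁, p₂, hp₂, hr⟩, hx, hy⟩ := h
  rw [mem_iff_of_direction_eq_ker hs hp] at hp₁ hp₂ hx hy
  have hr' := (hr.map f).mul_nonneg
  rw [← vsub_sub_vsub_cancel_right x p₁ p, ← vsub_sub_vsub_cancel_right p₂ y p, map_sub, map_sub,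
    hp₁, hp₂, sub_zero, zero_sub, _root_.mul_neg, neg_nonneg] at hr'
  exact lt_of_le_of_ne hr' (mul_ne_zero hx hy)

end Hyperplane

section RectangularCoordinates

/-- Rectangular coordinates of the plane whose first axis points along `d`. -/
lemma EuclideanSpace.exists_coordinates (d : EuclideanSpace ℝ (Fin 2)) (hd : d ≠ 0) :
    ∃ X Y : EuclideanSpace ℝ (Fin 2) →ₗ[ℝ] ℝ, Y d = 0 ∧
      ∀ v w, inner ℝ v w = X v * X w + Y v * Y w := by
  have hn : ‖d‖ ≠ 0 := norm_ne_zero_iff.mpr hd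
  have hsq : d 0 ^ 2 + d 1 ^ 2 = ‖d‖ ^ 2 := by
    simp [EuclideanSpace.real_norm_sq_eq, Fin.sum_univ_two]
  refine ⟨‖d‖⁻¹ • innerₛₗ ℝ d, ‖d‖⁻¹ • innerₛₗ ℝ !₂[-d 1, d 0], ?_, fun v w => ?_⟩
  · simp [PiLp.inner_apply, Fin.sum_univ_two]
    right
    ring
  · simp [PiLp.inner_apply, Fin.sum_univ_two]
    field_simp
    rw [← hsq]
    ring

/-- In rectangular coordinates the kernel of a coordinate is spanned by any of its nonzero
vectors. -/
lemma span_singleton_eq_ker_of_coordinates {V : Type*} [NormedAddCommGroup V]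
    [InnerProductSpace ℝ V] {f g : V →ₗ[ℝ] ℝ}
    (hfg : ∀ v w, inner ℝ v w = f v * f w + g v * g w) {d : V} (hd : d ≠ 0) (hf : f d = 0) :
    Submodule.span ℝ {d} = LinearMap.ker f := by
  have hzero : ∀ v, f v = 0 → g v = 0 → v = 0 := fun v h₁ h₂ => by
    rw [← inner_self_eq_zero (𝕜 := ℝ), hfg, h₁, h₂]
    simp
  have hg : g d ≠ 0 := fun h => hd (hzero d hf h)
  refine le_antisymm (by simpa using hf) fun v hv => ?_
  rw [LinearMap.mem_ker] at hv
  refine Submodule.mem_span_singleton.mpr ⟨g v / g d, ?_⟩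
  refine sub_eq_zero.mp (hzero _ ?_ ?_)
  · simp [hf, hv]
  · simp [hg]

end RectangularCoordinates

section Arcsin

/-- With `h` fixed, the length `r * arcsin (h / r)` of the arc of height `h` above the horizontal
radius decreases as the radius grows. -/
lemma mul_arcsin_div_antitone {r₁ r₂ h : ℝ} (hr₁ : 0 < r₁) (hr₁₂ : r₁ ≤ r₂) (hh : 0 ≤ h)
    (hhr : h ≤ r₁) : r₂ * arcsin (h / r₂) ≤ r₁ * arcsin (h / r₁) := by
  have hr₂ : 0 < r₂ := hr₁.trans_le hr₁₂
  set α := arcsin (h / r₁) with hα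
  have hα₀ : 0 ≤ α := arcsin_nonneg.mpr (by positivity)
  have hα₁ : α ≤ π / 2 := arcsin_le_pi_div_two _
  have hsin : sin α = h / r₁ :=
    sin_arcsin (by linarith [div_nonneg hh hr₁.le]) ((div_le_one hr₁).mpr hhr)
  have ht₀ : 0 ≤ r₁ / r₂ := by positivity
  have ht₁ : r₁ / r₂ ≤ 1 := (div_le_one hr₂).mpr hr₁₂
  have hconc := strictConcaveOn_sin_Icc.concaveOn.2 (x := 0) (y := α)
    ⟨le_rfl, pi_pos.le⟩ ⟨hα₀, by linarith [pi_pos]⟩ (sub_nonneg.mpr ht₁) ht₀ (by ring)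
  simp only [sin_zero, smul_eq_mul, mul_zero, zero_add, hsin] at hconc
  have hle : arcsin (h / r₂) ≤ r₁ / r₂ * α := by
    have hmul : r₁ / r₂ * α ≤ π / 2 := (mul_le_of_le_one_left hα₀ ht₁).trans hα₁
    have hmul₀ : 0 ≤ r₁ / r₂ * α := by positivity
    rw [← arcsin_sin (by linarith [pi_pos]) hmul]
    refine monotone_arcsin ?_
    calc h / r₂ = r₁ / r₂ * (h / r₁) := by field_simp
      _ ≤ _ := hconc
  calc r₂ * arcsin (h / r₂) ≤ r₂ * (r₁ / r₂ * α) := by gcongr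
    _ = r₁ * α := by field_simp

/-- The angle between the points `(x, h)` and `(y, k)` of a circle of radius `r` about the origin,
when they lie in the same horizontal and in different vertical half-planes. -/
lemma arccos_eq_arcsin_add_arcsin {r x y h k : ℝ} (hr : 0 < r) (hx : x ^ 2 + h ^ 2 = r ^ 2)
    (hy : y ^ 2 + k ^ 2 = r ^ 2) (hxy : 0 ≤ x * y) (hhk : h * k ≤ 0) :
    arccos ((x * y + h * k) / (r * r)) = arcsin (|h| / r) + arcsin (|k| / r) := by
  have hcos : ∀ {x h : ℝ}, x ^ 2 + h ^ 2 = r ^ 2 →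
      sin (arcsin (|h| / r)) = |h| / r ∧ cos (arcsin (|h| / r)) = |x| / r := by
    intro x h hx
    constructor
    · refine sin_arcsin (by linarith [div_nonneg (abs_nonneg h) hr.le]) ((div_le_one hr).mpr ?_)
      exact abs_le_of_sq_le_sq (by linarith [sq_nonneg x]) hr.le
    · rw [cos_arcsin, ← sqrt_sq (show 0 ≤ |x| / r by positivity)]
      congr 1
      rw [div_pow, div_pow, sq_abs, sq_abs]
      field_simp
      linarith
  obtain ⟨hs₁, hc₁⟩ := hcos hx
  obtain ⟨hs₂, hc₂⟩ := hcos hy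
  have h₁ : 0 ≤ arcsin (|h| / r) := arcsin_nonneg.mpr (by positivity)
  have h₂ : 0 ≤ arcsin (|k| / r) := arcsin_nonneg.mpr (by positivity)
  rw [← arccos_cos (add_nonneg h₁ h₂)
    (by linarith [arcsin_le_pi_div_two (|h| / r), arcsin_le_pi_div_two (|k| / r)]),
    cos_add, hs₁, hs₂, hc₁, hc₂]
  congr 1
  rw [div_mul_div_comm, div_mul_div_comm, ← abs_mul, ← abs_mul, abs_of_nonneg hxy,
    abs_of_nonpos hhk]
  ring

end Arcsin

/-- If `x` and `y` are at least as far from `0` as `c`, and lie on the same side of `-c`, then they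
lie on the same side of `0`. -/
lemma mul_nonneg_of_mul_add_pos {x y c : ℝ} (hx : c ^ 2 ≤ x ^ 2) (hy : c ^ 2 ≤ y ^ 2)
    (h : 0 < (x + c) * (y + c)) : 0 ≤ x * y := by
  rw [sq_le_sq] at hx hy
  have := neg_abs_le c
  have := le_abs_self c
  rcases pos_and_pos_or_neg_and_neg_of_mul_pos h with ⟨h₁, h₂⟩ | ⟨h₁, h₂⟩ <;>
    rcases abs_cases x with ⟨h₃, h₄⟩ | ⟨h₃, h₄⟩ <;> rcases abs_cases y with ⟨h₅, h₆⟩ | ⟨h₅, h₆⟩ <;>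
    nlinarith

/-- If `h` lies strictly between `0` and `a`, and `k` strictly between `0` and `-a`, then `h` and
`k` have opposite signs and are at most `a` in absolute value. -/
lemma heights_between {a h k : ℝ} (hh : (a - h) * -h < 0) (hk : (-a - k) * -k < 0) :
    h ^ 2 ≤ a ^ 2 ∧ k ^ 2 ≤ a ^ 2 ∧ h * k ≤ 0 := by
  refine ⟨by nlinarith [sq_nonneg (a - h)], by nlinarith [sq_nonneg (a + k)], ?_⟩
  have h₁ : 0 < a * h := by nlinarith [sq_nonneg h]
  have h₂ : 0 < -(a * k) := by nlinarith [sq_nonneg k]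
  by_contra! h₃
  nlinarith [mul_pos h₁ h₂, mul_nonneg (sq_nonneg a) h₃.le]

/-- In coordinates centred at `O`, the angle between two points of a circle in different vertical
half-planes, both lying beyond the vertical line through a point `A` of the circle. -/
lemma angle_eq_arcsin_add_arcsin {V P : Type*} [NormedAddCommGroup V] [InnerProductSpace ℝ V]
    [MetricSpace P] [NormedAddTorsor V P] {X Y : V →ₗ[ℝ] ℝ}
    (hXY : ∀ v w, inner ℝ v w = X v * X w + Y v * Y w) {r : ℝ} (hr : 0 < r) {O A p q : P}
    (hA : dist A O = r) (hp : dist p O = r) (hq : dist q O = r)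
    (hpA : Y (p -ᵥ O) ^ 2 ≤ Y (A -ᵥ O) ^ 2) (hqA : Y (q -ᵥ O) ^ 2 ≤ Y (A -ᵥ O) ^ 2)
    (hside : 0 < X (p -ᵥ A) * X (q -ᵥ A)) (hY : Y (p -ᵥ O) * Y (q -ᵥ O) ≤ 0) :
    EuclideanGeometry.angle p O q =
      arcsin (|Y (p -ᵥ O)| / r) + arcsin (|Y (q -ᵥ O)| / r) := by
  have hsq : ∀ {z : P}, dist z O = r → X (z -ᵥ O) ^ 2 + Y (z -ᵥ O) ^ 2 = r ^ 2 := by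
    intro z hz
    rw [← hz, dist_eq_norm_vsub V, ← real_inner_self_eq_norm_sq, hXY]
    ring
  have hA' := hsq hA
  have hp' := hsq hp
  have hq' := hsq hq
  rw [← vsub_sub_vsub_cancel_right p A O, ← vsub_sub_vsub_cancel_right q A O, map_sub, map_sub]
    at hside
  have hX : 0 ≤ X (p -ᵥ O) * X (q -ᵥ O) :=
    mul_nonneg_of_mul_add_pos (c := -X (A -ᵥ O)) (by linarith [neg_sq (X (A -ᵥ O))])
      (by linarith [neg_sq (X (A -ᵥ O))]) (by simpa only [sub_eq_add_neg] using hside)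
  rw [EuclideanGeometry.angle, InnerProductGeometry.angle, hXY, ← dist_eq_norm_vsub V,
    ← dist_eq_norm_vsub V, hp, hq]
  exact arccos_eq_arcsin_add_arcsin hr hp' hq' hX hY


/-- Corollary on arc lengths: two circles `k₁`, `k₂` with centers
`O₁ ≠ O₂` and radii `0 < r₁ ≤ r₂` meet in exactly the two points `A ≠ B`; two lines
`ℓ₁`, `ℓ₂` parallel to the line `O₁O₂` separate the plane into three parts with `A`,
`O₁`, `B` in different parts; `ℓ₁ ∩ k₁ = {P₁, S₁}`, `ℓ₂ ∩ k₁ = {Q₁, R₁}`,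
`ℓ₁ ∩ k₂ = {P₂, S₂}`, `ℓ₂ ∩ k₂ = {Q₂, R₂}` with `P₁, Q₁, P₂, Q₂` strictly on the same
side of the line `AB`. Then the arc of `k₁` from `Q₁` to `P₁` on that side is at least as long as the arc of
`k₂` from `P₂` to `Q₂` on that side; equivalently `r₁·∠P₁O₁Q₁ ≥ r₂·∠P₂O₂Q₂`. -/
theorem stmt12 (r₁ r₂ : ℝ) (hr₁ : 0 < r₁) (hr₁₂ : r₁ ≤ r₂)
    (O₁ O₂ A B P₁ S₁ Q₁ R₁ P₂ S₂ Q₂ R₂ : EuclideanSpace ℝ (Fin 2))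
    (hO : O₁ ≠ O₂) (hABne : A ≠ B)
    (hk : Metric.sphere O₁ r₁ ∩ Metric.sphere O₂ r₂ = {A, B})
    (ℓ₁ ℓ₂ : AffineSubspace ℝ (EuclideanSpace ℝ (Fin 2)))
    (hpar₁ : ℓ₁.direction = (affineSpan ℝ {O₁, O₂}).direction)
    (hpar₂ : ℓ₂.direction = (affineSpan ℝ {O₁, O₂}).direction)
    -- `A`, `O₁`, `B` lie in the three different parts determined by `ℓ₁` and `ℓ₂`:
    (hsep₁ : ℓ₁.SOppSide A O₁) (hsep₁' : ℓ₁.SOppSide A B)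
    (hsep₂ : ℓ₂.SOppSide B O₁) (hsep₂' : ℓ₂.SOppSide B A)
    (h₁₁ : (ℓ₁ : Set (EuclideanSpace ℝ (Fin 2))) ∩ Metric.sphere O₁ r₁ = {P₁, S₁})
    (h₂₁ : (ℓ₂ : Set (EuclideanSpace ℝ (Fin 2))) ∩ Metric.sphere O₁ r₁ = {Q₁, R₁})
    (h₁₂ : (ℓ₁ : Set (EuclideanSpace ℝ (Fin 2))) ∩ Metric.sphere O₂ r₂ = {P₂, S₂})
    (h₂₂ : (ℓ₂ : Set (EuclideanSpace ℝ (Fin 2))) ∩ Metric.sphere O₂ r₂ = {Q₂, R₂})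
    (hside₁ : (affineSpan ℝ {A, B}).SSameSide P₁ Q₁)
    (hside₂ : (affineSpan ℝ {A, B}).SSameSide P₁ P₂)
    (hside₃ : (affineSpan ℝ {A, B}).SSameSide P₁ Q₂) :
    r₂ * EuclideanGeometry.angle P₂ O₂ Q₂ ≤ r₁ * EuclideanGeometry.angle P₁ O₁ Q₁ := by
  have hr₂ : 0 < r₂ := hr₁.trans_le hr₁₂
  obtain ⟨X, Y, hYd, hXY⟩ :=
    EuclideanSpace.exists_coordinates (O₂ -ᵥ O₁) (vsub_ne_zero.mpr hO.symm)
  have hker : (affineSpan ℝ {O₁, O₂}).direction = LinearMap.ker Y := by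
    rw [direction_affineSpan, vectorSpan_pair_rev]
    exact span_singleton_eq_ker_of_coordinates (fun v w => by rw [hXY, add_comm])
      (vsub_ne_zero.mpr hO.symm) hYd
  rw [hker] at hpar₁ hpar₂
  have hA : A ∈ Metric.sphere O₁ r₁ ∩ Metric.sphere O₂ r₂ := hk ▸ Set.mem_insert _ _
  have hB : B ∈ Metric.sphere O₁ r₁ ∩ Metric.sphere O₂ r₂ := hk ▸ Set.mem_insert_of_mem _ rfl
  have hP₁ := h₁₁.symm ▸ Set.mem_insert P₁ {S₁}
  have hQ₁ := h₂₁.symm ▸ Set.mem_insert Q₁ {R₁}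
  have hP₂ := h₁₂.symm ▸ Set.mem_insert P₂ {S₂}
  have hQ₂ := h₂₂.symm ▸ Set.mem_insert Q₂ {R₂}
  simp only [Set.mem_inter_iff, Metric.mem_sphere, SetLike.mem_coe] at hA hB hP₁ hQ₁ hP₂ hQ₂
  have hsq : ∀ {z O : EuclideanSpace ℝ (Fin 2)} {r : ℝ}, dist z O = r →
      (X z - X O) ^ 2 + (Y z - Y O) ^ 2 = r ^ 2 := by
    intro z O r hz
    rw [← hz, dist_eq_norm, ← real_inner_self_eq_norm_sq, hXY, map_sub, map_sub]
    ring
  have hA₁ := hsq hA.1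
  have hA₂ := hsq hA.2
  have hB₁ := hsq hB.1
  have hB₂ := hsq hB.2
  have hYO : Y O₂ = Y O₁ := by simpa [sub_eq_zero] using hYd
  have hXO : X O₂ - X O₁ ≠ 0 := by
    intro h
    have := hXY (O₂ - O₁) (O₂ - O₁)
    rw [map_sub, map_sub, h, hYO] at this
    exact hO (sub_eq_zero.mp (inner_self_eq_zero.mp (this.trans (by ring)))).symm
  have hXAB : X B = X A := by
    rw [hYO] at hA₂ hB₂
    exact mul_right_cancel₀ hXO (by linarith)
  have hkerAB : (affineSpan ℝ {A, B}).direction = LinearMap.ker X := by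
    rw [direction_affineSpan, vectorSpan_pair_rev]
    exact span_singleton_eq_ker_of_coordinates hXY (vsub_ne_zero.mpr hABne.symm)
      (by simp [hXAB])
  have hAmem : A ∈ affineSpan ℝ {A, B} := left_mem_affineSpan_pair ℝ A B
  have hs₁ := hside₁.mul_pos hkerAB hAmem
  have hs₂ := (hside₂.symm.trans hside₃).mul_pos hkerAB hAmem
  have ho₁ := hsep₁.mul_neg hpar₁ hP₁.1
  have ho₁' := hsep₁'.mul_neg hpar₁ hP₁.1
  have ho₂ := hsep₂.mul_neg hpar₂ hQ₁.1
  have hYP := (AffineSubspace.mem_iff_of_direction_eq_ker hpar₁ hP₁.1).mp hP₂.1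
  have hYQ := (AffineSubspace.mem_iff_of_direction_eq_ker hpar₂ hQ₁.1).mp hQ₂.1
  simp only [vsub_eq_sub, map_sub] at ho₁ ho₁' ho₂ hYP hYQ
  rw [hXAB] at hB₁
  have hYB : Y B - Y O₁ = -(Y A - Y O₁) := by
    rcases sq_eq_sq_iff_eq_or_eq_neg.mp (show (Y B - Y O₁) ^ 2 = (Y A - Y O₁) ^ 2 by linarith)
      with h | h
    · rw [sub_left_injective h] at ho₁'
      exact absurd ho₁' (mul_self_nonneg _).not_gt
    · exact h
  obtain ⟨hh, hk', hneg⟩ := heights_between (a := Y (A -ᵥ O₁)) (h := Y (P₁ -ᵥ O₁))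
    (k := Y (Q₁ -ᵥ O₁)) (by simp only [vsub_eq_sub, map_sub]; linarith)
    (by simp only [vsub_eq_sub, map_sub]; rw [← hYB]; linarith)
  have hYP' : Y (P₂ -ᵥ O₂) = Y (P₁ -ᵥ O₁) := by
    simp only [vsub_eq_sub, map_sub]; linarith
  have hYQ' : Y (Q₂ -ᵥ O₂) = Y (Q₁ -ᵥ O₁) := by
    simp only [vsub_eq_sub, map_sub]; linarith
  have hYA' : Y (A -ᵥ O₂) = Y (A -ᵥ O₁) := by
    simp only [vsub_eq_sub, map_sub]; linarith
  rw [angle_eq_arcsin_add_arcsin hXY hr₁ hA.1 hP₁.2 hQ₁.2 hh hk' hs₁ hneg,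
    angle_eq_arcsin_add_arcsin hXY hr₂ hA.2 hP₂.2 hQ₂.2 (by rwa [hYP', hYA'])
      (by rwa [hYQ', hYA']) hs₂ (by rwa [hYP', hYQ']), hYP', hYQ', mul_add, mul_add]
  have hle : ∀ {z : EuclideanSpace ℝ (Fin 2)}, dist z O₁ = r₁ → |Y (z -ᵥ O₁)| ≤ r₁ := by
    intro z hz
    refine abs_le_of_sq_le_sq ?_ hr₁.le
    rw [vsub_eq_sub, map_sub]
    linarith [hsq hz, sq_nonneg (X z - X O₁)]
  exact add_le_add (mul_arcsin_div_antitone hr₁ hr₁₂ (abs_nonneg _) (hle hP₁.2))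
    (mul_arcsin_div_antitone hr₁ hr₁₂ (abs_nonneg _) (hle hQ₁.2))
end

section
/- Fix r > 0, a finite set of points {O_i}_{i ∈ I} in the Euclidean plane ℝ², and a closed ball ℬ' = closedBall(O', r') with r' ≤ r/3. Assume the circles {sphere(O_i, r)}_{i ∈ I} together with sphere(O', r') are in general position (any two of these circles are either disjoint or intersect transversally in exactly two points, and no point lies on three of them). Let ℛ₁ = ℬ' ∩ (⋃_{i ∈ I} closedBall(O_i, r)) and ℛ₂ = ℬ' \ ℛ₁. Then the length (one-dimensional Hausdorff measure) of the boundary between ℛ₁ and ℛ₂, namely ℋ¹( frontier(⋃_{i ∈ I} closedBall(O_i, r)) ∩ ℬ' ), is at most the perimeter of ℬ', i.e. at most 2π r'. -/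
open MeasureTheory
open scoped ENNReal

/-! ### Counting boundary points of open subsets of the line -/

lemma exists_mem_frontier_of_mem_of_notMem {S : Set ℝ} {A : Set ℝ} (hA : IsPreconnected A)
    {x y : ℝ} (hxA : x ∈ A) (hyA : y ∈ A) (hx : x ∈ S) (hy : y ∉ S) :
    ∃ z ∈ A, z ∈ frontier S := by
  by_contra! h
  have h1 : A ⊆ interior S ∪ (closure S)ᶜ := by
    intro z hz
    by_contra hz'
    simp only [Set.mem_union, Set.mem_compl_iff, not_or, not_not] at hz'
    exact h z hz ⟨hz'.2, hz'.1⟩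
  have hx' : x ∈ interior S := by
    rcases h1 hxA with h2 | h2
    · exact h2
    · exact absurd (subset_closure hx) h2
  have hy' : y ∈ (closure S)ᶜ := by
    rcases h1 hyA with h2 | h2
    · exact absurd (interior_subset h2) hy
    · exact h2
  obtain ⟨z, -, hz1, hz2⟩ := hA _ _ isOpen_interior isClosed_closure.isOpen_compl h1
    ⟨x, hxA, hx'⟩ ⟨y, hyA, hy'⟩
  exact hz2 (subset_closure (interior_subset hz1))

lemma exists_mem_frontier_Ioc {S : Set ℝ} (hS : IsOpen S) {x y : ℝ} (hxy : x ≤ y)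
    (hx : x ∈ S) (hy : y ∉ S) : ∃ z ∈ Set.Ioc x y, z ∈ frontier S := by
  obtain ⟨z, hz, hzS⟩ := exists_mem_frontier_of_mem_of_notMem isPreconnected_Icc
    (Set.left_mem_Icc.2 hxy) (Set.right_mem_Icc.2 hxy) hx hy
  refine ⟨z, ⟨lt_of_le_of_ne hz.1 ?_, hz.2⟩, hzS⟩
  rintro rfl
  rw [hS.frontier_eq] at hzS
  exact hzS.2 hx

lemma exists_mem_frontier_Ico {S : Set ℝ} (hS : IsOpen S) {x y : ℝ} (hxy : x ≤ y)
    (hx : x ∉ S) (hy : y ∈ S) : ∃ z ∈ Set.Ico x y, z ∈ frontier S := by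
  obtain ⟨z, hz, hzS⟩ := exists_mem_frontier_of_mem_of_notMem isPreconnected_Icc
    (Set.right_mem_Icc.2 hxy) (Set.left_mem_Icc.2 hxy) hy hx
  refine ⟨z, ⟨hz.1, lt_of_le_of_ne hz.2 ?_⟩, hzS⟩
  rintro rfl
  rw [hS.frontier_eq] at hzS
  exact hzS.2 hy

lemma frontier_diff_Icc_subset {S : Set ℝ} (hS : IsOpen S) {a b : ℝ} (hab : a ≤ b)
    (ha : a ∉ frontier S) (hb : b ∉ frontier S) :
    frontier (S \ Set.Icc a b) ⊆ (frontier S \ Set.Ioo a b) ∪ ({a, b} ∩ S) := by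
  intro x hx
  rw [Set.sdiff_eq] at hx
  rcases frontier_inter_subset _ _ hx with ⟨h1, h2⟩ | ⟨h1, h2⟩
  · left
    rw [closure_compl, interior_Icc] at h2
    exact ⟨h1, h2⟩
  · right
    rw [frontier_compl, frontier_Icc hab] at h2
    refine ⟨h2, ?_⟩
    by_contra hxS
    have : x ∈ frontier S := by rw [hS.frontier_eq]; exact ⟨h1, hxS⟩
    rcases h2 with rfl | rfl
    · exact ha this
    · exact hb this

lemma count_add_le_of_subset {A T W Z : Set ℝ} {k : ℝ≥0∞} (hZ : MeasurableSet Z) (hZA : Z ⊆ A)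
    (hT : T ⊆ (A \ Z) ∪ W)
    (hW : Measure.count W + k ≤ Measure.count Z) :
    Measure.count T + k ≤ Measure.count A :=
  calc Measure.count T + k ≤ Measure.count (A \ Z) + Measure.count W + k := by
        gcongr; exact (measure_mono hT).trans (measure_union_le _ _)
    _ = Measure.count (A \ Z) + (Measure.count W + k) := add_assoc _ _ _
    _ ≤ Measure.count (A \ Z) + Measure.count Z := by gcongr
    _ = Measure.count A := by
      rw [add_comm, ← measure_inter_add_sdiff A hZ, Set.inter_eq_right.2 hZA]

lemma count_pair {x y : ℝ} (h : x ≠ y) : Measure.count ({x, y} : Set ℝ) = 2 := by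
  rw [Measure.count_apply (by measurability), Set.encard_pair h]; rfl

lemma count_pair_le (x y : ℝ) : Measure.count ({x, y} : Set ℝ) ≤ 2 := by
  by_cases h : x = y
  · subst h; simp
  · exact (count_pair h).le

lemma count_frontier_diff_Icc_le_add {S : Set ℝ} (hS : IsOpen S) {a b : ℝ} (hab : a ≤ b)
    (ha : a ∉ frontier S) (hb : b ∉ frontier S) :
    Measure.count (frontier (S \ Set.Icc a b)) ≤ Measure.count (frontier S) + 2 := by
  refine (measure_mono (frontier_diff_Icc_subset hS hab ha hb)).trans
    ((measure_union_le _ _).trans (add_le_add (measure_mono Set.sdiff_subset)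
      ((measure_mono Set.inter_subset_left).trans (count_pair_le _ _))))

lemma count_frontier_diff_Icc_le {S : Set ℝ} (hS : IsOpen S) {a b : ℝ} (hab : a ≤ b)
    (ha : a ∉ frontier S) (hb : b ∉ frontier S) (h : ¬ (a ∈ S ∧ b ∈ S)) :
    Measure.count (frontier (S \ Set.Icc a b)) ≤ Measure.count (frontier S) := by
  have hsub := frontier_diff_Icc_subset hS hab ha hb
  by_cases haS : a ∈ S
  · have hbS : b ∉ S := fun hbS => h ⟨haS, hbS⟩
    obtain ⟨z, hz, hzS⟩ := exists_mem_frontier_Ioc hS hab haS hbS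
    have hzb : z < b := lt_of_le_of_ne hz.2 (by rintro rfl; exact hb hzS)
    have := count_add_le_of_subset (A := frontier S) (W := {a}) (Z := {z}) (k := 0)
      (measurableSet_singleton z) (by simpa using hzS) (T := frontier (S \ Set.Icc a b)) ?_ (by simp)
    · simpa using this
    · intro x hx
      rcases hsub hx with ⟨h1, h2⟩ | ⟨h1, h2⟩
      · left; refine ⟨h1, ?_⟩; rintro rfl; exact h2 ⟨hz.1, hzb⟩
      · right
        rcases h1 with rfl | rfl
        · rfl
        · exact absurd h2 hbS
  · by_cases hbS : b ∈ S
    · obtain ⟨z, hz, hzS⟩ := exists_mem_frontier_Ico hS hab haS hbS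
      have hzb : a < z := lt_of_le_of_ne hz.1 (by rintro rfl; exact ha hzS)
      have := count_add_le_of_subset (A := frontier S) (W := {b}) (Z := {z}) (k := 0)
        (measurableSet_singleton z) (by simpa using hzS) (T := frontier (S \ Set.Icc a b)) ?_
        (by simp)
      · simpa using this
      · intro x hx
        rcases hsub hx with ⟨h1, h2⟩ | ⟨h1, h2⟩
        · left; refine ⟨h1, ?_⟩; rintro rfl; exact h2 ⟨hzb, hz.2⟩
        · right
          rcases h1 with rfl | rfl
          · exact absurd h2 haS
          · rfl
    · refine measure_mono fun x hx => ?_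
      rcases hsub hx with ⟨h1, h2⟩ | ⟨rfl | rfl, h2⟩
      · exact h1
      · exact absurd h2 haS
      · exact absurd h2 hbS

lemma count_frontier_diff_Icc_add_le {S : Set ℝ} (hS : IsOpen S) {a b x : ℝ}
    (ha : a ∉ frontier S) (hb : b ∉ frontier S) (haS : a ∉ S) (hbS : b ∉ S)
    (hax : a < x) (hxb : x < b) (hx : x ∈ S) :
    Measure.count (frontier (S \ Set.Icc a b)) + 2 ≤ Measure.count (frontier S) := by
  obtain ⟨z, hz, hzS⟩ := exists_mem_frontier_Ico hS hax.le haS hx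
  obtain ⟨w, hw, hwS⟩ := exists_mem_frontier_Ioc hS hxb.le hx hbS
  have haz : a < z := lt_of_le_of_ne hz.1 (by rintro rfl; exact ha hzS)
  have hwb : w < b := lt_of_le_of_ne hw.2 (by rintro rfl; exact hb hwS)
  have hzw : z < w := hz.2.trans hw.1
  refine count_add_le_of_subset (A := frontier S) (W := ∅) (Z := {z, w})
    (by measurability) ?_ ?_ ?_
  · rintro y (rfl | rfl) <;> assumption
  · intro y hy
    rcases frontier_diff_Icc_subset hS (hax.trans hxb).le ha hb hy with ⟨h1, h2⟩ | ⟨rfl | rfl, h2⟩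
    · left; refine ⟨h1, ?_⟩
      rintro (rfl | rfl)
      · exact h2 ⟨haz, hzw.trans hwb⟩
      · exact h2 ⟨haz.trans hzw, hwb⟩
    · exact absurd h2 haS
    · exact absurd h2 hbS
  · rw [count_pair hzw.ne]; simp

lemma count_frontier_diff_Icc_le_of_gap {S : Set ℝ} (hS : IsOpen S) {a b z w : ℝ}
    (ha : a ∉ frontier S) (hb : b ∉ frontier S)
    (haz : a < z) (hzw : z < w) (hwb : w < b) (hgap : ∀ y ∈ Set.Icc z w, y ∉ S) :
    Measure.count (frontier (S \ Set.Icc a b)) ≤ Measure.count (frontier S) := by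
  have hab : a ≤ b := (haz.trans (hzw.trans hwb)).le
  by_cases h : a ∈ S ∧ b ∈ S
  · obtain ⟨z', hz, hzS⟩ := exists_mem_frontier_Ioc hS haz.le h.1 (hgap z ⟨le_rfl, hzw.le⟩)
    obtain ⟨w', hw, hwS⟩ := exists_mem_frontier_Ico hS hwb.le (hgap w ⟨hzw.le, le_rfl⟩) h.2
    have hzw' : z' < w' := hz.2.trans_lt (hzw.trans_le hw.1)
    have := count_add_le_of_subset (A := frontier S) (W := {a, b}) (Z := {z', w'}) (k := 0)
      (by measurability) ?_ (T := frontier (S \ Set.Icc a b)) ?_ ?_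
    · simpa using this
    · rintro y (rfl | rfl) <;> assumption
    · intro y hy
      rcases frontier_diff_Icc_subset hS hab ha hb hy with ⟨h1, h2⟩ | ⟨h1, h2⟩
      · left; refine ⟨h1, ?_⟩
        rintro (rfl | rfl)
        · exact h2 ⟨hz.1, hzw'.trans hw.2⟩
        · exact h2 ⟨hz.1.trans hzw', hw.2⟩
      · right; exact h1
    · rw [count_pair hzw'.ne, add_zero]; exact count_pair_le _ _
  · exact count_frontier_diff_Icc_le hS hab ha hb h

/-! ### Horizontal slices of the complement of a union of discs -/

/-- The slice at height `t` of the open disc of radius `R` about the origin with the closed discs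
of radius `r` centred at the points of `F` removed. -/
def discSlice (r R : ℝ) (F : Finset (ℝ × ℝ)) (t : ℝ) : Set ℝ :=
  {x | x ^ 2 + t ^ 2 < R ^ 2 ∧ ∀ c ∈ F, r ^ 2 < (x - c.1) ^ 2 + (t - c.2) ^ 2}

/-- The number of boundary points of `discSlice r R F t`. -/
noncomputable def sliceCount (r R : ℝ) (F : Finset (ℝ × ℝ)) (t : ℝ) : ℝ≥0∞ :=
  Measure.count (frontier (discSlice r R F t))

lemma isOpen_discSlice (r R : ℝ) (F : Finset (ℝ × ℝ)) (t : ℝ) : IsOpen (discSlice r R F t) := by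
  have : discSlice r R F t = {x | x ^ 2 + t ^ 2 < R ^ 2} ∩
      ⋂ c ∈ F, {x | r ^ 2 < (x - c.1) ^ 2 + (t - c.2) ^ 2} := by
    ext x; simp [discSlice]
  rw [this]
  exact (isOpen_lt (by fun_prop) (by fun_prop)).inter
    (isOpen_biInter_finset fun c _ => isOpen_lt (by fun_prop) (by fun_prop))

lemma closure_discSlice_subset (r R : ℝ) (F : Finset (ℝ × ℝ)) (t : ℝ) :
    closure (discSlice r R F t) ⊆
      {x | x ^ 2 + t ^ 2 ≤ R ^ 2 ∧ ∀ c ∈ F, r ^ 2 ≤ (x - c.1) ^ 2 + (t - c.2) ^ 2} := by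
  apply closure_minimal
  · exact fun x hx => ⟨hx.1.le, fun c hc => (hx.2 c hc).le⟩
  · have : {x | x ^ 2 + t ^ 2 ≤ R ^ 2 ∧ ∀ c ∈ F, r ^ 2 ≤ (x - c.1) ^ 2 + (t - c.2) ^ 2} =
        {x | x ^ 2 + t ^ 2 ≤ R ^ 2} ∩ ⋂ c ∈ F, {x | r ^ 2 ≤ (x - c.1) ^ 2 + (t - c.2) ^ 2} := by
      ext x; simp
    rw [this]
    exact (isClosed_le (by fun_prop) (by fun_prop)).inter
      (isClosed_biInter fun c _ => isClosed_le (by fun_prop) (by fun_prop))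

lemma eq_of_mem_frontier_discSlice {r R : ℝ} {F : Finset (ℝ × ℝ)} {t x : ℝ}
    (hx : x ∈ frontier (discSlice r R F t)) :
    x ^ 2 + t ^ 2 = R ^ 2 ∨ ∃ c ∈ F, (x - c.1) ^ 2 + (t - c.2) ^ 2 = r ^ 2 := by
  rw [(isOpen_discSlice r R F t).frontier_eq] at hx
  obtain ⟨h1, h2⟩ := closure_discSlice_subset r R F t hx.1
  by_contra! h
  exact hx.2 ⟨lt_of_le_of_ne h1 h.1, fun c hc => lt_of_le_of_ne (h2 c hc) (h.2 c hc).symm⟩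

lemma mem_Icc_halfChord_iff {r a t x y : ℝ} (h : (t - y) ^ 2 ≤ r ^ 2) :
    x ∈ Set.Icc (a - √(r ^ 2 - (t - y) ^ 2)) (a + √(r ^ 2 - (t - y) ^ 2)) ↔
      (x - a) ^ 2 + (t - y) ^ 2 ≤ r ^ 2 := by
  rw [← le_sub_iff_add_le, ← sq_abs (x - a), ← Real.le_sqrt (abs_nonneg _) (by linarith), abs_le,
    Set.mem_Icc]
  constructor <;> rintro ⟨h1, h2⟩ <;> constructor <;> linarith

lemma discSlice_insert (r R : ℝ) (F : Finset (ℝ × ℝ)) (c : ℝ × ℝ) {t : ℝ}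
    (h : (t - c.2) ^ 2 ≤ r ^ 2) :
    discSlice r R (insert c F) t = discSlice r R F t \
      Set.Icc (c.1 - √(r ^ 2 - (t - c.2) ^ 2)) (c.1 + √(r ^ 2 - (t - c.2) ^ 2)) := by
  ext x
  rw [Set.mem_sdiff, mem_Icc_halfChord_iff h, not_le]
  simp only [discSlice, Finset.forall_mem_insert, Set.mem_ofPred_eq]
  tauto

lemma discSlice_insert_of_lt (r R : ℝ) (F : Finset (ℝ × ℝ)) (c : ℝ × ℝ) {t : ℝ}
    (h : r ^ 2 < (t - c.2) ^ 2) : discSlice r R (insert c F) t = discSlice r R F t := by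
  ext x
  simp only [discSlice, Finset.forall_mem_insert, Set.mem_ofPred_eq]
  have : r ^ 2 < (x - c.1) ^ 2 + (t - c.2) ^ 2 := by nlinarith [sq_nonneg (x - c.1)]
  tauto

lemma finite_setOf_quadratic_eq_zero {a b c : ℝ} (ha : a ≠ 0) :
    {t : ℝ | a * t ^ 2 + b * t + c = 0}.Finite := by
  rcases Set.eq_empty_or_nonempty {t : ℝ | a * t ^ 2 + b * t + c = 0} with h | ⟨u, hu⟩
  · rw [h]; exact Set.finite_empty
  · refine (Set.toFinite {u, -b / a - u}).subset fun t ht => ?_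
    have h1 : (t - u) * (a * (t + u) + b) = 0 := by
      simp only [Set.mem_ofPred_eq] at hu ht; linear_combination ht - hu
    rcases mul_eq_zero.1 h1 with h | h
    · left; linarith
    · right
      simp only [Set.mem_singleton_iff]
      field_simp
      linarith

lemma ae_sq_sub_ne (r y : ℝ) : ∀ᵐ t : ℝ, (t - y) ^ 2 ≠ r ^ 2 := by
  have hfin : {t : ℝ | 1 * t ^ 2 + (-2 * y) * t + (y ^ 2 - r ^ 2) = 0}.Finite :=
    finite_setOf_quadratic_eq_zero one_ne_zero
  filter_upwards [hfin.countable.ae_notMem volume] with t ht h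
  exact ht (show _ = _ by linarith)

lemma ae_notMem_two_circles {ρ ρ' : ℝ} {c c' : ℝ × ℝ} (h : c ≠ c' ∨ ρ ^ 2 ≠ ρ' ^ 2) :
    ∀ᵐ t : ℝ, ∀ x : ℝ, (x - c.1) ^ 2 + (t - c.2) ^ 2 = ρ ^ 2 →
      (x - c'.1) ^ 2 + (t - c'.2) ^ 2 ≠ ρ' ^ 2 := by
  obtain ⟨a, b⟩ := c
  obtain ⟨a', b'⟩ := c'
  simp only
  by_cases ha : a = a'
  · subst ha
    by_cases hb : b = b'
    · subst hb
      refine Filter.Eventually.of_forall fun t x h1 h2 => ?_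
      rcases h with h | h
      · exact h rfl
      · exact h (h1.symm.trans h2)
    · have hb' : b' - b ≠ 0 := sub_ne_zero.2 (Ne.symm hb)
      filter_upwards [Measure.ae_ne volume ((ρ ^ 2 - ρ' ^ 2 + b' ^ 2 - b ^ 2) / (2 * (b' - b)))]
        with t ht x h1 h2
      apply ht
      field_simp
      linarith
  · have ha' : a' - a ≠ 0 := sub_ne_zero.2 (Ne.symm ha)
    set k := -(b' - b) / (a' - a) with hk
    set m := (ρ ^ 2 - ρ' ^ 2 + b' ^ 2 - b ^ 2 + a' ^ 2 - a ^ 2) / (2 * (a' - a)) with hm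
    have hfin : {t : ℝ | (k ^ 2 + 1) * t ^ 2 + (2 * k * (m - a) - 2 * b) * t +
        ((m - a) ^ 2 + b ^ 2 - ρ ^ 2) = 0}.Finite :=
      finite_setOf_quadratic_eq_zero (by positivity)
    filter_upwards [hfin.countable.ae_notMem volume] with t ht x h1 h2
    apply ht
    have hx : x = k * t + m := by
      rw [hk, hm]; field_simp; linarith
    subst hx
    show _ = _
    linarith

lemma ae_notMem_frontier_discSlice {r R : ℝ} (hR : 0 < R) (hRr : R ≤ r / 3)
    {F : Finset (ℝ × ℝ)} {c : ℝ × ℝ} (hc : c ∉ F) :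
    ∀ᵐ t : ℝ, ∀ x, (x - c.1) ^ 2 + (t - c.2) ^ 2 = r ^ 2 → x ∉ frontier (discSlice r R F t) := by
  have h1 : ∀ᵐ t : ℝ, ∀ c' ∈ F, ∀ x : ℝ, (x - c.1) ^ 2 + (t - c.2) ^ 2 = r ^ 2 →
      (x - c'.1) ^ 2 + (t - c'.2) ^ 2 ≠ r ^ 2 := by
    rw [Filter.eventually_all_finset]
    intro c' hc'
    exact ae_notMem_two_circles (Or.inl (by rintro rfl; exact hc hc'))
  have h2 := ae_notMem_two_circles (ρ := r) (ρ' := R) (c := c) (c' := (0, 0))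
    (Or.inr (by nlinarith))
  filter_upwards [h1, h2] with t h1 h2 x hx hfr
  rcases eq_of_mem_frontier_discSlice hfr with h | ⟨c', hc', h⟩
  · exact h2 x hx (by simpa using h)
  · exact h1 c' hc' x hx h

lemma sub_halfChord_sq {r a t y : ℝ} (h : (t - y) ^ 2 ≤ r ^ 2) :
    (a - √(r ^ 2 - (t - y) ^ 2) - a) ^ 2 + (t - y) ^ 2 = r ^ 2 := by
  have := Real.sq_sqrt (sub_nonneg.2 h)
  linarith

lemma add_halfChord_sq {r a t y : ℝ} (h : (t - y) ^ 2 ≤ r ^ 2) :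
    (a + √(r ^ 2 - (t - y) ^ 2) - a) ^ 2 + (t - y) ^ 2 = r ^ 2 := by
  have := Real.sq_sqrt (sub_nonneg.2 h)
  linarith

lemma sliceCount_insert_le_of_not_tip {r R : ℝ} (hR : 0 < R) (hRr : R ≤ r / 3)
    {F : Finset (ℝ × ℝ)} {c : ℝ × ℝ} (hc : c ∉ F)
    (hup : R ^ 2 ≤ c.1 ^ 2 + (c.2 - r) ^ 2) (hdown : R ^ 2 ≤ c.1 ^ 2 + (c.2 + r) ^ 2) :
    ∀ᵐ t, sliceCount r R (insert c F) t ≤ sliceCount r R F t := by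
  filter_upwards [ae_notMem_frontier_discSlice hR hRr hc] with t ht
  unfold sliceCount
  rcases le_or_gt ((t - c.2) ^ 2) (r ^ 2) with h | h
  · rw [discSlice_insert _ _ _ _ h]
    have hs := Real.sq_sqrt (sub_nonneg.2 h)
    have hs0 := Real.sqrt_nonneg (r ^ 2 - (t - c.2) ^ 2)
    refine count_frontier_diff_Icc_le (isOpen_discSlice _ _ _ _) (by linarith)
      (ht _ (sub_halfChord_sq h)) (ht _ (add_halfChord_sq h)) ?_
    rintro ⟨⟨h1, -⟩, ⟨h2, -⟩⟩
    have habs := abs_le_of_sq_le_sq' h (by linarith)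
    rcases le_total 0 c.2 with h0 | h0 <;> nlinarith
  · rw [discSlice_insert_of_lt _ _ _ _ h]

/-! ### Adding a disc whose lowest point lies in the ball -/

lemma parallelogram_mem_ball {r R p a ℓ ρ σ ς : ℝ} (hRr : R ≤ r / 3)
    (hσ0 : 0 ≤ σ) (hς0 : 0 ≤ ς) (hσ : σ ^ 2 = r ^ 2 - (ℓ - (a + r)) ^ 2)
    (hς : ς ^ 2 = r ^ 2 - (ρ - (a + r)) ^ 2) (ha : -R < a) (haℓ : a < ℓ) (haρ : a < ρ)
    (hℓR : ℓ ≤ R) (hρR : ρ ≤ R) (hℓ : (p - σ) ^ 2 + ℓ ^ 2 ≤ R ^ 2)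
    (hρ : (p + ς) ^ 2 + ρ ^ 2 ≤ R ^ 2) :
    (p - σ + ς) ^ 2 + (ℓ + ρ - a) ^ 2 ≤ R ^ 2 := by
  have h3 : ℓ + ρ - a - r ≤ 0 := by linarith
  rcases le_total (p - σ + ς) 0 with h | h
  · have h1 : (p - σ + ς) * ς ≤ 0 := mul_nonpos_of_nonpos_of_nonneg h hς0
    have h2 : (ρ - a) * (ℓ + ρ - a - r) ≤ 0 :=
      mul_nonpos_of_nonneg_of_nonpos (by linarith) h3
    nlinarith
  · have h1 : 0 ≤ (p - σ + ς) * σ := mul_nonneg h hσ0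
    have h2 : (ℓ - a) * (ℓ + ρ - a - r) ≤ 0 :=
      mul_nonpos_of_nonneg_of_nonpos (by linarith) h3
    nlinarith

lemma parallelogram_mem_slice_ball {R ℓ ρ a t u v x : ℝ}
    (hux : u ≤ x) (hxv : x ≤ v) (hℓ : u ^ 2 + ℓ ^ 2 ≤ R ^ 2) (hρ : v ^ 2 + ρ ^ 2 ≤ R ^ 2)
    (hx : x ^ 2 + (ℓ + ρ - a) ^ 2 ≤ R ^ 2) (hℓt : ℓ < t) (hρt : ρ < t) (ht : t < ℓ + ρ - a) :
    x ^ 2 + t ^ 2 < R ^ 2 := by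
  rcases le_total 0 t with h | h
  · nlinarith
  · rcases le_total 0 x with h' | h' <;> nlinarith

lemma parallelogram_notMem_lower_disc {r p a ℓ ρ σ ς q b t : ℝ} (hr : 0 < r)
    (hσ0 : 0 ≤ σ) (hς0 : 0 ≤ ς) (hσ : σ ^ 2 = r ^ 2 - (ℓ - (a + r)) ^ 2)
    (hς : ς ^ 2 = r ^ 2 - (ρ - (a + r)) ^ 2) (haℓ : a < ℓ) (haρ : a < ρ)
    (hne : (q, b) ≠ (p, a + r)) (hb : b ≤ a + r)
    (hℓ : r ^ 2 ≤ (p - σ - q) ^ 2 + (ℓ - b) ^ 2) (hρ : r ^ 2 ≤ (p + ς - q) ^ 2 + (ρ - b) ^ 2)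
    (ht : t < ℓ + ρ - a) (htb : ℓ + ρ - a ≤ b) :
    r ^ 2 < (p - σ + ς - q) ^ 2 + (t - b) ^ 2 := by
  suffices h : r ^ 2 ≤ (p - σ + ς - q) ^ 2 + (ℓ + ρ - a - b) ^ 2 by nlinarith
  rcases le_total q (p - σ) with h | h
  · have h1 : 0 ≤ (p - σ - q) * ς := mul_nonneg (by linarith) hς0
    have h2 : 0 ≤ (ρ - a) * (ℓ - b + r) := mul_nonneg (by linarith) (by linarith)
    nlinarith
  rcases le_total (p + ς) q with h' | h'
  · have h1 : 0 ≤ (q - (p + ς)) * σ := mul_nonneg (by linarith) hσ0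
    have h2 : 0 ≤ (ℓ - a) * (ρ - b + r) := mul_nonneg (by linarith) (by linarith)
    nlinarith
  exfalso
  have e1 : (ℓ - b) ^ 2 ≤ (ℓ - (a + r)) ^ 2 := by nlinarith
  have e2 : (ρ - b) ^ 2 ≤ (ρ - (a + r)) ^ 2 := by nlinarith
  have q1 : p ≤ q := by
    have : σ ≤ q - (p - σ) := by
      by_contra! hlt
      nlinarith
    linarith
  have q2 : q ≤ p := by
    have : ς ≤ p + ς - q := by
      by_contra! hlt
      nlinarith
    linarith
  obtain rfl : p = q := le_antisymm q1 q2
  have hb' : b ≠ a + r := by rintro rfl; exact hne rfl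
  have hb'' : b < a + r := lt_of_le_of_ne hb hb'
  nlinarith

lemma parallelogram_notMem_opposite_disc {r R p a ℓ ρ σ ς q b t s : ℝ} (hRr : R ≤ r / 3)
    (hσ0 : 0 ≤ σ) (hς0 : 0 ≤ ς) (hσ : σ ^ 2 = r ^ 2 - (ℓ - (a + r)) ^ 2)
    (hς : ς ^ 2 = r ^ 2 - (ρ - (a + r)) ^ 2) (ha : -R < a) (haℓ : a < ℓ) (haρ : a < ρ)
    (hR : 0 < R) (hb : b + r < R)
    (hℓ : r ^ 2 ≤ (p - σ - q) ^ 2 + (ℓ - b) ^ 2) (hρ : r ^ 2 ≤ (p + ς - q) ^ 2 + (ρ - b) ^ 2)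
    (hℓt : ℓ < t) (hρt : ρ < t) (has : a < s) (hst : s < t)
    (hbad : ∀ x, (x - p) ^ 2 + (s - (a + r)) ^ 2 ≤ r ^ 2 → r ^ 2 < (x - q) ^ 2 + (s - b) ^ 2) :
    r ^ 2 < (p - σ + ς - q) ^ 2 + (t - b) ^ 2 := by
  by_contra! h
  have hbt : t ≤ b + r := by
    have := abs_le_of_sq_le_sq' (a := t - b) (b := r) (by nlinarith [sq_nonneg (p - σ + ς - q)])
      (by linarith)
    linarith
  have k1 : (p - σ + ς - q) ^ 2 < (p - σ - q) ^ 2 := by nlinarith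
  have k2 : (p - σ + ς - q) ^ 2 < (p + ς - q) ^ 2 := by nlinarith
  have huq : p - σ < q := by by_contra! h'; nlinarith
  have hqv : q < p + ς := by by_contra! h'; nlinarith
  have hlev : ∀ y, y < t → (b - a) ^ 2 ≤ (y - (a + r)) ^ 2 := fun y hy => by
    have := mul_nonneg (show 0 ≤ (a + r - y) - (a - b) by linarith)
      (show 0 ≤ (a + r - y) + (a - b) by linarith)
    linarith
  have key : (q - p) ^ 2 + (b - a) ^ 2 ≤ r ^ 2 := by
    rcases le_total p q with h' | h'
    · have h1 : (q - p) ^ 2 ≤ ς ^ 2 := pow_le_pow_left₀ (by linarith) (by linarith) 2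
      linarith [hlev ρ hρt]
    · have h1 : (p - q) ^ 2 ≤ σ ^ 2 := pow_le_pow_left₀ (by linarith) (by linarith) 2
      linarith [hlev ℓ hℓt]
  have hd : 0 < b + r - a := by linarith
  set w := (s - a) / (b + r - a) with hw
  have hw0 : 0 ≤ w := div_nonneg (by linarith) hd.le
  have hw1 : w ≤ 1 := (div_le_one hd).2 (by linarith)
  have hs : s = a + w * (b + r - a) := by rw [hw]; field_simp; ring
  have hww : 0 ≤ w * (1 - w) := mul_nonneg hw0 (by linarith)
  have n1 := mul_nonneg hww (sq_nonneg (q - p))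
  have n2 := mul_nonneg hww (sq_nonneg (b + r - a))
  have n3 := mul_nonneg hw0 (sub_nonneg.2 key)
  have n4 := mul_nonneg (sub_nonneg.2 hw1) (sub_nonneg.2 key)
  have h1 := hbad (p + w * (q - p)) (by rw [hs]; linarith)
  rw [hs] at h1
  linarith

lemma sliceCount_insert_add_le {r R : ℝ} (F : Finset (ℝ × ℝ)) (c : ℝ × ℝ) {t : ℝ}
    (ht : ∀ x, (x - c.1) ^ 2 + (t - c.2) ^ 2 = r ^ 2 → x ∉ frontier (discSlice r R F t)) :
    sliceCount r R (insert c F) t ≤ sliceCount r R F t + 2 := by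
  unfold sliceCount
  rcases le_or_gt ((t - c.2) ^ 2) (r ^ 2) with h | h
  · rw [discSlice_insert _ _ _ _ h]
    exact count_frontier_diff_Icc_le_add (isOpen_discSlice _ _ _ _)
      (by linarith [Real.sqrt_nonneg (r ^ 2 - (t - c.2) ^ 2)])
      (ht _ (sub_halfChord_sq h)) (ht _ (add_halfChord_sq h))
  · rw [discSlice_insert_of_lt _ _ _ _ h]
    exact le_self_add

lemma sliceCount_insert_le {r R : ℝ} (F : Finset (ℝ × ℝ)) (c : ℝ × ℝ) {t : ℝ}
    (ht : ∀ x, (x - c.1) ^ 2 + (t - c.2) ^ 2 = r ^ 2 → x ∉ frontier (discSlice r R F t))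
    (ht' : ∀ j ∈ F, (t - j.2) ^ 2 ≠ r ^ 2)
    (h : (t - c.2) ^ 2 < r ^ 2 → c.1 - √(r ^ 2 - (t - c.2) ^ 2) ∈ discSlice r R F t →
      c.1 + √(r ^ 2 - (t - c.2) ^ 2) ∈ discSlice r R F t →
      ∃ j ∈ F, ∃ x, (x - c.1) ^ 2 + (t - c.2) ^ 2 ≤ r ^ 2 ∧
        (x - j.1) ^ 2 + (t - j.2) ^ 2 ≤ r ^ 2)
    (hc : (t - c.2) ^ 2 ≠ r ^ 2) :
    sliceCount r R (insert c F) t ≤ sliceCount r R F t := by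
  unfold sliceCount
  rcases le_or_gt ((t - c.2) ^ 2) (r ^ 2) with h1 | h1
  · rw [discSlice_insert _ _ _ _ h1]
    have fa := ht _ (sub_halfChord_sq h1)
    have fb := ht _ (add_halfChord_sq h1)
    have hS := isOpen_discSlice r R F t
    by_cases hlr : c.1 - √(r ^ 2 - (t - c.2) ^ 2) ∈ discSlice r R F t ∧
      c.1 + √(r ^ 2 - (t - c.2) ^ 2) ∈ discSlice r R F t
    · obtain ⟨j, hj, x, hxc, hxj⟩ := h (lt_of_le_of_ne h1 hc) hlr.1 hlr.2
      have hj1 : (t - j.2) ^ 2 ≤ r ^ 2 := by nlinarith [sq_nonneg (x - j.1)]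
      have hjs : 0 < √(r ^ 2 - (t - j.2) ^ 2) :=
        Real.sqrt_pos.2 (sub_pos.2 (lt_of_le_of_ne hj1 (ht' j hj)))
      have hgap : ∀ y ∈ Set.Icc (j.1 - √(r ^ 2 - (t - j.2) ^ 2)) (j.1 + √(r ^ 2 - (t - j.2) ^ 2)),
          y ∉ discSlice r R F t := fun y hy hyS =>
        absurd (hyS.2 j hj) (not_lt.2 ((mem_Icc_halfChord_iff hj1).1 hy))
      rw [← mem_Icc_halfChord_iff h1] at hxc
      rw [← mem_Icc_halfChord_iff hj1] at hxj
      refine count_frontier_diff_Icc_le_of_gap hS fa fb (z := j.1 - √(r ^ 2 - (t - j.2) ^ 2))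
        (w := j.1 + √(r ^ 2 - (t - j.2) ^ 2)) ?_ (by linarith) ?_ hgap
      · by_contra! hle
        exact hgap _ ⟨hle, hxc.1.trans hxj.2⟩ hlr.1
      · by_contra! hle
        exact hgap _ ⟨hxj.1.trans hxc.2, hle⟩ hlr.2
    · exact count_frontier_diff_Icc_le hS
        (by linarith [Real.sqrt_nonneg (r ^ 2 - (t - c.2) ^ 2)]) fa fb hlr
  · rw [discSlice_insert_of_lt _ _ _ _ h1]

lemma exists_isLUB_chord_end {r R a : ℝ} {F : Finset (ℝ × ℝ)} {f : ℝ → ℝ} (hf : Continuous f)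
    {s : ℝ} (hs : f s ∈ discSlice r R F s) (has : a < s) (hR : 0 < R) :
    ∃ ℓ, s ≤ ℓ ∧ ℓ ≤ R ∧ (∀ t, a < t → f t ∈ discSlice r R F t → t ≤ ℓ) ∧
      f ℓ ^ 2 + ℓ ^ 2 ≤ R ^ 2 ∧ ∀ c ∈ F, r ^ 2 ≤ (f ℓ - c.1) ^ 2 + (ℓ - c.2) ^ 2 := by
  set L : Set ℝ := {t | a < t ∧ f t ∈ discSlice r R F t}
  have hL : ∀ t ∈ L, t ≤ R := fun t ht => by
    have := ht.2.1
    exact (abs_le_of_sq_le_sq' (by nlinarith [sq_nonneg (f t)]) hR.le).2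
  have hbdd : BddAbove L := ⟨R, hL⟩
  have hsL : s ∈ L := ⟨has, hs⟩
  have hcl : IsClosed {t | f t ^ 2 + t ^ 2 ≤ R ^ 2 ∧
      ∀ c ∈ F, r ^ 2 ≤ (f t - c.1) ^ 2 + (t - c.2) ^ 2} := by
    have : {t | f t ^ 2 + t ^ 2 ≤ R ^ 2 ∧ ∀ c ∈ F, r ^ 2 ≤ (f t - c.1) ^ 2 + (t - c.2) ^ 2} =
        {t | f t ^ 2 + t ^ 2 ≤ R ^ 2} ∩
          ⋂ c ∈ F, {t | r ^ 2 ≤ (f t - c.1) ^ 2 + (t - c.2) ^ 2} := by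
      ext x; simp
    rw [this]
    exact (isClosed_le (by fun_prop) (by fun_prop)).inter
      (isClosed_biInter fun c _ => isClosed_le (by fun_prop) (by fun_prop))
  have hsub : L ⊆ {t | f t ^ 2 + t ^ 2 ≤ R ^ 2 ∧
      ∀ c ∈ F, r ^ 2 ≤ (f t - c.1) ^ 2 + (t - c.2) ^ 2} :=
    fun t ht => ⟨ht.2.1.le, fun c hc => (ht.2.2 c hc).le⟩
  have hmem := closure_minimal hsub hcl (csSup_mem_closure ⟨s, hsL⟩ hbdd)
  exact ⟨sSup L, le_csSup hbdd hsL, csSup_le ⟨s, hsL⟩ hL,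
    fun t hat ht => le_csSup hbdd ⟨hat, ht⟩, hmem.1, hmem.2⟩

lemma lintegral_sliceCount_insert_le_of_up_tip {r R : ℝ} (hR : 0 < R) (hRr : R ≤ r / 3)
    {F : Finset (ℝ × ℝ)} {c : ℝ × ℝ} (hcF : c ∉ F)
    (hF : ∀ j ∈ F, j.1 ^ 2 + (j.2 + r) ^ 2 < R ^ 2 ∨
      (j.1 ^ 2 + (j.2 - r) ^ 2 < R ^ 2 ∧ j.2 ≤ c.2))
    (hc : c.1 ^ 2 + (c.2 - r) ^ 2 < R ^ 2) :
    ∫⁻ t, sliceCount r R (insert c F) t ≤ ∫⁻ t, sliceCount r R F t := by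
  have hr : 0 < r := by linarith
  have hg := ae_notMem_frontier_discSlice hR hRr hcF
  have hj : ∀ᵐ t : ℝ, ∀ j ∈ insert c F, (t - j.2) ^ 2 ≠ r ^ 2 := by
    rw [Filter.eventually_all_finset]
    exact fun j _ => ae_sq_sub_ne r j.2
  obtain ⟨p, Y⟩ := c
  obtain ⟨a, rfl⟩ : ∃ a, Y = a + r := ⟨Y - r, by ring⟩
  simp only at hF hc hj hg
  have haR : -R < a ∧ a < R := abs_lt_of_sq_lt_sq' (by nlinarith [sq_nonneg p]) hR.le
  set l : ℝ → ℝ := fun t => p - √(r ^ 2 - (t - (a + r)) ^ 2) with hl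
  set e : ℝ → ℝ := fun t => p + √(r ^ 2 - (t - (a + r)) ^ 2) with he
  have hlt : ∀ t, (t - (a + r)) ^ 2 < r ^ 2 → a < t := fun t ht => by
    have := (abs_lt_of_sq_lt_sq' ht hr.le).1
    linarith
  have hmono : ∀ y t : ℝ, y < t → t < a + r → (t - (a + r)) ^ 2 < (y - (a + r)) ^ 2 :=
    fun y t h1 h2 => by nlinarith
  have hsq : ∀ t, a < t → t ≤ R → (t - (a + r)) ^ 2 < r ^ 2 := fun t h1 h2 => by
    have := hmono a t h1 (by linarith)
    rwa [sub_add_cancel_left, neg_sq] at this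
  by_cases hbad : ∃ s, a < s ∧ l s ∈ discSlice r R F s ∧ e s ∈ discSlice r R F s ∧
      ∀ j ∈ F, ∀ x, (x - p) ^ 2 + (s - (a + r)) ^ 2 ≤ r ^ 2 →
        r ^ 2 < (x - j.1) ^ 2 + (s - j.2) ^ 2
  swap
  · push Not at hbad
    apply lintegral_mono_ae
    filter_upwards [hg, hj] with t h1 h2
    refine sliceCount_insert_le F _ h1 (fun j hj => h2 j (Finset.mem_insert_of_mem hj)) ?_
      (h2 _ (Finset.mem_insert_self _ _))
    intro h3 h4 h5
    obtain ⟨j, hj, x, h6, h7⟩ := hbad t (hlt t h3) h4 h5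
    exact ⟨j, hj, x, h6, h7⟩
  obtain ⟨s₀, has₀, hls₀, hes₀, hs₀⟩ := hbad
  obtain ⟨ℓ, hsℓ, hℓR, hℓub, hℓ1, hℓ2⟩ :=
    exists_isLUB_chord_end (f := l) (by fun_prop) hls₀ has₀ hR
  obtain ⟨ρ, hsρ, hρR, hρub, hρ1, hρ2⟩ :=
    exists_isLUB_chord_end (f := e) (by fun_prop) hes₀ has₀ hR
  have haℓ : a < ℓ := by linarith
  have haρ : a < ρ := by linarith
  set σ := √(r ^ 2 - (ℓ - (a + r)) ^ 2) with hσdef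
  set ς := √(r ^ 2 - (ρ - (a + r)) ^ 2) with hςdef
  have hσ0 : 0 ≤ σ := Real.sqrt_nonneg _
  have hς0 : 0 ≤ ς := Real.sqrt_nonneg _
  have hσ : σ ^ 2 = r ^ 2 - (ℓ - (a + r)) ^ 2 := Real.sq_sqrt (sub_nonneg.2 (hsq ℓ haℓ hℓR).le)
  have hς : ς ^ 2 = r ^ 2 - (ρ - (a + r)) ^ 2 := Real.sq_sqrt (sub_nonneg.2 (hsq ρ haρ hρR).le)
  have hball := parallelogram_mem_ball hRr hσ0 hς0 hσ hς haR.1 haℓ haρ hℓR hρR hℓ1 hρ1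
  have hτR : ℓ + ρ - a ≤ R :=
    (abs_le_of_sq_le_sq' (by nlinarith [sq_nonneg (p - σ + ς)]) hR.le).2
  have hgood : ∀ t, (∀ x, (x - p) ^ 2 + (t - (a + r)) ^ 2 = r ^ 2 →
      x ∉ frontier (discSlice r R F t)) → ℓ < t → ρ < t → t < ℓ + ρ - a →
      sliceCount r R (insert (p, a + r) F) t + 2 ≤ sliceCount r R F t := by
    intro t h1 hℓt hρt htτ
    have hat : a < t := by linarith
    have htlt : (t - (a + r)) ^ 2 < r ^ 2 := hsq t hat (by linarith)
    unfold sliceCount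
    rw [discSlice_insert _ _ _ _ htlt.le]
    have hs1 : σ < √(r ^ 2 - (t - (a + r)) ^ 2) := by
      exact Real.sqrt_lt_sqrt (by linarith [sq_nonneg σ]) (by linarith [hmono ℓ t hℓt (by linarith)])
    have hs2 : ς < √(r ^ 2 - (t - (a + r)) ^ 2) := by
      exact Real.sqrt_lt_sqrt (by linarith [sq_nonneg ς]) (by linarith [hmono ρ t hρt (by linarith)])
    refine count_frontier_diff_Icc_add_le (x := p - σ + ς) (isOpen_discSlice _ _ _ _)
      (h1 _ (sub_halfChord_sq htlt.le)) (h1 _ (add_halfChord_sq htlt.le))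
      (fun h => absurd (hℓub t hat h) (not_le.2 hℓt))
      (fun h => absurd (hρub t hat h) (not_le.2 hρt))
      (by simp only; linarith) (by simp only; linarith) ⟨?_, ?_⟩
    · exact parallelogram_mem_slice_ball (by linarith) (by linarith) hℓ1 hρ1 hball hℓt hρt htτ
    · rintro ⟨q, b⟩ hjF
      rcases hF _ hjF with h2 | ⟨h2, h3⟩
      · simp only at h2
        have hb := (abs_lt_of_sq_lt_sq' (a := b + r) (b := R) (by nlinarith [sq_nonneg q]) hR.le).2
        exact parallelogram_notMem_opposite_disc hRr hσ0 hς0 hσ hς haR.1 haℓ haρ hR hb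
          (hℓ2 _ hjF) (hρ2 _ hjF) hℓt hρt has₀ (hsℓ.trans_lt hℓt) (hs₀ _ hjF)
      · simp only at h2 h3
        have hb := (abs_lt_of_sq_lt_sq' (a := b - r) (b := R) (by nlinarith [sq_nonneg q]) hR.le).1
        exact parallelogram_notMem_lower_disc hr hσ0 hς0 hσ hς haℓ haρ
          (by rintro h; rw [h] at hjF; exact hcF hjF) h3 (hℓ2 _ hjF) (hρ2 _ hjF) htτ
          (by linarith)
  set A : Set ℝ := Set.Ioo (max ℓ ρ) (max ℓ ρ + (min ℓ ρ - a))
  set B : Set ℝ := Set.Ioc a (min ℓ ρ)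
  have hmm : max ℓ ρ + min ℓ ρ = ℓ + ρ := max_add_min ℓ ρ
  have hpt : ∀ᵐ t : ℝ, sliceCount r R (insert (p, a + r) F) t + A.indicator (fun _ => 2) t ≤
      sliceCount r R F t + B.indicator (fun _ => 2) t := by
    filter_upwards [hg, hj] with t h1 h2
    by_cases htA : t ∈ A
    · rw [Set.indicator_of_mem htA]
      refine le_add_right (hgood t h1 ((le_max_left _ _).trans_lt htA.1)
        ((le_max_right _ _).trans_lt htA.1) (by linarith [htA.2]))
    · rw [Set.indicator_of_notMem htA, add_zero]
      by_cases htB : t ∈ B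
      · rw [Set.indicator_of_mem htB]
        exact sliceCount_insert_add_le F _ h1
      · rw [Set.indicator_of_notMem htB, add_zero]
        refine sliceCount_insert_le F _ h1 (fun j hj => h2 j (Finset.mem_insert_of_mem hj)) ?_
          (h2 _ (Finset.mem_insert_self _ _))
        intro h3 h4 h5
        have hat := hlt t h3
        exact absurd ⟨hat, le_min (hℓub t hat h4) (hρub t hat h5)⟩ htB
  have hint := lintegral_mono_ae hpt
  rw [lintegral_add_right _ (measurable_const.indicator measurableSet_Ioo),
    lintegral_add_right _ (measurable_const.indicator measurableSet_Ioc),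
    lintegral_indicator_const measurableSet_Ioo, lintegral_indicator_const measurableSet_Ioc,
    Real.volume_Ioo, Real.volume_Ioc, add_sub_cancel_left] at hint
  exact (ENNReal.add_le_add_iff_right (by finiteness)).1 hint

lemma lintegral_sliceCount_empty_le (r R : ℝ) (hR : 0 < R) :
    ∫⁻ t, sliceCount r R ∅ t ≤ ENNReal.ofReal (4 * R) := by
  have hpt : ∀ t, sliceCount r R ∅ t ≤ (Set.Ioo (-R) R).indicator (fun _ => 2) t := fun t => by
    unfold sliceCount
    by_cases ht : t ∈ Set.Ioo (-R) R
    · rw [Set.indicator_of_mem ht]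
      have hpos : 0 < R ^ 2 - t ^ 2 := sub_pos.2 (sq_lt_sq' ht.1 ht.2)
      have : discSlice r R ∅ t = Set.Ioo (-√(R ^ 2 - t ^ 2)) √(R ^ 2 - t ^ 2) := by
        ext x
        rw [Set.mem_Ioo, ← abs_lt, Real.lt_sqrt (abs_nonneg x), sq_abs]
        simp [discSlice, lt_sub_iff_add_lt]
      rw [this, frontier_Ioo (by linarith [Real.sqrt_pos.2 hpos])]
      exact count_pair_le _ _
    · have : discSlice r R ∅ t = ∅ := by
        refine Set.eq_empty_of_forall_notMem fun x hx => ht ?_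
        exact abs_lt_of_sq_lt_sq' (by nlinarith [hx.1, sq_nonneg x]) hR.le
      rw [this]
      simp
  refine (lintegral_mono hpt).trans ?_
  rw [lintegral_indicator_const measurableSet_Ioo, Real.volume_Ioo,
    show (2 : ℝ≥0∞) = ENNReal.ofReal 2 by simp, ← ENNReal.ofReal_mul (by norm_num)]
  exact ENNReal.ofReal_le_ofReal (by linarith)

lemma lintegral_sliceCount_up_tips_union_le {r R : ℝ} (hR : 0 < R) (hRr : R ≤ r / 3)
    {D : Finset (ℝ × ℝ)} (hD : ∀ j ∈ D, j.1 ^ 2 + (j.2 + r) ^ 2 < R ^ 2)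
    (U : Finset (ℝ × ℝ)) (hU : ∀ j ∈ U, j.1 ^ 2 + (j.2 - r) ^ 2 < R ^ 2) :
    ∫⁻ t, sliceCount r R (U ∪ D) t ≤ ∫⁻ t, sliceCount r R D t := by
  induction U using Finset.induction_on_max_value (fun c : ℝ × ℝ => c.2) with
  | empty => simp
  | insert c U hcU hmax ih =>
    rw [Finset.insert_union]
    have ih' := ih fun j hj => hU j (Finset.mem_insert_of_mem hj)
    by_cases hc : c ∈ U ∪ D
    · rwa [Finset.insert_eq_of_mem hc]
    · refine (lintegral_sliceCount_insert_le_of_up_tip hR hRr hc (fun j hj => ?_)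
        (hU c (Finset.mem_insert_self _ _))).trans ih'
      rcases Finset.mem_union.1 hj with h | h
      · exact Or.inr ⟨hU j (Finset.mem_insert_of_mem h), hmax j h⟩
      · exact Or.inl (hD j h)

lemma lintegral_sliceCount_not_tips_union_le {r R : ℝ} (hR : 0 < R) (hRr : R ≤ r / 3)
    (G W : Finset (ℝ × ℝ)) (hW : ∀ j ∈ W, R ^ 2 ≤ j.1 ^ 2 + (j.2 - r) ^ 2 ∧
      R ^ 2 ≤ j.1 ^ 2 + (j.2 + r) ^ 2) :
    ∫⁻ t, sliceCount r R (W ∪ G) t ≤ ∫⁻ t, sliceCount r R G t := by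
  induction W using Finset.induction_on with
  | empty => simp
  | insert c W hcW ih =>
    rw [Finset.insert_union]
    have ih' := ih fun j hj => hW j (Finset.mem_insert_of_mem hj)
    by_cases hc : c ∈ W ∪ G
    · rwa [Finset.insert_eq_of_mem hc]
    · have h := hW c (Finset.mem_insert_self _ _)
      exact (lintegral_mono_ae (sliceCount_insert_le_of_not_tip hR hRr hc h.1 h.2)).trans ih'

lemma lintegral_sliceCount_image_neg (r R : ℝ) (F : Finset (ℝ × ℝ)) :
    ∫⁻ t, sliceCount r R (F.image fun c => (c.1, -c.2)) t = ∫⁻ t, sliceCount r R F t := by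
  rw [← lintegral_neg_eq_self]
  congr with t
  unfold sliceCount
  congr 2
  ext x
  simp only [discSlice, Finset.forall_mem_image, Set.mem_ofPred_eq, neg_sq]
  have : ∀ y, (-t - -y) ^ 2 = (t - y) ^ 2 := fun y => by ring
  simp only [this]

lemma lintegral_sliceCount_le {r R : ℝ} (hR : 0 < R) (hRr : R ≤ r / 3) (F : Finset (ℝ × ℝ)) :
    ∫⁻ t, sliceCount r R F t ≤ ENNReal.ofReal (4 * R) := by
  classical
  set up : ℝ × ℝ → Prop := fun j => j.1 ^ 2 + (j.2 - r) ^ 2 < R ^ 2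
  set down : ℝ × ℝ → Prop := fun j => j.1 ^ 2 + (j.2 + r) ^ 2 < R ^ 2
  have hF : F = F.filter (fun j => ¬ up j ∧ ¬ down j) ∪ (F.filter up ∪ F.filter down) := by
    ext j
    simp only [Finset.mem_union, Finset.mem_filter]
    tauto
  have hdown : ∫⁻ t, sliceCount r R (F.filter down) t ≤ ENNReal.ofReal (4 * R) := by
    rw [← lintegral_sliceCount_image_neg]
    have := lintegral_sliceCount_up_tips_union_le hR hRr (D := ∅) (by simp)
      ((F.filter down).image fun c => (c.1, -c.2)) (by
        simp only [Finset.forall_mem_image, Finset.mem_filter]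
        rintro j ⟨-, hj⟩
        have : (-j.2 - r) ^ 2 = (j.2 + r) ^ 2 := by ring
        rw [this]; exact hj)
    rw [Finset.union_empty] at this
    exact this.trans (lintegral_sliceCount_empty_le r R hR)
  rw [hF]
  refine (lintegral_sliceCount_not_tips_union_le hR hRr _ _ fun j hj => ?_).trans
    ((lintegral_sliceCount_up_tips_union_le hR hRr (fun j hj => (Finset.mem_filter.1 hj).2) _
      fun j hj => (Finset.mem_filter.1 hj).2).trans hdown)
  have := (Finset.mem_filter.1 hj).2
  exact ⟨not_lt.1 this.1, not_lt.1 this.2⟩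

/-! ### Projecting the free arcs to an axis -/

/-- The angles `φ` for which the point of the circle of radius `r` about `c` at angle `φ` is in the
open ball of radius `R` about the origin and outside the open discs of radius `r` centred at `F`. -/
def freeArc (r R : ℝ) (F : Finset (ℝ × ℝ)) (c : ℝ × ℝ) : Set ℝ :=
  {φ | (c.1 + r * Real.cos φ) ^ 2 + (c.2 + r * Real.sin φ) ^ 2 < R ^ 2 ∧
    ∀ j ∈ F, r ^ 2 ≤ (c.1 + r * Real.cos φ - j.1) ^ 2 + (c.2 + r * Real.sin φ - j.2) ^ 2}

lemma measurableSet_freeArc (r R : ℝ) (F : Finset (ℝ × ℝ)) (c : ℝ × ℝ) :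
    MeasurableSet (freeArc r R F c) := by
  have : freeArc r R F c =
      {φ | (c.1 + r * Real.cos φ) ^ 2 + (c.2 + r * Real.sin φ) ^ 2 < R ^ 2} ∩
      ⋂ j ∈ F, {φ | r ^ 2 ≤
        (c.1 + r * Real.cos φ - j.1) ^ 2 + (c.2 + r * Real.sin φ - j.2) ^ 2} := by
    ext x; simp [freeArc]
  rw [this]
  exact (isOpen_lt (by fun_prop) (by fun_prop)).measurableSet.inter
    (isClosed_biInter fun c _ => isClosed_le (by fun_prop) (by fun_prop)).measurableSet

/-- The points at height `t` of the free arcs of the circle about `c`. -/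
def freeSlice (r R : ℝ) (F : Finset (ℝ × ℝ)) (c : ℝ × ℝ) (t : ℝ) : Set ℝ :=
  {x | (x - c.1) ^ 2 + (t - c.2) ^ 2 = r ^ 2 ∧ x ^ 2 + t ^ 2 < R ^ 2 ∧
    ∀ j ∈ F, r ^ 2 ≤ (x - j.1) ^ 2 + (t - j.2) ^ 2}

lemma measurableSet_freeSlice (r R : ℝ) (F : Finset (ℝ × ℝ)) (c : ℝ × ℝ) (t : ℝ) :
    MeasurableSet (freeSlice r R F c t) := by
  have : freeSlice r R F c t = {x | (x - c.1) ^ 2 + (t - c.2) ^ 2 = r ^ 2} ∩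
      ({x | x ^ 2 + t ^ 2 < R ^ 2} ∩
      ⋂ j ∈ F, {x | r ^ 2 ≤ (x - j.1) ^ 2 + (t - j.2) ^ 2}) := by
    ext x; simp [freeSlice]
  rw [this]
  exact (isClosed_eq (by fun_prop) (by fun_prop)).measurableSet.inter
    ((isOpen_lt (by fun_prop) (by fun_prop)).measurableSet.inter
    (isClosed_biInter fun c _ => isClosed_le (by fun_prop) (by fun_prop)).measurableSet)

lemma mem_closure_setOf_sq_sub_lt (x a : ℝ) : x ∈ closure {y | (x - a) ^ 2 < (y - a) ^ 2} := by
  rcases le_total a x with h | h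
  · refine closure_mono (s := Set.Ioi x) (fun y hy => ?_) (by rw [closure_Ioi]; exact Set.self_mem_Ici)
    rw [Set.mem_Ioi] at hy
    rw [Set.mem_ofPred_eq]
    nlinarith
  · refine closure_mono (s := Set.Iio x) (fun y hy => ?_) (by rw [closure_Iio]; exact Set.self_mem_Iic)
    rw [Set.mem_Iio] at hy
    rw [Set.mem_ofPred_eq]
    nlinarith

lemma freeSlice_subset_frontier {r R : ℝ} {F : Finset (ℝ × ℝ)} {c : ℝ × ℝ} (hc : c ∈ F) {t : ℝ}
    (ht : ∀ j ∈ F, j ≠ c → ∀ x : ℝ, (x - c.1) ^ 2 + (t - c.2) ^ 2 = r ^ 2 →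
      (x - j.1) ^ 2 + (t - j.2) ^ 2 ≠ r ^ 2) :
    freeSlice r R F c t ⊆ frontier (discSlice r R F t) := by
  rintro x ⟨h1, h2, h3⟩
  rw [(isOpen_discSlice r R F t).frontier_eq]
  refine ⟨?_, fun hx => absurd (hx.2 c hc) (by rw [h1]; exact lt_irrefl _)⟩
  have hx : x ∈ discSlice r R (F.erase c) t := by
    refine ⟨h2, fun j hj => ?_⟩
    rw [Finset.mem_erase] at hj
    exact lt_of_le_of_ne (h3 j hj.2) (ht j hj.2 hj.1 x h1).symm
  refine closure_mono ?_ ((isOpen_discSlice r R (F.erase c) t).inter_closure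
    ⟨hx, mem_closure_setOf_sq_sub_lt x c.1⟩)
  rintro y ⟨hy1, hy2⟩
  refine ⟨hy1.1, fun j hj => ?_⟩
  by_cases hjc : j = c
  · subst hjc
    have : (x - j.1) ^ 2 < (y - j.1) ^ 2 := hy2
    linarith
  · exact hy1.2 j (Finset.mem_erase.2 ⟨hjc, hj⟩)

lemma ae_sum_count_freeSlice_le (r R : ℝ) (F : Finset (ℝ × ℝ)) :
    ∀ᵐ t : ℝ, ∑ c ∈ F, Measure.count (freeSlice r R F c t) ≤ sliceCount r R F t := by
  have h : ∀ᵐ t : ℝ, ∀ c ∈ F, ∀ j ∈ F, j ≠ c → ∀ x : ℝ, (x - c.1) ^ 2 + (t - c.2) ^ 2 = r ^ 2 →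
      (x - j.1) ^ 2 + (t - j.2) ^ 2 ≠ r ^ 2 := by
    rw [Filter.eventually_all_finset]
    intro c _
    rw [Filter.eventually_all_finset]
    intro j _
    by_cases hjc : j = c
    · exact Filter.Eventually.of_forall fun t h => absurd hjc h
    · filter_upwards [ae_notMem_two_circles (ρ := r) (ρ' := r) (Or.inl (Ne.symm hjc))]
        with t ht _ using ht
  filter_upwards [h] with t ht
  rw [← measure_biUnion_finset _ fun c _ => measurableSet_freeSlice r R F c t]
  · exact measure_mono (Set.iUnion₂_subset fun c hc => freeSlice_subset_frontier hc (ht c hc))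
  · intro c hc j hj hne
    exact Set.disjoint_left.2 fun x hx hx' => ht c hc j hj (Ne.symm hne) x hx.1 hx'.1

lemma indicator_one_le_count {α : Type*} {s : Set α} {t : α} {E : Set ℝ}
    (h : t ∈ s → E.Nonempty) : s.indicator (fun _ => (1 : ℝ≥0∞)) t ≤ Measure.count E := by
  by_cases ht : t ∈ s
  · obtain ⟨x, hx⟩ := h ht
    rw [Set.indicator_of_mem ht, ← Measure.count_singleton x]
    exact measure_mono (Set.singleton_subset_iff.2 hx)
  · rw [Set.indicator_of_notMem ht]
    exact zero_le

lemma indicator_image_add_le_count_freeSlice {r R : ℝ} (hr : 0 < r) (F : Finset (ℝ × ℝ))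
    (c : ℝ × ℝ) {A B : Set ℝ} (hA : ∀ φ ∈ A, φ ∈ freeArc r R F c ∧ 0 < Real.cos φ)
    (hB : ∀ φ ∈ B, φ ∈ freeArc r R F c ∧ Real.cos φ < 0) (t : ℝ) :
    ((fun φ => c.2 + r * Real.sin φ) '' A).indicator (fun _ => (1 : ℝ≥0∞)) t +
      ((fun φ => c.2 + r * Real.sin φ) '' B).indicator (fun _ => (1 : ℝ≥0∞)) t ≤
      Measure.count (freeSlice r R F c t) := by
  have key : ∀ φ ∈ freeArc r R F c,
      c.1 + r * Real.cos φ ∈ freeSlice r R F c (c.2 + r * Real.sin φ) := fun φ hφ =>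
    ⟨by linear_combination r ^ 2 * Real.cos_sq_add_sin_sq φ, hφ.1, hφ.2⟩
  rw [← measure_inter_add_sdiff (freeSlice r R F c t) (measurableSet_Ioi (a := c.1))]
  refine add_le_add (indicator_one_le_count ?_) (indicator_one_le_count ?_)
  · rintro ⟨φ, hφ, rfl⟩
    refine ⟨_, key φ (hA φ hφ).1, ?_⟩
    have := mul_pos hr (hA φ hφ).2
    rw [Set.mem_Ioi]
    linarith
  · rintro ⟨φ, hφ, rfl⟩
    refine ⟨_, key φ (hB φ hφ).1, ?_⟩
    have := mul_neg_of_pos_of_neg hr (hB φ hφ).2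
    rw [Set.mem_Ioi]
    linarith

lemma injOn_sin_Ioo : Set.InjOn Real.sin (Set.Ioo (Real.pi / 2) (-(Real.pi / 2) + 2 * Real.pi)) := by
  intro x hx y hy hxy
  have h1 : Real.sin (Real.pi - x) = Real.sin (Real.pi - y) := by
    rw [Real.sin_pi_sub, Real.sin_pi_sub, hxy]
  have := Real.injOn_sin (x₁ := Real.pi - x) (x₂ := Real.pi - y)
    ⟨by linarith [hx.2], by linarith [hx.1]⟩ ⟨by linarith [hy.2], by linarith [hy.1]⟩ h1
  linarith

lemma volume_image_sin {r : ℝ} (hr : 0 < r) (y : ℝ) {A : Set ℝ} (hA : MeasurableSet A)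
    (hinj : Set.InjOn Real.sin A) :
    MeasurableSet ((fun φ => y + r * Real.sin φ) '' A) ∧
    ∫⁻ φ in A, ENNReal.ofReal (r * |Real.cos φ|) = volume ((fun φ => y + r * Real.sin φ) '' A) := by
  have hinj' : Set.InjOn (fun φ => y + r * Real.sin φ) A := fun x hx z hz hxz => by
    refine hinj hx hz ?_
    simp only at hxz
    exact mul_left_cancel₀ hr.ne' (add_left_cancel hxz)
  refine ⟨hA.image_of_continuousOn_injOn (by fun_prop) hinj', ?_⟩
  have := lintegral_image_eq_lintegral_abs_deriv_mul hA
    (f := fun φ => y + r * Real.sin φ) (f' := fun φ => r * Real.cos φ)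
    (fun x _ => (((Real.hasDerivAt_sin x).const_mul r).const_add y).hasDerivWithinAt) hinj' 1
  simp only [Pi.one_apply, lintegral_one, Measure.restrict_apply_univ, mul_one, abs_mul,
    abs_of_pos hr] at this
  exact this.symm

lemma sum_lintegral_freeArc_le {r R : ℝ} (hR : 0 < R) (hRr : R ≤ r / 3) (F : Finset (ℝ × ℝ)) :
    ∑ c ∈ F, ∫⁻ φ in Set.Ioc (-(Real.pi / 2)) (-(Real.pi / 2) + 2 * Real.pi) ∩ freeArc r R F c,
      ENNReal.ofReal (r * |Real.cos φ|) ≤ ENNReal.ofReal (4 * R) := by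
  have hr : 0 < r := by linarith
  set I₁ := Set.Ioo (-(Real.pi / 2)) (Real.pi / 2)
  set I₂ := Set.Ioo (Real.pi / 2) (-(Real.pi / 2) + 2 * Real.pi)
  set A : ℝ × ℝ → Set ℝ := fun c => I₁ ∩ freeArc r R F c
  set B : ℝ × ℝ → Set ℝ := fun c => I₂ ∩ freeArc r R F c
  have hA := fun c : ℝ × ℝ => volume_image_sin hr c.2 (A := A c)
    (measurableSet_Ioo.inter (measurableSet_freeArc r R F c))
    (Real.injOn_sin.mono (Set.inter_subset_left.trans Set.Ioo_subset_Icc_self))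
  have hB := fun c : ℝ × ℝ => volume_image_sin hr c.2 (A := B c)
    (measurableSet_Ioo.inter (measurableSet_freeArc r R F c))
    (injOn_sin_Ioo.mono Set.inter_subset_left)
  have hstep : ∀ c ∈ F,
      ∫⁻ φ in Set.Ioc (-(Real.pi / 2)) (-(Real.pi / 2) + 2 * Real.pi) ∩ freeArc r R F c,
        ENNReal.ofReal (r * |Real.cos φ|) ≤
      ∫⁻ t, (((fun φ => c.2 + r * Real.sin φ) '' A c).indicator (fun _ => (1 : ℝ≥0∞)) t +
        ((fun φ => c.2 + r * Real.sin φ) '' B c).indicator (fun _ => (1 : ℝ≥0∞)) t) := by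
    intro c _
    rw [lintegral_add_right _ (measurable_const.indicator (hB c).1),
      lintegral_indicator_const (hA c).1, lintegral_indicator_const (hB c).1, one_mul, one_mul,
      ← (hA c).2, ← (hB c).2,
      ← Set.Ioc_union_Ioc_eq_Ioc (b := Real.pi / 2) (by linarith [Real.pi_pos])
        (by linarith [Real.pi_pos]), Set.union_inter_distrib_right]
    refine (lintegral_union_le _ _ _).trans (le_of_eq ?_)
    congr 1
    · exact setLIntegral_congr (Ioo_ae_eq_Ioc.symm.inter Filter.EventuallyEq.rfl)
    · exact setLIntegral_congr (Ioo_ae_eq_Ioc.symm.inter Filter.EventuallyEq.rfl)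
  refine (Finset.sum_le_sum hstep).trans ?_
  rw [← lintegral_finsetSum]
  swap
  · exact fun c _ => (measurable_const.indicator (hA c).1).add
      (measurable_const.indicator (hB c).1)
  refine le_trans (lintegral_mono_ae ?_) (lintegral_sliceCount_le hR hRr F)
  filter_upwards [ae_sum_count_freeSlice_le r R F] with t ht
  refine (Finset.sum_le_sum fun c _ => ?_).trans ht
  refine indicator_image_add_le_count_freeSlice hr F c (fun φ hφ => ⟨hφ.2, ?_⟩)
    (fun φ hφ => ⟨hφ.2, ?_⟩) t
  · exact Real.cos_pos_of_mem_Ioo hφ.1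
  · exact Real.cos_neg_of_pi_div_two_lt_of_lt hφ.1.1 (by linarith [hφ.1.2])

/-! ### Averaging over directions -/

/-- The rotation of the plane by the angle `-θ`. -/
noncomputable def rotateNeg (θ : ℝ) (v : ℝ × ℝ) : ℝ × ℝ :=
  (v.1 * Real.cos θ + v.2 * Real.sin θ, -v.1 * Real.sin θ + v.2 * Real.cos θ)

lemma rotateNeg_injective (θ : ℝ) : Function.Injective (rotateNeg θ) := by
  rintro ⟨a, b⟩ ⟨c, d⟩ h
  simp only [rotateNeg, Prod.mk.injEq] at h
  have h1 := Real.cos_sq_add_sin_sq θ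
  obtain ⟨h2, h3⟩ := h
  ext
  · linear_combination Real.cos θ * h2 - Real.sin θ * h3 - (a - c) * h1
  · linear_combination Real.sin θ * h2 + Real.cos θ * h3 - (b - d) * h1

lemma add_mem_freeArc_iff (r R : ℝ) (F : Finset (ℝ × ℝ)) (c : ℝ × ℝ) (φ θ : ℝ) :
    φ + θ ∈ freeArc r R F c ↔
      φ ∈ freeArc r R (F.image (rotateNeg θ)) (rotateNeg θ c) := by
  have h1 := Real.cos_sq_add_sin_sq θ
  have key : ∀ j : ℝ × ℝ,
      (c.1 + r * Real.cos (φ + θ) - j.1) ^ 2 + (c.2 + r * Real.sin (φ + θ) - j.2) ^ 2 =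
      ((rotateNeg θ c).1 + r * Real.cos φ - (rotateNeg θ j).1) ^ 2 +
        ((rotateNeg θ c).2 + r * Real.sin φ - (rotateNeg θ j).2) ^ 2 := fun j => by
    simp only [rotateNeg, Real.cos_add, Real.sin_add]
    linear_combination (r ^ 2 * (Real.cos φ ^ 2 + Real.sin φ ^ 2) -
      (c.1 - j.1) ^ 2 - (c.2 - j.2) ^ 2) * h1
  have key0 := key 0
  simp only [rotateNeg, Prod.fst_zero, Prod.snd_zero, sub_zero, zero_mul, neg_zero, add_zero]
    at key0
  simp only [freeArc, Set.mem_ofPred_eq, Finset.forall_mem_image, key, key0, rotateNeg]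

lemma add_two_pi_zsmul_mem_freeArc_iff (r R : ℝ) (F : Finset (ℝ × ℝ)) (c : ℝ × ℝ) (φ : ℝ) (n : ℤ) :
    n • (2 * Real.pi) + φ ∈ freeArc r R F c ↔ φ ∈ freeArc r R F c := by
  simp only [freeArc, Set.mem_ofPred_eq, zsmul_eq_mul, add_comm _ φ, Real.cos_add_int_mul_two_pi,
    Real.sin_add_int_mul_two_pi]

/-- A half-open interval of length `2 * π`. -/
noncomputable abbrev anglePeriod : Set ℝ :=
  Set.Ioc (-(Real.pi / 2)) (-(Real.pi / 2) + 2 * Real.pi)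

lemma lintegral_indicator_add_anglePeriod {A : Set ℝ} (hA : MeasurableSet A)
    (hper : ∀ (n : ℤ) (x : ℝ), n • (2 * Real.pi) + x ∈ A ↔ x ∈ A) (φ : ℝ) :
    ∫⁻ θ in anglePeriod, A.indicator (fun _ => 1) (φ + θ) = volume (anglePeriod ∩ A) := by
  have h1 := isAddFundamentalDomain_Ioc Real.two_pi_pos (-(Real.pi / 2)) volume
  have h2 := isAddFundamentalDomain_Ioc Real.two_pi_pos (φ + -(Real.pi / 2)) volume
  have h3 := h1.setLIntegral_eq h2 (A.indicator fun _ => (1 : ℝ≥0∞)) (by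
    rintro ⟨_, n, rfl⟩ x
    by_cases hx : x ∈ A
    · rw [Set.indicator_of_mem hx]
      exact Set.indicator_of_mem ((hper n x).2 hx) _
    · rw [Set.indicator_of_notMem hx]
      exact Set.indicator_of_notMem (fun h => hx ((hper n x).1 h)) _)
  have h4 : ∫⁻ θ in anglePeriod, A.indicator (fun _ => (1 : ℝ≥0∞)) (φ + θ) =
      ∫⁻ θ in Set.Ioc (φ + -(Real.pi / 2)) (φ + -(Real.pi / 2) + 2 * Real.pi),
        A.indicator (fun _ => 1) θ := by
    rw [← lintegral_indicator measurableSet_Ioc, ← lintegral_indicator measurableSet_Ioc,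
      ← lintegral_add_left_eq_self (Set.indicator (Set.Ioc (φ + _) _) _) φ]
    congr with θ
    simp only [Set.indicator, Set.mem_Ioc, add_assoc, add_lt_add_iff_left, add_le_add_iff_left]
  rw [h4, ← h3, lintegral_indicator_const hA, one_mul, Measure.restrict_apply hA, Set.inter_comm]

lemma ofReal_le_lintegral_abs_cos {r : ℝ} (hr : 0 < r) :
    ENNReal.ofReal (4 * r) ≤ ∫⁻ φ in anglePeriod, ENNReal.ofReal (r * |Real.cos φ|) := by
  have hpi := Real.pi_pos
  have hA := (volume_image_sin hr 0 (A := Set.Ioo (-(Real.pi / 2)) (Real.pi / 2))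
    measurableSet_Ioo (Real.injOn_sin.mono Set.Ioo_subset_Icc_self)).2
  have hB := (volume_image_sin hr 0
    (A := Set.Ioo (Real.pi / 2) (-(Real.pi / 2) + 2 * Real.pi)) measurableSet_Ioo injOn_sin_Ioo).2
  have harc : ∀ t ∈ Set.Ioo (-r) r, Real.sin (Real.arcsin (t / r)) = t / r ∧
      Real.arcsin (t / r) ∈ Set.Ioo (-(Real.pi / 2)) (Real.pi / 2) := fun t ht => by
    have h1 : -1 < t / r := by rw [lt_div_iff₀ hr]; linarith [ht.1]
    have h2 : t / r < 1 := by rw [div_lt_one hr]; exact ht.2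
    exact ⟨Real.sin_arcsin h1.le h2.le, Real.neg_pi_div_two_lt_arcsin.2 h1,
      Real.arcsin_lt_pi_div_two.2 h2⟩
  have hA' : ENNReal.ofReal (r - -r) ≤
      ∫⁻ φ in Set.Ioo (-(Real.pi / 2)) (Real.pi / 2), ENNReal.ofReal (r * |Real.cos φ|) := by
    rw [hA, ← Real.volume_Ioo]
    refine measure_mono fun t ht => ⟨_, (harc t ht).2, ?_⟩
    simp only [(harc t ht).1]
    field_simp
    ring
  have hB' : ENNReal.ofReal (r - -r) ≤
      ∫⁻ φ in Set.Ioo (Real.pi / 2) (-(Real.pi / 2) + 2 * Real.pi),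
        ENNReal.ofReal (r * |Real.cos φ|) := by
    rw [hB, ← Real.volume_Ioo]
    refine measure_mono fun t ht => ⟨Real.pi - Real.arcsin (t / r), ?_, ?_⟩
    · obtain ⟨h1, h2⟩ := (harc t ht).2
      constructor <;> linarith
    · simp only [Real.sin_pi_sub, (harc t ht).1]
      field_simp
      ring
  calc ENNReal.ofReal (4 * r) = ENNReal.ofReal (r - -r) + ENNReal.ofReal (r - -r) := by
        rw [← ENNReal.ofReal_add (by linarith) (by linarith)]; congr 1; ring
    _ ≤ _ := add_le_add hA' hB'
    _ = ∫⁻ φ in Set.Ioo (-(Real.pi / 2)) (Real.pi / 2) ∪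
          Set.Ioo (Real.pi / 2) (-(Real.pi / 2) + 2 * Real.pi),
          ENNReal.ofReal (r * |Real.cos φ|) := by
        refine (lintegral_union measurableSet_Ioo ?_).symm
        exact Set.disjoint_left.2 fun x h1 h2 => lt_asymm h1.2 h2.1
    _ ≤ _ := by
        refine lintegral_mono_set ?_
        rintro x (h | h) <;> constructor <;> linarith [h.1, h.2]

lemma sum_volume_freeArc_le {r R : ℝ} (hR : 0 < R) (hRr : R ≤ r / 3) (F : Finset (ℝ × ℝ)) :
    ∑ c ∈ F, ENNReal.ofReal r * volume (anglePeriod ∩ freeArc r R F c) ≤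
      ENNReal.ofReal (2 * Real.pi * R) := by
  have hr : 0 < r := by linarith
  set w : ℝ → ℝ≥0∞ := fun φ => ENNReal.ofReal (r * |Real.cos φ|) with hw
  have hwm : Measurable w := by fun_prop
  have hmA := fun c => measurableSet_freeArc r R F c
  have hmeas : ∀ c, Measurable (Function.uncurry fun θ φ : ℝ =>
      w φ * (freeArc r R F c).indicator (fun _ => (1 : ℝ≥0∞)) (φ + θ)) := fun c =>
    (hwm.comp measurable_snd).mul
      ((measurable_const.indicator (hmA c)).comp (measurable_snd.add measurable_fst))
  have hdir : ∀ θ : ℝ, ∑ c ∈ F, ∫⁻ φ in anglePeriod,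
      w φ * (freeArc r R F c).indicator (fun _ => 1) (φ + θ) ≤ ENNReal.ofReal (4 * R) := by
    intro θ
    have h := sum_lintegral_freeArc_le hR hRr (F.image (rotateNeg θ))
    rw [Finset.sum_image (rotateNeg_injective θ).injOn] at h
    refine le_trans (le_of_eq (Finset.sum_congr rfl fun c _ => ?_)) h
    rw [Set.inter_comm, ← Measure.restrict_restrict (measurableSet_freeArc _ _ _ _),
      ← lintegral_indicator (measurableSet_freeArc _ _ _ _)]
    congr with φ
    by_cases hφ : φ + θ ∈ freeArc r R F c
    · rw [Set.indicator_of_mem hφ, Set.indicator_of_mem ((add_mem_freeArc_iff _ _ _ _ _ _).1 hφ),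
        mul_one]
    · rw [Set.indicator_of_notMem hφ,
        Set.indicator_of_notMem (fun h => hφ ((add_mem_freeArc_iff _ _ _ _ _ _).2 h)), mul_zero]
  have hswap : ∀ c, ENNReal.ofReal (4 * r) * volume (anglePeriod ∩ freeArc r R F c) ≤
      ∫⁻ θ in anglePeriod, ∫⁻ φ in anglePeriod,
        w φ * (freeArc r R F c).indicator (fun _ => 1) (φ + θ) := by
    intro c
    rw [lintegral_lintegral_swap (hmeas c).aemeasurable]
    have : ∀ φ, ∫⁻ θ in anglePeriod, w φ * (freeArc r R F c).indicator (fun _ => 1) (φ + θ) =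
        w φ * volume (anglePeriod ∩ freeArc r R F c) := fun φ => by
      have hm : Measurable fun θ : ℝ =>
          (freeArc r R F c).indicator (fun _ => (1 : ℝ≥0∞)) (φ + θ) :=
        (measurable_const.indicator (hmA c)).comp (measurable_const_add φ)
      rw [lintegral_const_mul _ hm, lintegral_indicator_add_anglePeriod (hmA c) fun n x =>
          add_two_pi_zsmul_mem_freeArc_iff r R F c x n]
    simp only [this]
    rw [lintegral_mul_const _ hwm]
    gcongr
    exact ofReal_le_lintegral_abs_cos hr
  have htotal : ∑ c ∈ F, ENNReal.ofReal (4 * r) * volume (anglePeriod ∩ freeArc r R F c) ≤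
      ENNReal.ofReal (4 * R) * ENNReal.ofReal (2 * Real.pi) :=
    calc _ ≤ ∑ c ∈ F, ∫⁻ θ in anglePeriod, ∫⁻ φ in anglePeriod,
          w φ * (freeArc r R F c).indicator (fun _ => 1) (φ + θ) :=
          Finset.sum_le_sum fun c _ => hswap c
      _ = ∫⁻ θ in anglePeriod, ∑ c ∈ F, ∫⁻ φ in anglePeriod,
          w φ * (freeArc r R F c).indicator (fun _ => 1) (φ + θ) := by
          rw [lintegral_finsetSum]
          exact fun c _ => (hmeas c).lintegral_prod_right
      _ ≤ ∫⁻ θ in anglePeriod, ENNReal.ofReal (4 * R) := lintegral_mono hdir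
      _ = _ := by
          rw [setLIntegral_const, Real.volume_Ioc, add_sub_cancel_left]
  have h4 : ∀ x : ℝ, ENNReal.ofReal (4 * x) = 4 * ENNReal.ofReal x := fun x => by
    rw [ENNReal.ofReal_mul (by norm_num)]; simp
  rw [← ENNReal.mul_le_mul_iff_right (a := 4) (by norm_num) (by norm_num), Finset.mul_sum]
  simp only [h4, mul_assoc] at htotal
  refine htotal.trans (le_of_eq ?_)
  rw [mul_comm (2 * Real.pi) R, ENNReal.ofReal_mul hR.le]

/-! ### Back to the Euclidean plane -/

lemma euclidean_plane_dist_sq (x y : EuclideanSpace ℝ (Fin 2)) :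
    dist x y ^ 2 = (x 0 - y 0) ^ 2 + (x 1 - y 1) ^ 2 := by
  rw [EuclideanSpace.dist_eq, Real.sq_sqrt (by positivity), Fin.sum_univ_two, Real.dist_eq,
    Real.dist_eq, sq_abs, sq_abs]

lemma lipschitzWith_circle (r : NNReal) (a b : ℝ) :
    LipschitzWith r fun φ : ℝ => !₂[a + r * Real.cos φ, b + r * Real.sin φ] := by
  refine LipschitzWith.of_dist_le_mul fun x y => ?_
  refine le_of_sq_le_sq ?_ (by positivity)
  rw [euclidean_plane_dist_sq, Real.dist_eq, mul_pow, sq_abs]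
  simp only [Matrix.cons_val_zero, Matrix.cons_val_one]
  have h := Real.one_sub_sq_div_two_le_cos (x := x - y)
  rw [Real.cos_sub] at h
  have h1 := Real.cos_sq_add_sin_sq x
  have h2 := Real.cos_sq_add_sin_sq y
  have h3 : (Real.cos x - Real.cos y) ^ 2 + (Real.sin x - Real.sin y) ^ 2 ≤ (x - y) ^ 2 := by
    linarith
  have h4 := mul_le_mul_of_nonneg_left h3 (sq_nonneg (r : ℝ))
  linarith

lemma exists_anglePeriod_eq {r x y : ℝ} (hr : 0 < r) (h : x ^ 2 + y ^ 2 = r ^ 2) :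
    ∃ φ ∈ anglePeriod, x = r * Real.cos φ ∧ y = r * Real.sin φ := by
  set z : ℂ := ⟨x / r, y / r⟩ with hz
  have hnorm : ‖z‖ = 1 := by
    rw [Complex.norm_def, Complex.normSq_apply, Real.sqrt_eq_one]
    simp only [hz]
    field_simp
    linarith
  have hz0 : z ≠ 0 := by
    intro h0
    rw [h0, norm_zero] at hnorm
    exact zero_ne_one hnorm
  have hcos := Complex.cos_arg hz0
  have hsin := Complex.sin_arg z
  rw [hnorm, div_one] at hcos hsin
  obtain ⟨n, hn, -⟩ := existsUnique_add_zsmul_mem_Ioc Real.two_pi_pos z.arg (-(Real.pi / 2))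
  refine ⟨_, hn, ?_, ?_⟩
  · simp only [zsmul_eq_mul, Real.cos_add_int_mul_two_pi, hcos]
    exact (mul_div_cancel₀ x hr.ne').symm
  · simp only [zsmul_eq_mul, Real.sin_add_int_mul_two_pi, hsin]
    exact (mul_div_cancel₀ y hr.ne').symm

lemma frontier_iUnion_closedBall {ι E : Type*} [Finite ι] [MetricSpace E] {r : ℝ} {O : ι → E}
    {P : E} (hP : P ∈ frontier (⋃ i, Metric.closedBall (O i) r)) :
    (∃ i, dist P (O i) = r) ∧ ∀ j, r ≤ dist P (O j) := by
  have hcl : IsClosed (⋃ i, Metric.closedBall (O i) r) :=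
    isClosed_iUnion_of_finite fun i => Metric.isClosed_closedBall
  rw [hcl.frontier_eq] at hP
  have hout : ∀ j, r ≤ dist P (O j) := by
    intro j
    by_contra! h
    refine hP.2 (interior_maximal ?_ Metric.isOpen_ball (Metric.mem_ball.2 h))
    exact Metric.ball_subset_closedBall.trans
      (Set.subset_iUnion (fun i => Metric.closedBall (O i) r) j)
  obtain ⟨i, hi⟩ := Set.mem_iUnion.1 hP.1
  exact ⟨⟨i, le_antisymm hi (hout i)⟩, hout⟩

/-- Lemma on the length of the boundary: given finitely many points
`O_i` and a closed ball `ℬ' = closedBall(O', r')` with `r' ≤ r/3`, with all the circles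
`sphere(O_i, r)` and `sphere(O', r')` in general position (any two are disjoint or meet
in exactly two points, and no point lies on three of them), the length (1-dimensional
Hausdorff measure) of the boundary between `ℛ₁ = ℬ' ∩ ⋃ᵢ closedBall(O_i, r)` and
`ℛ₂ = ℬ' \ ℛ₁` is at most the perimeter `2πr'` of `ℬ'`. -/
theorem stmt13 {ι : Type} [Fintype ι] (r r' : ℝ) (hr : 0 < r) (hr' : r' ≤ r / 3)
    (O : ι → EuclideanSpace ℝ (Fin 2)) (O' : EuclideanSpace ℝ (Fin 2))
    (circ : Option ι → Set (EuclideanSpace ℝ (Fin 2)))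
    (hcirc : circ = fun a =>
      a.elim (Metric.sphere O' r') fun i => Metric.sphere (O i) r)
    (hgp₂ : ∀ a b : Option ι, a ≠ b →
      circ a ∩ circ b = ∅ ∨ ∃ x y, x ≠ y ∧ circ a ∩ circ b = {x, y})
    (hgp₃ : ∀ a b c : Option ι, a ≠ b → b ≠ c → a ≠ c →
      circ a ∩ circ b ∩ circ c = ∅) :
    μH[1] (frontier (⋃ i, Metric.closedBall (O i) r) ∩ Metric.closedBall O' r') ≤
      ENNReal.ofReal (2 * Real.pi * r') := by
  classical
  have := Measure.nullSingletonClass_hausdorff (EuclideanSpace ℝ (Fin 2)) one_pos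
  rcases le_or_gt r' 0 with hr'0 | hr'0
  · have hsub : (Metric.closedBall O' r').Subsingleton := fun x hx y hy => by
      rw [Metric.mem_closedBall] at hx hy
      rw [dist_le_zero.1 (hx.trans hr'0), dist_le_zero.1 (hy.trans hr'0)]
    rw [(hsub.anti Set.inter_subset_right).measure_zero]
    exact zero_le
  set ctr : ι → ℝ × ℝ := fun i => (O i 0 - O' 0, O i 1 - O' 1) with hctr
  set F : Finset (ℝ × ℝ) := Finset.univ.image ctr
  set f : ℝ × ℝ → ℝ → EuclideanSpace ℝ (Fin 2) := fun c φ =>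
    !₂[O' 0 + c.1 + r.toNNReal * Real.cos φ, O' 1 + c.2 + r.toNNReal * Real.sin φ] with hf
  have hcover : frontier (⋃ i, Metric.closedBall (O i) r) ∩ Metric.closedBall O' r' ⊆
      (⋃ i, circ (some i) ∩ circ none) ∪
        ⋃ c ∈ F, f c '' (anglePeriod ∩ freeArc r r' F c) := by
    rintro P ⟨hP, hPB⟩
    obtain ⟨⟨i, hi⟩, hout⟩ := frontier_iUnion_closedBall hP
    rw [Metric.mem_closedBall] at hPB
    rcases hPB.eq_or_lt with hPB | hPB
    · left
      exact Set.mem_iUnion.2 ⟨i, by rw [hcirc]; exact ⟨hi, hPB⟩⟩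
    right
    have hi2 := euclidean_plane_dist_sq P (O i)
    rw [hi] at hi2
    obtain ⟨φ, hφ, hx, hy⟩ := exists_anglePeriod_eq hr hi2.symm
    refine Set.mem_iUnion₂.2 ⟨ctr i, Finset.mem_image_of_mem _ (Finset.mem_univ i), φ,
      ⟨hφ, ?_, ?_⟩, ?_⟩
    · have h1 := euclidean_plane_dist_sq P O'
      have h2 := pow_lt_pow_left₀ hPB dist_nonneg two_ne_zero
      rw [h1] at h2
      simp only [hctr, ← hx, ← hy]
      linarith
    · simp only [F, Finset.forall_mem_image]
      intro j _
      have h1 := euclidean_plane_dist_sq P (O j)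
      have h2 := pow_le_pow_left₀ hr.le (hout j) 2
      rw [h1] at h2
      simp only [hctr, ← hx, ← hy]
      linarith
    · ext k
      fin_cases k
      · simp [hf, hctr, hr.le, ← hx]
      · simp [hf, hctr, hr.le, ← hy]
  have hnull : μH[1] (⋃ i, circ (some i) ∩ circ none) = 0 := by
    refine measure_iUnion_null fun i => ?_
    rcases hgp₂ (some i) none (by simp) with h | ⟨x, y, -, h⟩
    · rw [h, measure_empty]
    · rw [h]
      exact (Set.toFinite {x, y}).measure_zero _
  have harc : ∀ c ∈ F, μH[1] (f c '' (anglePeriod ∩ freeArc r r' F c)) ≤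
      ENNReal.ofReal r * volume (anglePeriod ∩ freeArc r r' F c) := fun c _ => by
    have h := (lipschitzWith_circle r.toNNReal (O' 0 + c.1) (O' 1 + c.2)).hausdorffMeasure_image_le
      zero_le_one (anglePeriod ∩ freeArc r r' F c)
    rwa [ENNReal.rpow_one, hausdorffMeasure_real] at h
  calc _ ≤ μH[1] (⋃ i, circ (some i) ∩ circ none) +
        μH[1] (⋃ c ∈ F, f c '' (anglePeriod ∩ freeArc r r' F c)) :=
        (measure_mono hcover).trans (measure_union_le _ _)
    _ ≤ 0 + ∑ c ∈ F, ENNReal.ofReal r * volume (anglePeriod ∩ freeArc r r' F c) :=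
        add_le_add hnull.le ((measure_biUnion_finset_le _ _).trans (Finset.sum_le_sum harc))
    _ ≤ _ := by
        rw [zero_add]
        exact sum_volume_freeArc_le hr'0 hr' F
end

section
/- Let O, O₂ be points in the Euclidean plane ℝ² and let 0 < r₁ < r₂. Let A and B be two points inside the closed ball closedBall(O, r₁). Suppose γ is a connected subset of the circle sphere(O₂, r₂) containing A and B whose diameter equals dist(A, B) (i.e., γ is an arc between A and B with diameter |AB|). Then γ ⊆ closedBall(O, r₁). -/
/-- Two points at the same distance `r` from `C` and at distance less than `2 * r` from each other
admit coordinates, orthogonal up to the scale factor `H`, in which `C` is the origin and the two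
points are `(-k, 1)` and `(k, 1)`. -/
theorem exists_scaled_coordinates (C A B : EuclideanSpace ℝ (Fin 2)) (r : ℝ)
    (hA : dist A C = r) (hB : dist B C = r) (hAB : dist A B < 2 * r) :
    ∃ (s t : EuclideanSpace ℝ (Fin 2) → ℝ) (H k : ℝ), 0 < H ∧ Continuous t ∧
      (∀ x y, dist x y ^ 2 = H * ((s x - s y) ^ 2 + (t x - t y) ^ 2)) ∧
      s C = 0 ∧ t C = 0 ∧ s A = -k ∧ t A = 1 ∧ s B = k ∧ t B = 1 := by
  have hd : ∀ x y : EuclideanSpace ℝ (Fin 2),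
      dist x y ^ 2 = (x 0 - y 0) ^ 2 + (x 1 - y 1) ^ 2 := by
    intro x y
    simp [EuclideanSpace.dist_sq_eq, Fin.sum_univ_two, Real.dist_eq, sq_abs]
  have h1 := hd A C
  have h2 := hd B C
  have h3 := hd A B
  rw [hA] at h1
  rw [hB] at h2
  have h4 : dist A B ^ 2 < (2 * r) ^ 2 := by
    have := dist_nonneg (x := A) (y := B)
    gcongr
  rw [h3] at h4
  obtain ⟨m, hm⟩ : ∃ m, m = (A 0 + B 0) / 2 - C 0 := ⟨_, rfl⟩
  obtain ⟨n, hn⟩ : ∃ n, n = (A 1 + B 1) / 2 - C 1 := ⟨_, rfl⟩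
  have hH : 0 < m ^ 2 + n ^ 2 := by
    subst hm hn
    nlinarith
  refine ⟨fun x => ((x 1 - C 1) * m - (x 0 - C 0) * n) / (m ^ 2 + n ^ 2),
    fun x => ((x 0 - C 0) * m + (x 1 - C 1) * n) / (m ^ 2 + n ^ 2), m ^ 2 + n ^ 2,
    ((B 1 - C 1) * m - (B 0 - C 0) * n) / (m ^ 2 + n ^ 2), hH, by fun_prop, ?_, by simp, by simp,
    ?_, ?_, rfl, ?_⟩
  · intro x y
    rw [hd]
    field_simp
    ring
  · field_simp
    subst hm hn
    ring
  · field_simp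
    subst hm hn
    linarith
  · field_simp
    subst hm hn
    linarith


/-- Observation on arcs: if `A` and `B` lie in the closed ball of radius
`r₁ < r₂` around `O`, and `γ` is a connected subset of the circle of radius `r₂` around
`O₂` containing `A` and `B` whose diameter equals `dist A B`, then `γ` is contained in
the closed ball of radius `r₁` around `O`. -/
theorem stmt14 (r₁ r₂ : ℝ) (hr₁ : 0 < r₁) (hr₁₂ : r₁ < r₂)
    (O O₂ A B : EuclideanSpace ℝ (Fin 2))
    (hA : A ∈ Metric.closedBall O r₁) (hB : B ∈ Metric.closedBall O r₁)
    (γ : Set (EuclideanSpace ℝ (Fin 2)))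
    (hγ : γ ⊆ Metric.sphere O₂ r₂) (hconn : IsPreconnected γ)
    (hAγ : A ∈ γ) (hBγ : B ∈ γ)
    (hdiam : Metric.diam γ = dist A B) :
    γ ⊆ Metric.closedBall O r₁ := by
  rw [Metric.mem_closedBall] at hA hB
  have hAB : dist A B < 2 * r₂ := by
    linarith [dist_triangle_right A B O]
  obtain ⟨s, t, H, k, hH, ht, hd, hsC, htC, hsA, htA, hsB, htB⟩ :=
    exists_scaled_coordinates O₂ A B r₂ (hγ hAγ) (hγ hBγ) hAB
  have hbdd : Bornology.IsBounded γ := Metric.isBounded_sphere.subset hγ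
  have hcirc : ∀ x ∈ γ, s x ^ 2 + t x ^ 2 = k ^ 2 + 1 := by
    intro x hx
    have h1 := hd x O₂
    have h2 := hd B O₂
    rw [Metric.mem_sphere.1 (hγ hx), hsC, htC] at h1
    rw [Metric.mem_sphere.1 (hγ hBγ), hsC, htC, hsB, htB] at h2
    refine mul_left_cancel₀ hH.ne' ?_
    linarith
  have hnear : ∀ x ∈ γ, ∀ y ∈ γ,
      (s x - s y) ^ 2 + (t x - t y) ^ 2 ≤ 4 * k ^ 2 := by
    intro x hx y hy
    have h1 : dist x y ≤ dist A B := hdiam ▸ Metric.dist_le_diam_of_mem hbdd hx hy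
    have h2 : dist x y ^ 2 ≤ dist A B ^ 2 := by gcongr
    rw [hd, hd, hsA, hsB, htA, htB] at h2
    linarith [le_of_mul_le_mul_left h2 hH]
  have hnA : ∀ x ∈ γ, (s x + k) ^ 2 + (t x - 1) ^ 2 ≤ 4 * k ^ 2 := by
    intro x hx
    have := hnear x hx A hAγ
    rwa [hsA, htA, sub_neg_eq_add] at this
  have hnB : ∀ x ∈ γ, (s x - k) ^ 2 + (t x - 1) ^ 2 ≤ 4 * k ^ 2 := by
    intro x hx
    have := hnear x hx B hBγ
    rwa [hsB, htB] at this
  have hne : ∀ x ∈ γ, t x ≠ -1 := by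
    intro x hx h
    have h1 := hcirc x hx
    have h2 := hnA x hx
    have h3 := hnB x hx
    rw [h] at h1 h2 h3
    rcases sq_eq_sq_iff_eq_or_eq_neg.1 (show s x ^ 2 = k ^ 2 by linarith) with h4 | h4 <;>
      rw [h4] at h2 h3 <;> nlinarith
  have hgt : ∀ x ∈ γ, -1 < t x := by
    intro x hx
    by_contra! h
    obtain ⟨y, hy, hy'⟩ := hconn.intermediate_value hx hAγ ht.continuousOn
      (show (-1 : ℝ) ∈ Set.Icc (t x) (t A) from ⟨h, by rw [htA]; norm_num⟩)
    exact hne y hy hy'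
  have hge : ∀ x ∈ γ, 1 ≤ t x := by
    intro x hx
    by_contra! h
    have h1 := hcirc x hx
    have h2 := hnA x hx
    have h3 := hnB x hx
    have h4 : k ^ 2 < s x ^ 2 := by nlinarith [hgt x hx]
    have h5 : k ^ 2 ≤ |s x * k| := by
      rw [abs_mul, ← sq_abs k, sq]
      exact mul_le_mul_of_nonneg_right (sq_lt_sq.1 h4).le (abs_nonneg k)
    rcases abs_cases (s x * k) with ⟨h6, _⟩ | ⟨h6, _⟩ <;> rw [h6] at h5 <;>
      nlinarith [sq_nonneg (t x - 1)]
  intro x hx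
  rw [Metric.mem_closedBall]
  refine abs_le_of_sq_le_sq' ?_ hr₁.le |>.2
  have hA2 : dist A O ^ 2 ≤ r₁ ^ 2 := by gcongr
  have hB2 : dist B O ^ 2 ≤ r₁ ^ 2 := by gcongr
  have hr : r₁ ^ 2 < r₂ ^ 2 := by gcongr
  have hr₂ := hd B O₂
  rw [Metric.mem_sphere.1 (hγ hBγ), hsB, htB, hsC, htC] at hr₂
  rw [hd, hsA, htA] at hA2
  rw [hd, hsB, htB] at hB2
  rw [hd]
  obtain ⟨R, hR⟩ : ∃ R, r₁ ^ 2 = H * R := ⟨r₁ ^ 2 / H, by field_simp⟩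
  rw [hR] at hA2 hB2 hr ⊢
  rw [hr₂] at hr
  replace hA2 := le_of_mul_le_mul_left hA2 hH
  replace hB2 := le_of_mul_le_mul_left hB2 hH
  replace hr := lt_of_mul_lt_mul_left hr hH.le
  refine mul_le_mul_of_nonneg_left ?_ hH.le
  have h1 := hcirc x hx
  have h2 := hge x hx
  have hq : 0 < t O := by nlinarith [sq_nonneg (s O), sq_nonneg (t O)]
  have hsk : |s x| ≤ |k| := sq_le_sq.1 (by nlinarith)
  have hps : -(s O * s x) ≤ |s O * k| := by
    refine (neg_le_abs _).trans ?_
    rw [abs_mul, abs_mul]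
    gcongr
  have hqt : t O * 1 ≤ t O * t x := by gcongr
  rcases abs_cases (s O * k) with ⟨h6, _⟩ | ⟨h6, _⟩ <;> rw [h6] at hps <;> nlinarith
end

section
/- Fix r > 0 and ε > 0 with 2ε < r/3. Let {O_i}_{i ∈ I} be a finite set of points in the Euclidean plane ℝ², let B_R = closedBall(O, r/3) for some point O, and assume the circles {sphere(O_i, r)}_{i ∈ I} together with sphere(O, r/3) are in general position (any two of these circles are either disjoint or intersect transversally in exactly two points, and no point lies on three of them). Let ℛ₂ = B_R \ (⋃_{i ∈ I} closedBall(O_i, r)), and let S be a connected component of ℛ₂ whose boundary has length ℋ¹(frontier S) > 6πε (a 'large' component). Then the area (two-dimensional Lebesgue measure) of the ε-tube t_ε(frontier S) = {Q ∈ ℝ² : dist(Q, frontier S) ≤ ε} is at most 2ε · ℋ¹(frontier S). -/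
open MeasureTheory
open scoped ENNReal

/-- The point at angle `θ` on the circle with centre `c` and radius `ρ`. -/
noncomputable def circlePoint (c : EuclideanSpace ℝ (Fin 2)) (ρ θ : ℝ) :
    EuclideanSpace ℝ (Fin 2) :=
  !₂[c 0 + ρ * Real.cos θ, c 1 + ρ * Real.sin θ]

@[simp]
theorem circlePoint_zero (c : EuclideanSpace ℝ (Fin 2)) (ρ θ : ℝ) :
    circlePoint c ρ θ 0 = c 0 + ρ * Real.cos θ := rfl

@[simp]
theorem circlePoint_one (c : EuclideanSpace ℝ (Fin 2)) (ρ θ : ℝ) :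
    circlePoint c ρ θ 1 = c 1 + ρ * Real.sin θ := rfl

theorem continuous_circlePoint (c : EuclideanSpace ℝ (Fin 2)) (ρ : ℝ) :
    Continuous (circlePoint c ρ) := by
  refine (PiLp.continuous_toLp 2 _).comp (continuous_pi fun i => ?_)
  fin_cases i
  · exact (continuous_const.add (continuous_const.mul Real.continuous_cos))
  · exact (continuous_const.add (continuous_const.mul Real.continuous_sin))

theorem dist_sq_plane (p q : EuclideanSpace ℝ (Fin 2)) :
    dist p q ^ 2 = (p 0 - q 0) ^ 2 + (p 1 - q 1) ^ 2 := by
  rw [EuclideanSpace.dist_eq, Real.sq_sqrt (by positivity), Fin.sum_univ_two, Real.dist_eq,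
    Real.dist_eq, sq_abs, sq_abs]

theorem plane_ext {p q : EuclideanSpace ℝ (Fin 2)} (h0 : p 0 = q 0) (h1 : p 1 = q 1) : p = q := by
  ext i
  fin_cases i
  · exact h0
  · exact h1

theorem circlePoint_mem_sphere (c : EuclideanSpace ℝ (Fin 2)) {ρ : ℝ} (hρ : 0 ≤ ρ) (θ : ℝ) :
    circlePoint c ρ θ ∈ Metric.sphere c ρ := by
  rw [Metric.mem_sphere, ← sq_eq_sq₀ dist_nonneg hρ, dist_sq_plane]
  simp only [circlePoint_zero, circlePoint_one]
  linear_combination ρ ^ 2 * Real.sin_sq_add_cos_sq θ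

theorem exists_circlePoint_eq {c p : EuclideanSpace ℝ (Fin 2)} {ρ : ℝ} (hρ : 0 < ρ)
    (hp : p ∈ Metric.sphere c ρ) (θ₀ : ℝ) :
    ∃ θ ∈ Set.Ico θ₀ (θ₀ + 2 * Real.pi), circlePoint c ρ θ = p := by
  rw [Metric.mem_sphere, ← sq_eq_sq₀ dist_nonneg hρ.le, dist_sq_plane] at hp
  set z : ℂ := ⟨p 0 - c 0, p 1 - c 1⟩ with hz
  have hnorm : ‖z‖ = ρ := by
    rw [← sq_eq_sq₀ (norm_nonneg _) hρ.le, Complex.sq_norm, Complex.normSq_apply]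
    simp only [hz]
    linarith
  have hz0 : z ≠ 0 := by
    rw [← norm_pos_iff, hnorm]
    exact hρ
  have hmod : toIcoMod Real.two_pi_pos θ₀ z.arg
      = z.arg - (toIcoDiv Real.two_pi_pos θ₀ z.arg : ℤ) * (2 * Real.pi) := by
    rw [toIcoMod, zsmul_eq_mul]
  refine ⟨toIcoMod Real.two_pi_pos θ₀ z.arg, toIcoMod_mem_Ico _ _ _, plane_ext ?_ ?_⟩
  · rw [circlePoint_zero, hmod, Real.cos_sub_int_mul_two_pi, Complex.cos_arg hz0, hnorm]
    simp only [hz]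
    field_simp
    ring
  · rw [circlePoint_one, hmod, Real.sin_sub_int_mul_two_pi, Complex.sin_arg, hnorm]
    simp only [hz]
    field_simp
    ring

theorem dist_circlePoint (c : EuclideanSpace ℝ (Fin 2)) {ρ : ℝ} (hρ : 0 ≤ ρ) (s t : ℝ) :
    dist (circlePoint c ρ s) (circlePoint c ρ t) = 2 * ρ * |Real.sin ((s - t) / 2)| := by
  rw [← sq_eq_sq₀ dist_nonneg (by positivity), dist_sq_plane, mul_pow, sq_abs]
  have h := Real.cos_sq ((s - t) / 2)
  rw [mul_div_cancel₀ (s - t) two_ne_zero] at h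
  have h' := Real.sin_sq_add_cos_sq ((s - t) / 2)
  rw [Real.cos_sub] at h
  simp only [circlePoint_zero, circlePoint_one]
  linear_combination ρ ^ 2 * Real.sin_sq_add_cos_sq s + ρ ^ 2 * Real.sin_sq_add_cos_sq t
    + 4 * ρ ^ 2 * h - 4 * ρ ^ 2 * h'

theorem injOn_circlePoint (c : EuclideanSpace ℝ (Fin 2)) {ρ : ℝ} (hρ : 0 < ρ) (a : ℝ) :
    Set.InjOn (circlePoint c ρ) (Set.Ico a (a + 2 * Real.pi)) := by
  intro s hs t ht h
  rw [← dist_eq_zero, dist_circlePoint c hρ.le, mul_eq_zero, abs_eq_zero] at h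
  rcases h with h | h
  · linarith
  · rw [Real.sin_eq_zero_iff_of_lt_of_lt (by linarith [hs.1, ht.2]) (by linarith [hs.2, ht.1])]
      at h
    linarith

theorem sphere_diff_circlePoint (c : EuclideanSpace ℝ (Fin 2)) {ρ : ℝ} (hρ : 0 < ρ) (θ₀ : ℝ) :
    Metric.sphere c ρ \ {circlePoint c ρ θ₀} =
      circlePoint c ρ '' Set.Ioo θ₀ (θ₀ + 2 * Real.pi) := by
  ext q
  constructor
  · rintro ⟨hq, hne⟩
    obtain ⟨θ, hθ, rfl⟩ := exists_circlePoint_eq hρ hq θ₀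
    refine ⟨θ, ⟨lt_of_le_of_ne hθ.1 ?_, hθ.2⟩, rfl⟩
    rintro rfl
    exact hne rfl
  · rintro ⟨θ, hθ, rfl⟩
    refine ⟨circlePoint_mem_sphere c hρ.le θ, fun h => hθ.1.ne' ?_⟩
    exact injOn_circlePoint c hρ θ₀ ⟨hθ.1.le, hθ.2⟩ ⟨le_rfl, by linarith [Real.pi_pos]⟩ h

theorem isPreconnected_sphere_diff_singleton {c p : EuclideanSpace ℝ (Fin 2)} {ρ : ℝ}
    (hρ : 0 < ρ) (hp : p ∈ Metric.sphere c ρ) :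
    IsPreconnected (Metric.sphere c ρ \ {p}) := by
  obtain ⟨θ₀, -, rfl⟩ := exists_circlePoint_eq hρ hp 0
  rw [sphere_diff_circlePoint c hρ]
  exact isPreconnected_Ioo.image _ (continuous_circlePoint c ρ).continuousOn

theorem sphere_subset_closure_diff_singleton {c p : EuclideanSpace ℝ (Fin 2)} {ρ : ℝ}
    (hρ : 0 < ρ) (hp : p ∈ Metric.sphere c ρ) :
    Metric.sphere c ρ ⊆ closure (Metric.sphere c ρ \ {p}) := by
  intro q hq
  by_cases hqp : q = p
  · obtain ⟨θ₀, -, rfl⟩ := exists_circlePoint_eq hρ hp 0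
    rw [sphere_diff_circlePoint c hρ, hqp]
    refine image_closure_subset_closure_image (continuous_circlePoint c ρ) ⟨θ₀, ?_, rfl⟩
    rw [closure_Ioo (by linarith [Real.pi_pos])]
    exact ⟨le_rfl, by linarith [Real.pi_pos]⟩
  · exact subset_closure ⟨hq, hqp⟩

theorem exists_dist_eq_abs (Q c : EuclideanSpace ℝ (Fin 2)) (t : ℝ) :
    ∃ x, dist x Q = |t| ∧ dist x c = |dist Q c + t| := by
  obtain ⟨θ, hθ⟩ : ∃ θ, circlePoint c (dist Q c) θ = Q := by
    rcases (dist_nonneg (x := Q) (y := c)).eq_or_lt with h | h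
    · refine ⟨0, ?_⟩
      rw [← h, dist_eq_zero.1 h.symm]
      exact plane_ext (by simp) (by simp)
    · obtain ⟨θ, -, hθ⟩ := exists_circlePoint_eq h (p := Q) rfl 0
      exact ⟨θ, hθ⟩
  have h0 := congrArg (fun p => p 0) hθ
  have h1 := congrArg (fun p => p 1) hθ
  simp only [circlePoint_zero, circlePoint_one] at h0 h1
  refine ⟨circlePoint c (dist Q c + t) θ, ?_, ?_⟩
  · rw [← sq_eq_sq₀ dist_nonneg (abs_nonneg _), dist_sq_plane, sq_abs, circlePoint_zero,
      circlePoint_one, ← h0, ← h1]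
    linear_combination t ^ 2 * Real.sin_sq_add_cos_sq θ
  · rw [← sq_eq_sq₀ dist_nonneg (abs_nonneg _), dist_sq_plane, sq_abs, circlePoint_zero,
      circlePoint_one]
    linear_combination (dist Q c + t) ^ 2 * Real.sin_sq_add_cos_sq θ

theorem cos_mul_volume_le_hausdorffMeasure_image (c : EuclideanSpace ℝ (Fin 2)) {ρ h : ℝ}
    (hρ : 0 < ρ) (hh : 0 < h) (hh' : h < Real.pi / 2) {E : Set ℝ}
    (hE : ∀ s ∈ E, ∀ t ∈ E, |s - t| ≤ 2 * h) :
    ENNReal.ofReal (Real.cos h * ρ) * volume E ≤ μH[1] (circlePoint c ρ '' E) := by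
  have hcos : 0 < Real.cos h := Real.cos_pos_of_mem_Ioo ⟨by linarith [Real.pi_pos], hh'⟩
  have key : ∀ s ∈ E, ∀ t ∈ E, Real.cos h * ρ * |s - t| ≤
      dist (circlePoint c ρ s) (circlePoint c ρ t) := by
    intro s hs t ht
    rw [dist_circlePoint c hρ.le]
    set x := |s - t| / 2 with hx
    have hx0 : 0 ≤ x := by positivity
    have hxh : x ≤ h := by linarith [hE s hs t ht]
    have h1 : |Real.sin ((s - t) / 2)| = Real.sin x := by
      have habs : |(s - t) / 2| = x := by rw [abs_div, abs_two]
      rw [Real.abs_sin_eq_sin_abs_of_abs_le_pi (by rw [habs]; linarith [Real.pi_pos]), habs]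
    have h2 : x * Real.cos x ≤ Real.sin x := by
      have := Real.le_tan hx0 (by linarith)
      have hc : 0 < Real.cos x := Real.cos_pos_of_mem_Ioo ⟨by linarith [Real.pi_pos], by linarith⟩
      rwa [Real.tan_eq_sin_div_cos, le_div_iff₀ hc] at this
    have h3 : Real.cos h ≤ Real.cos x :=
      Real.cos_le_cos_of_nonneg_of_le_pi hx0 (by linarith [Real.pi_pos]) hxh
    rw [h1]
    have h4 : x * Real.cos h ≤ Real.sin x := le_trans (by gcongr) h2
    have h5 : |s - t| = 2 * x := by rw [hx]; ring
    rw [h5]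
    nlinarith
  have hinj : Set.InjOn (circlePoint c ρ) E := by
    intro s hs t ht hst
    have := key s hs t ht
    rw [hst, dist_self] at this
    have h0 : |s - t| ≤ 0 := by
      by_contra hlt
      push Not at hlt
      have : 0 < Real.cos h * ρ * |s - t| := by positivity
      linarith
    exact sub_eq_zero.1 (abs_nonpos_iff.1 h0)
  obtain ⟨g, hgl⟩ : ∃ g, Set.LeftInvOn g (circlePoint c ρ) E := ⟨_, hinj.leftInvOn_invFunOn⟩
  have hg : g '' (circlePoint c ρ '' E) = E := hgl.image_image
  have hlip : LipschitzOnWith (Real.toNNReal (Real.cos h * ρ)⁻¹) g (circlePoint c ρ '' E) := by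
    refine LipschitzOnWith.of_dist_le_mul ?_
    rintro _ ⟨s, hs, rfl⟩ _ ⟨t, ht, rfl⟩
    rw [hgl hs, hgl ht, Real.coe_toNNReal _ (by positivity),
      Real.dist_eq, ← div_eq_inv_mul, le_div_iff₀ (by positivity)]
    linarith [key s hs t ht]
  have := hlip.hausdorffMeasure_image_le (d := 1) zero_le_one
  rw [hg, hausdorffMeasure_real, ENNReal.rpow_one, ENNReal.ofNNReal_toNNReal,
    ENNReal.ofReal_inv_of_pos (by positivity)] at this
  rwa [← ENNReal.div_eq_inv_mul,
    ENNReal.le_div_iff_mul_le (Or.inl (by simp; positivity)) (Or.inl ENNReal.ofReal_ne_top),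
    mul_comm] at this

theorem mul_volume_le_hausdorffMeasure_image (c : EuclideanSpace ℝ (Fin 2)) {ρ : ℝ}
    (hρ : 0 < ρ) {E : Set ℝ} (hE : MeasurableSet E) (hE' : E ⊆ Set.Ico 0 (2 * Real.pi)) :
    ENNReal.ofReal ρ * volume E ≤ μH[1] (circlePoint c ρ '' E) := by
  have hinj : Set.InjOn (circlePoint c ρ) E := by
    refine (injOn_circlePoint c hρ 0).mono ?_
    rwa [zero_add]
  have key : ∀ n : ℕ, 2 < n →
      ENNReal.ofReal (Real.cos (Real.pi / n) * ρ) * volume E ≤ μH[1] (circlePoint c ρ '' E) := by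
    intro n hn
    have hn0 : (0 : ℝ) < n := by exact_mod_cast (by omega : 0 < n)
    have hn2 : (2 : ℝ) < n := by exact_mod_cast hn
    set h := Real.pi / n with hh
    have hpos : 0 < h := div_pos Real.pi_pos hn0
    have hlt : h < Real.pi / 2 := div_lt_div_of_pos_left Real.pi_pos two_pos hn2
    have hnh : n * (2 * h) = 2 * Real.pi := by rw [hh]; field_simp
    let F : ℕ → Set ℝ := fun k => E ∩ Set.Ico (k * (2 * h)) ((k + 1) * (2 * h))
    have hFm : ∀ k, MeasurableSet (F k) := fun k => hE.inter measurableSet_Ico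
    have hcover : E ⊆ ⋃ k ∈ Finset.range n, F k := by
      intro s hs
      have hs0 := (hE' hs).1
      have hs1 := (hE' hs).2
      refine Set.mem_biUnion (x := ⌊s / (2 * h)⌋₊) ?_ ⟨hs, ?_, ?_⟩
      · rw [Finset.coe_range, Set.mem_Iio, Nat.floor_lt (by positivity),
          div_lt_iff₀ (by positivity), hnh]
        exact hs1
      · rw [← le_div_iff₀ (by positivity)]
        exact Nat.floor_le (by positivity)
      · rw [← div_lt_iff₀ (by positivity)]
        exact Nat.lt_floor_add_one _
    have hdisj : Pairwise (Function.onFun Disjoint F) := by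
      intro j k hjk
      refine Set.disjoint_left.2 fun s hj hk => hjk ?_
      have h1 : (j : ℝ) < k + 1 := lt_of_mul_lt_mul_right (hj.2.1.trans_lt hk.2.2) (by positivity)
      have h2 : (k : ℝ) < j + 1 := lt_of_mul_lt_mul_right (hk.2.1.trans_lt hj.2.2) (by positivity)
      norm_cast at h1 h2
      omega
    calc ENNReal.ofReal (Real.cos h * ρ) * volume E
        ≤ ENNReal.ofReal (Real.cos h * ρ) * ∑ k ∈ Finset.range n, volume (F k) := by
          gcongr
          exact (measure_mono hcover).trans (measure_biUnion_finset_le _ _)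
      _ = ∑ k ∈ Finset.range n, ENNReal.ofReal (Real.cos h * ρ) * volume (F k) :=
          Finset.mul_sum _ _ _
      _ ≤ ∑ k ∈ Finset.range n, μH[1] (circlePoint c ρ '' F k) := by
          refine Finset.sum_le_sum fun k _ => ?_
          refine cos_mul_volume_le_hausdorffMeasure_image c hρ hpos hlt fun s hs t ht => ?_
          rw [abs_le]
          constructor <;> linarith [hs.2.1, hs.2.2, ht.2.1, ht.2.2]
      _ = μH[1] (⋃ k ∈ Finset.range n, circlePoint c ρ '' F k) := by
          refine (measure_biUnion_finset ?_ fun k _ => ?_).symm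
          · intro j _ k _ hjk
            exact Set.disjoint_image_image fun s hs t ht hst =>
              Set.disjoint_left.1 (hdisj hjk) hs (hinj hs.1 ht.1 hst ▸ ht)
          · exact (hFm k).image_of_continuousOn_injOn (continuous_circlePoint c ρ).continuousOn
              (hinj.mono Set.inter_subset_left)
      _ ≤ μH[1] (circlePoint c ρ '' E) :=
          measure_mono (Set.iUnion₂_subset fun k _ => Set.image_mono Set.inter_subset_left)
  have hlim : Filter.Tendsto
      (fun n : ℕ => ENNReal.ofReal (Real.cos (Real.pi / n) * ρ) * volume E) Filter.atTop
      (nhds (ENNReal.ofReal ρ * volume E)) := by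
    refine ENNReal.Tendsto.mul_const (ENNReal.tendsto_ofReal ?_)
      (Or.inl (ENNReal.ofReal_pos.2 hρ).ne')
    have h0 := (Real.continuous_cos.tendsto 0).comp
      (tendsto_const_div_atTop_nhds_zero_nat Real.pi)
    rw [Real.cos_zero] at h0
    simpa using h0.mul_const ρ
  exact le_of_tendsto hlim ((Filter.eventually_gt_atTop 2).mono key)

/-- The point reached from the point at angle `z.1` on the circle of radius `ρ` about `(a, b)`
by moving a distance `ε` in the direction `z.1 + z.2`. -/
noncomputable def sweep (a b ρ ε : ℝ) (z : ℝ × ℝ) : ℝ × ℝ :=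
  (a + ρ * Real.cos z.1 + ε * Real.cos (z.1 + z.2),
    b + ρ * Real.sin z.1 + ε * Real.sin (z.1 + z.2))

/-- The derivative of `sweep`. -/
noncomputable def sweepDeriv (ρ ε : ℝ) (z : ℝ × ℝ) : ℝ × ℝ →L[ℝ] ℝ × ℝ :=
  (Matrix.toLin (.finTwoProd ℝ) (.finTwoProd ℝ)
    !![-ρ * Real.sin z.1 - ε * Real.sin (z.1 + z.2), -ε * Real.sin (z.1 + z.2);
      ρ * Real.cos z.1 + ε * Real.cos (z.1 + z.2),
      ε * Real.cos (z.1 + z.2)]).toContinuousLinearMap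

theorem hasFDerivAt_sweep (a b ρ ε : ℝ) (z : ℝ × ℝ) :
    HasFDerivAt (sweep a b ρ ε) (sweepDeriv ρ ε z) z := by
  have hf : HasFDerivAt (fun z : ℝ × ℝ => z.1) (ContinuousLinearMap.fst ℝ ℝ ℝ) z := hasFDerivAt_fst
  have hs : HasFDerivAt (fun z : ℝ × ℝ => z.1 + z.2)
      (ContinuousLinearMap.fst ℝ ℝ ℝ + ContinuousLinearMap.snd ℝ ℝ ℝ) z :=
    hasFDerivAt_fst.add hasFDerivAt_snd
  have := ((hf.cos.const_mul ρ).const_add a |>.add (hs.cos.const_mul ε)).prodMk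
    ((hf.sin.const_mul ρ).const_add b |>.add (hs.sin.const_mul ε))
  unfold sweepDeriv
  rw [Matrix.toLin_finTwoProd_toContinuousLinearMap]
  convert! this using 1
  ext <;> simp
  ring

theorem det_sweepDeriv (ρ ε : ℝ) (z : ℝ × ℝ) :
    (sweepDeriv ρ ε z).det = ρ * ε * Real.sin z.2 := by
  have h : Real.sin z.2 = Real.sin (z.1 + z.2) * Real.cos z.1
      - Real.cos (z.1 + z.2) * Real.sin z.1 := by
    rw [← Real.sin_sub, add_sub_cancel_left]
  rw [h]
  simp only [sweepDeriv, LinearMap.det_toContinuousLinearMap, LinearMap.det_toLin,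
    Matrix.det_fin_two_of]
  ring

theorem lintegral_abs_sin_Icc_zero_pi :
    ∫⁻ x in Set.Icc 0 Real.pi, ENNReal.ofReal |Real.sin x| = 2 := by
  rw [← ofReal_integral_eq_lintegral_ofReal
    (Real.continuous_sin.abs.integrableOn_Icc) (.of_forall fun x => abs_nonneg _),
    integral_Icc_eq_integral_Ioc, ← intervalIntegral.integral_of_le Real.pi_pos.le]
  have : ∫ x in (0 : ℝ)..Real.pi, |Real.sin x| = ∫ x in (0 : ℝ)..Real.pi, Real.sin x := by
    refine intervalIntegral.integral_congr fun x hx => ?_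
    rw [Set.uIcc_of_le Real.pi_pos.le] at hx
    exact abs_of_nonneg (Real.sin_nonneg_of_mem_Icc hx)
  rw [this, integral_sin]
  norm_num

theorem lintegral_abs_sin_Icc_neg_pi_zero :
    ∫⁻ x in Set.Icc (-Real.pi) 0, ENNReal.ofReal |Real.sin x| = 2 := by
  rw [← lintegral_abs_sin_Icc_zero_pi,
    ← (Measure.measurePreserving_neg (volume : Measure ℝ)).setLIntegral_comp_preimage_emb
      (MeasurableEquiv.neg ℝ).measurableEmbedding]
  simp

theorem volume_image_sweep_le (a b : ℝ) {ρ ε : ℝ} (hρ : 0 ≤ ρ) (hε : 0 ≤ ε) {E J : Set ℝ}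
    (hE : MeasurableSet E) (hJ : MeasurableSet J)
    (hJ' : ∫⁻ x in J, ENNReal.ofReal |Real.sin x| = 2) :
    volume (sweep a b ρ ε '' (E ×ˢ J)) ≤
      ENNReal.ofReal (2 * ε) * (ENNReal.ofReal ρ * volume E) := by
  refine (addHaar_image_le_lintegral_abs_det_fderiv volume (hE.prod hJ)
    fun z _ => (hasFDerivAt_sweep a b ρ ε z).hasFDerivWithinAt).trans ?_
  have h1 : ∀ z : ℝ × ℝ, ENNReal.ofReal |(sweepDeriv ρ ε z).det| =
      ENNReal.ofReal (ρ * ε) * ENNReal.ofReal |Real.sin z.2| := by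
    intro z
    rw [det_sweepDeriv, abs_mul, abs_of_nonneg (mul_nonneg hρ hε),
      ENNReal.ofReal_mul (mul_nonneg hρ hε)]
  simp_rw [h1]
  rw [Measure.volume_eq_prod, ← Measure.prod_restrict, lintegral_prod _ (by fun_prop)]
  change ∫⁻ _ in E, ∫⁻ y in J, ENNReal.ofReal (ρ * ε) * ENNReal.ofReal |Real.sin y| ≤ _
  rw [lintegral_const, lintegral_const_mul _ (by fun_prop), hJ', Measure.restrict_apply_univ,
    ENNReal.ofReal_mul hρ, ENNReal.ofReal_mul zero_le_two, ENNReal.ofReal_ofNat]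
  exact le_of_eq (by ring)

theorem two_mul_measure_le_sum {α κ : Type*} [MeasurableSpace α] [Fintype κ] (μ : Measure α)
    {T : Set α} (W : κ → Set α) (h : ∀ x ∈ T, ∃ i j, i ≠ j ∧ x ∈ W i ∧ x ∈ W j) :
    2 * μ T ≤ ∑ i, μ (W i) := by
  classical
  let f : α → ℝ≥0∞ := fun x => ∑ i, (toMeasurable μ (W i)).indicator 1 x
  have hT : T ⊆ {x | 2 ≤ f x} := by
    intro x hx
    obtain ⟨i, j, hij, hi, hj⟩ := h x hx
    calc (2 : ℝ≥0∞) = ∑ k ∈ {i, j}, (toMeasurable μ (W k)).indicator 1 x := by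
          rw [Finset.sum_pair hij, Set.indicator_of_mem (subset_toMeasurable μ _ hi),
            Set.indicator_of_mem (subset_toMeasurable μ _ hj), Pi.one_apply, one_add_one_eq_two]
      _ ≤ f x := Finset.sum_le_univ_sum_of_nonneg fun _ => zero_le
  have hm : ∀ i, Measurable ((toMeasurable μ (W i)).indicator (1 : α → ℝ≥0∞)) := fun i =>
    measurable_one.indicator (measurableSet_toMeasurable μ _)
  calc 2 * μ T ≤ 2 * μ {x | 2 ≤ f x} := by gcongr
    _ ≤ ∫⁻ x, f x ∂μ :=
        mul_meas_ge_le_lintegral (Finset.measurable_fun_sum _ fun i _ => hm i) 2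
    _ = ∑ i, μ (W i) := by
        rw [lintegral_finsetSum _ fun i _ => hm i]
        refine Finset.sum_congr rfl fun i _ => ?_
        rw [lintegral_indicator_one (measurableSet_toMeasurable μ _), measure_toMeasurable]

theorem circlePoint_eq_of_circlePoint_circlePoint_eq {c : EuclideanSpace ℝ (Fin 2)} {ρ ε : ℝ}
    (hε : 0 < ε) (hρ : ε < ρ) {s s' ψ ψ' : ℝ} (hψ : 0 ≤ Real.sin ψ * Real.sin ψ')
    (h : circlePoint (circlePoint c ρ s) ε (s + ψ) =
      circlePoint (circlePoint c ρ s') ε (s' + ψ')) :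
    circlePoint c ρ s = circlePoint c ρ s' := by
  suffices H : Real.cos s = Real.cos s' ∧ Real.sin s = Real.sin s' from
    plane_ext (by simp [H.1]) (by simp [H.2])
  have h0 := congrArg (fun p => p 0) h
  have h1 := congrArg (fun p => p 1) h
  simp only [circlePoint_zero, circlePoint_one, Real.cos_add, Real.sin_add] at h0 h1
  have e := Real.sin_sq_add_cos_sq s
  have e' := Real.sin_sq_add_cos_sq s'
  have f := Real.sin_sq_add_cos_sq ψ
  have f' := Real.sin_sq_add_cos_sq ψ'
  generalize Real.sin s = y at *
  generalize Real.cos s = x at *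
  generalize Real.sin s' = y' at *
  generalize Real.cos s' = x' at *
  generalize Real.sin ψ = v at *
  generalize Real.cos ψ = u at *
  generalize Real.sin ψ' = v' at *
  generalize Real.cos ψ' = u' at *
  have hu : u = u' := by
    have : 2 * ρ * ε * (u - u') = 0 := by
      linear_combination
        (c 0 + ρ * x + ε * (x * u - y * v) - c 0 + (ρ * x' + ε * (x' * u' - y' * v'))) * h0
        + (c 1 + ρ * y + ε * (y * u + x * v) - c 1 + (ρ * y' + ε * (y' * u' + x' * v'))) * h1
        - ((ρ + ε * u) ^ 2 + (ε * v) ^ 2) * e + ((ρ + ε * u') ^ 2 + (ε * v') ^ 2) * e'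
        - ε ^ 2 * f + ε ^ 2 * f'
    have hne : 2 * ρ * ε ≠ 0 := by
      have : 0 < ρ := hε.trans hρ
      positivity
    exact sub_eq_zero.1 ((mul_eq_zero.1 this).resolve_left hne)
  subst hu
  have hv : v = v' := by
    have h2 : v ^ 2 = v' ^ 2 := by linarith
    rcases sq_eq_sq_iff_eq_or_eq_neg.1 h2 with h3 | h3
    · exact h3
    · have h4 : v' = 0 := by
        rw [h3] at hψ
        nlinarith [sq_nonneg v']
      rw [h3, h4, neg_zero]
  subst hv
  have hu1 : -1 ≤ u := by nlinarith [sq_nonneg v]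
  have hX : 0 < ρ + ε * u := by nlinarith
  have hXY : (ρ + ε * u) ^ 2 + (ε * v) ^ 2 ≠ 0 := by positivity
  have hx : x = x' := by
    have : ((ρ + ε * u) ^ 2 + (ε * v) ^ 2) * (x - x') = 0 := by
      linear_combination (ρ + ε * u) * h0 + ε * v * h1
    exact sub_eq_zero.1 ((mul_eq_zero.1 this).resolve_left hXY)
  have hy : y = y' := by
    have : ((ρ + ε * u) ^ 2 + (ε * v) ^ 2) * (y - y') = 0 := by
      linear_combination (ρ + ε * u) * h1 - ε * v * h0
    exact sub_eq_zero.1 ((mul_eq_zero.1 this).resolve_left hXY)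
  exact ⟨hx, hy⟩

/-- The half of the direction interval `[-π, π]` with the given sign. -/
noncomputable def halfTurn (b : Bool) : Set ℝ :=
  if b then Set.Icc 0 Real.pi else Set.Icc (-Real.pi) 0

theorem measurableSet_halfTurn (b : Bool) : MeasurableSet (halfTurn b) := by
  cases b <;> exact measurableSet_Icc

theorem lintegral_abs_sin_halfTurn (b : Bool) :
    ∫⁻ x in halfTurn b, ENNReal.ofReal |Real.sin x| = 2 := by
  cases b
  · exact lintegral_abs_sin_Icc_neg_pi_zero
  · exact lintegral_abs_sin_Icc_zero_pi

theorem sin_mul_sin_nonneg_of_mem_halfTurn {b : Bool} {ψ ψ' : ℝ} (h : ψ ∈ halfTurn b)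
    (h' : ψ' ∈ halfTurn b) : 0 ≤ Real.sin ψ * Real.sin ψ' := by
  cases b
  · exact mul_nonneg_of_nonpos_of_nonpos (Real.sin_nonpos_of_nonpos_of_neg_pi_le h.2 h.1)
      (Real.sin_nonpos_of_nonpos_of_neg_pi_le h'.2 h'.1)
  · exact mul_nonneg (Real.sin_nonneg_of_mem_Icc h) (Real.sin_nonneg_of_mem_Icc h')

/-- The coordinates of a point of the plane, as a measurable equivalence. -/
noncomputable def planeEquivProd : EuclideanSpace ℝ (Fin 2) ≃ᵐ ℝ × ℝ :=
  (MeasurableEquiv.toLp 2 (Fin 2 → ℝ)).symm.trans MeasurableEquiv.finTwoArrow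

theorem planeEquivProd_apply (p : EuclideanSpace ℝ (Fin 2)) : planeEquivProd p = (p 0, p 1) := rfl

theorem measurePreserving_planeEquivProd : MeasurePreserving planeEquivProd :=
  (volume_preserving_finTwoArrow ℝ).comp
    (EuclideanSpace.volume_preserving_symm_measurableEquiv_toLp (Fin 2))

/-- If every point of `T` is at distance exactly `ε` from two points of a closed set `Γ` lying on
finitely many circles of radius larger than `ε`, then `T` has area at most `2ε` times the length
of `Γ`. -/
theorem volume_le_of_two_points {κ : Type*} [Fintype κ] {ε : ℝ} (hε : 0 < ε)
    (c : κ → EuclideanSpace ℝ (Fin 2)) (ρ : κ → ℝ) (hρ : ∀ k, ε < ρ k)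
    {Γ T : Set (EuclideanSpace ℝ (Fin 2))} (hΓ : IsClosed Γ)
    (hΓc : Γ ⊆ ⋃ k, Metric.sphere (c k) (ρ k))
    (hfin : ∀ j k, j ≠ k → (Metric.sphere (c j) (ρ j) ∩ Metric.sphere (c k) (ρ k)).Countable)
    (hT : ∀ Q ∈ T, ∃ p ∈ Γ, ∃ q ∈ Γ, p ≠ q ∧ dist p Q = ε ∧ dist q Q = ε) :
    volume T ≤ ENNReal.ofReal (2 * ε) * μH[1] Γ := by
  let E : κ → Set ℝ := fun k => Set.Ico 0 (2 * Real.pi) ∩ circlePoint (c k) (ρ k) ⁻¹' Γ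
  have hEm : ∀ k, MeasurableSet (E k) := fun k =>
    measurableSet_Ico.inter (hΓ.preimage (continuous_circlePoint _ _)).measurableSet
  have hρ0 : ∀ k, 0 < ρ k := fun k => hε.trans (hρ k)
  let W : κ × Bool → Set (EuclideanSpace ℝ (Fin 2)) := fun i => planeEquivProd ⁻¹'
    (sweep (c i.1 0) (c i.1 1) (ρ i.1) ε '' (E i.1 ×ˢ halfTurn i.2))
  have hW : ∀ i, volume (W i) ≤
      ENNReal.ofReal (2 * ε) * (ENNReal.ofReal (ρ i.1) * volume (E i.1)) := fun i => by
    rw [measurePreserving_planeEquivProd.measure_preimage_equiv]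
    exact volume_image_sweep_le _ _ (hρ0 _).le hε.le (hEm _) (measurableSet_halfTurn _)
      (lintegral_abs_sin_halfTurn _)
  have hmem : ∀ Q, ∀ p ∈ Γ, dist p Q = ε → ∃ i : κ × Bool, Q ∈ W i ∧ ∃ s, ∃ ψ ∈ halfTurn i.2,
      circlePoint (c i.1) (ρ i.1) s = p ∧ circlePoint p ε (s + ψ) = Q := by
    intro Q p hp hpQ
    obtain ⟨k, hk⟩ := Set.mem_iUnion.1 (hΓc hp)
    obtain ⟨s, hs, rfl⟩ := exists_circlePoint_eq (hρ0 k) hk 0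
    rw [zero_add] at hs
    rw [dist_comm] at hpQ
    obtain ⟨θ, hθ, hQ⟩ := exists_circlePoint_eq hε hpQ (s - Real.pi)
    have hθs : s + (θ - s) = θ := by ring
    have hJ : ∃ b, θ - s ∈ halfTurn b := by
      rcases le_total 0 (θ - s) with h | h
      · exact ⟨true, h, by linarith [hθ.2]⟩
      · exact ⟨false, by linarith [hθ.1], h⟩
    obtain ⟨b, hb⟩ := hJ
    refine ⟨(k, b), ⟨(s, θ - s), ⟨⟨hs, hp⟩, hb⟩, ?_⟩, s, θ - s, hb, rfl, by rw [hθs, hQ]⟩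
    rw [← hQ, planeEquivProd_apply, sweep, hθs]
    simp
  have h2 : 2 * volume T ≤ ∑ i, volume (W i) := by
    refine two_mul_measure_le_sum volume W fun Q hQ => ?_
    obtain ⟨p, hp, q, hq, hpq, hpQ, hqQ⟩ := hT Q hQ
    obtain ⟨i, hi, s, ψ, hψ, hsp, hspQ⟩ := hmem Q p hp hpQ
    obtain ⟨j, hj, t, φ, hφ, htq, htqQ⟩ := hmem Q q hq hqQ
    refine ⟨i, j, ?_, hi, hj⟩
    rintro rfl
    apply hpq
    subst hsp htq
    exact circlePoint_eq_of_circlePoint_circlePoint_eq hε (hρ _)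
      (sin_mul_sin_nonneg_of_mem_halfTurn hψ hφ) (hspQ.trans htqQ.symm)
  have hlen : ∑ k, ENNReal.ofReal (ρ k) * volume (E k) ≤ μH[1] Γ := by
    have := Measure.nullSingletonClass_hausdorff (EuclideanSpace ℝ (Fin 2)) one_pos
    calc ∑ k, ENNReal.ofReal (ρ k) * volume (E k)
        ≤ ∑ k, μH[1] (Γ ∩ Metric.sphere (c k) (ρ k)) := by
          refine Finset.sum_le_sum fun k _ => ?_
          refine (mul_volume_le_hausdorffMeasure_image (c k) (hρ0 k) (hEm k)
            Set.inter_subset_left).trans (measure_mono ?_)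
          rintro _ ⟨s, hs, rfl⟩
          exact ⟨hs.2, circlePoint_mem_sphere _ (hρ0 k).le _⟩
      _ = μH[1] (⋃ k, Γ ∩ Metric.sphere (c k) (ρ k)) := by
          rw [measure_iUnion₀, tsum_fintype]
          · intro j k hjk
            refine measure_mono_null ?_ (Set.Countable.measure_zero (hfin j k hjk) _)
            exact fun x hx => ⟨hx.1.2, hx.2.2⟩
          · exact fun k => (hΓ.inter Metric.isClosed_sphere).measurableSet.nullMeasurableSet
      _ ≤ μH[1] Γ := measure_mono (Set.iUnion_subset fun k => Set.inter_subset_left)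
  have h3 : 2 * volume T ≤ 2 * (ENNReal.ofReal (2 * ε) * μH[1] Γ) := by
    calc 2 * volume T ≤ ∑ i, volume (W i) := h2
      _ ≤ ∑ i : κ × Bool, ENNReal.ofReal (2 * ε) * (ENNReal.ofReal (ρ i.1) * volume (E i.1)) :=
          Finset.sum_le_sum fun i _ => hW i
      _ = 2 * (ENNReal.ofReal (2 * ε) * ∑ k, ENNReal.ofReal (ρ k) * volume (E k)) := by
          rw [Fintype.sum_prod_type]
          simp only [Finset.sum_const, Finset.card_univ, Fintype.card_bool, nsmul_eq_mul,
            Nat.cast_ofNat, Finset.mul_sum]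
      _ ≤ _ := by gcongr
  exact (ENNReal.mul_le_mul_iff_right two_ne_zero ENNReal.ofNat_ne_top).1 h3

/-- Let `S` be a connected subset of a disc that is relatively open in it and whose frontier lies
on the bounding circle and on circles of radius larger than `ε` bounding open discs disjoint
from `S`. A circle of radius `ε` whose interior and exterior both meet the frontier of `S` passes
through at least two points of the frontier. -/
theorem exists_two_frontier_points {ι : Type*} {R r ε : ℝ} (hε : 0 < ε) (hεr : ε < r)
    {O : ι → EuclideanSpace ℝ (Fin 2)} {Oc Q : EuclideanSpace ℝ (Fin 2)}
    {S : Set (EuclideanSpace ℝ (Fin 2))} (hR : 0 < R) (hS : IsPreconnected S)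
    (hSR : S ⊆ Metric.closedBall Oc R)
    (hSo : ∀ p ∈ S, ∃ δ > 0, Metric.closedBall Oc R ∩ Metric.ball p δ ⊆ S)
    (hSO : ∀ i, Disjoint S (Metric.ball (O i) r))
    (hfr : frontier S ⊆ Metric.sphere Oc R ∪ ⋃ i, Metric.sphere (O i) r)
    {p q : EuclideanSpace ℝ (Fin 2)} (hp : p ∈ frontier S) (hpQ : dist p Q < ε)
    (hq : q ∈ frontier S) (hqQ : ε < dist q Q) :
    ∃ a ∈ frontier S, ∃ b ∈ frontier S, a ≠ b ∧ dist a Q = ε ∧ dist b Q = ε := by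
  by_contra hcon
  push Not at hcon
  obtain ⟨p₀, hp₀, hunique⟩ : ∃ p₀ ∈ Metric.sphere Q ε,
      ∀ a ∈ frontier S, a ∈ Metric.sphere Q ε → a = p₀ := by
    by_cases hne : (frontier S ∩ Metric.sphere Q ε).Nonempty
    · obtain ⟨a, ha, haQ⟩ := hne
      refine ⟨a, haQ, fun b hb hbQ => ?_⟩
      by_contra hba
      exact hcon b hb a ha hba hbQ haQ
    · refine ⟨circlePoint Q ε 0, circlePoint_mem_sphere Q hε.le 0, fun a ha haQ => ?_⟩
      exact absurd ⟨a, ha, haQ⟩ hne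
  have hC := isPreconnected_sphere_diff_singleton hε hp₀
  have hCcl := sphere_subset_closure_diff_singleton hε hp₀
  set C := Metric.sphere Q ε \ {p₀} with hCdef
  have hCdisj : Disjoint (interior S) (closure S)ᶜ :=
    Set.disjoint_compl_right_iff_subset.2 (interior_subset.trans subset_closure)
  have hCcover : C ⊆ interior S ∪ (closure S)ᶜ := by
    intro x hx
    by_contra hcon'
    rw [Set.mem_union, not_or, Set.mem_compl_iff, not_not] at hcon'
    exact hx.2 (hunique x ⟨hcon'.2, hcon'.1⟩ hx.1)
  have hclR : closure S ⊆ Metric.closedBall Oc R :=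
    closure_minimal hSR Metric.isClosed_closedBall
  rcases hC.subset_or_subset isOpen_interior isClosed_closure.isOpen_compl hCdisj hCcover with h | h
  · have hsph : Metric.sphere Q ε ⊆ closure S :=
      hCcl.trans (closure_mono (h.trans interior_subset))
    rcases hfr hp with hpR | hpO
    · obtain ⟨x, hxQ, hxO⟩ := exists_dist_eq_abs Q Oc ε
      rw [abs_of_pos hε] at hxQ
      rw [abs_of_nonneg (add_nonneg dist_nonneg hε.le)] at hxO
      have h1 : dist x Oc ≤ R := hclR (hsph hxQ)
      have h2 : dist p Oc = R := hpR
      linarith [dist_triangle p Q Oc]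
    · obtain ⟨i, hpO⟩ := Set.mem_iUnion.1 hpO
      obtain ⟨x, hxQ, hxO⟩ := exists_dist_eq_abs Q (O i) (-ε)
      rw [abs_neg, abs_of_pos hε] at hxQ
      have h2 : dist p (O i) = r := hpO
      have h1 : x ∈ Metric.ball (O i) r := by
        rw [Metric.mem_ball, hxO, abs_lt]
        constructor
        · linarith [dist_nonneg (x := Q) (y := O i)]
        · linarith [dist_triangle Q p (O i), dist_comm p Q]
      exact Set.disjoint_left.1 ((hSO i).closure_left Metric.isOpen_ball) (hsph hxQ) h1
  · have hSC : ∀ x ∈ S, x ∈ Metric.sphere Q ε → x = p₀ := by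
      intro x hx hxQ
      by_contra hne
      exact h ⟨hxQ, hne⟩ (subset_closure hx)
    obtain ⟨p₁, hp₁Q, hp₁⟩ := mem_closure_iff.1 hp.1 _ Metric.isOpen_ball
      (Metric.mem_ball.2 hpQ)
    obtain ⟨q₁, hq₁Q, hq₁⟩ := mem_closure_iff.1 hq.1 (Metric.closedBall Q ε)ᶜ
      Metric.isClosed_closedBall.isOpen_compl (by simpa using hqQ)
    have hdisj : Disjoint (Metric.ball Q ε) (Metric.closedBall Q ε)ᶜ :=
      Set.disjoint_compl_right_iff_subset.2 Metric.ball_subset_closedBall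
    have htri : ∀ x, x ∉ Metric.sphere Q ε → x ∈ Metric.ball Q ε ∪ (Metric.closedBall Q ε)ᶜ := by
      intro x hx
      rcases lt_trichotomy (dist x Q) ε with hlt | heq | hgt
      · exact Or.inl hlt
      · exact absurd heq hx
      · exact Or.inr (by simpa using hgt)
    by_cases hp₀S : p₀ ∈ S
    · obtain ⟨δ, hδ, hδS⟩ := hSo p₀ hp₀S
      have hp₀R : p₀ ∉ Metric.ball Oc R := by
        intro hb
        have hint : p₀ ∈ interior S := by
          refine mem_interior.2 ⟨Metric.ball Oc R ∩ Metric.ball p₀ δ, ?_,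
            Metric.isOpen_ball.inter Metric.isOpen_ball, hb, Metric.mem_ball_self hδ⟩
          exact (Set.inter_subset_inter_left _ Metric.ball_subset_closedBall).trans hδS
        obtain ⟨x, hxS, hxC⟩ := mem_closure_iff.1 (hCcl hp₀) _ isOpen_interior hint
        exact h hxC (subset_closure (interior_subset hxS))
      have hK : IsPreconnected (Metric.ball Oc R ∩ Metric.ball p₀ δ) :=
        ((convex_ball _ _).inter (convex_ball _ _)).isPreconnected
      have hKcl : Metric.closedBall Oc R ∩ Metric.ball p₀ δ ⊆
          closure (Metric.ball Oc R ∩ Metric.ball p₀ δ) := by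
        rw [← closure_ball Oc hR.ne']
        exact Metric.isOpen_ball.closure_inter
      have hN : ∀ x ∈ S, x ∈ Metric.ball p₀ δ →
          x ∈ closure (Metric.ball Oc R ∩ Metric.ball p₀ δ) := fun x hx hxp =>
        hKcl ⟨hSR hx, hxp⟩
      have hKcover : Metric.ball Oc R ∩ Metric.ball p₀ δ ⊆
          Metric.ball Q ε ∪ (Metric.closedBall Q ε)ᶜ := by
        refine fun x hx => htri x fun hxQ => hp₀R ?_
        have hxS : x ∈ S := hδS ⟨Metric.ball_subset_closedBall hx.1, hx.2⟩
        exact hSC x hxS hxQ ▸ hx.1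
      have hScover : ∀ x ∈ S, x ∈ Metric.ball p₀ δ ∨
          x ∈ Metric.ball Q ε ∪ (Metric.closedBall Q ε)ᶜ := by
        intro x hx
        by_cases hxQ : x ∈ Metric.sphere Q ε
        · exact Or.inl (hSC x hx hxQ ▸ Metric.mem_ball_self hδ)
        · exact Or.inr (htri x hxQ)
      rcases hK.subset_or_subset Metric.isOpen_ball Metric.isClosed_closedBall.isOpen_compl hdisj
        hKcover with hK' | hK'
      · obtain ⟨z, hzS, hzU, hzV⟩ := hS (Metric.ball Q ε ∪ Metric.ball p₀ δ)
          (Metric.closedBall Q ε)ᶜ (Metric.isOpen_ball.union Metric.isOpen_ball)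
          Metric.isClosed_closedBall.isOpen_compl
          (fun x hx => by
            rcases hScover x hx with h' | h' | h'
            · exact Or.inl (Or.inr h')
            · exact Or.inl (Or.inl h')
            · exact Or.inr h') ⟨p₁, hp₁, Or.inl hp₁Q⟩ ⟨q₁, hq₁, hq₁Q⟩
        rcases hzU with hzU | hzU
        · exact Set.disjoint_left.1 hdisj hzU hzV
        · refine hzV (closure_minimal ?_ Metric.isClosed_closedBall (hN z hzS hzU))
          exact hK'.trans Metric.ball_subset_closedBall
      · obtain ⟨z, hzS, hzU, hzV⟩ := hS (Metric.ball Q ε)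
          ((Metric.closedBall Q ε)ᶜ ∪ Metric.ball p₀ δ) Metric.isOpen_ball
          (Metric.isClosed_closedBall.isOpen_compl.union Metric.isOpen_ball)
          (fun x hx => by
            rcases hScover x hx with h' | h' | h'
            · exact Or.inr (Or.inr h')
            · exact Or.inl h'
            · exact Or.inr (Or.inl h')) ⟨p₁, hp₁, hp₁Q⟩ ⟨q₁, hq₁, Or.inl hq₁Q⟩
        rcases hzV with hzV | hzV
        · exact Set.disjoint_left.1 hdisj hzU hzV
        · refine closure_minimal (s := Metric.ball Oc R ∩ Metric.ball p₀ δ) ?_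
            Metric.isOpen_ball.isClosed_compl (hN z hzS hzV) hzU
          exact hK'.trans (Set.compl_subset_compl.2 Metric.ball_subset_closedBall)
    · have hScover : S ⊆ Metric.ball Q ε ∪ (Metric.closedBall Q ε)ᶜ := fun x hx =>
        htri x fun hxQ => hp₀S (hSC x hx hxQ ▸ hx)
      rcases hS.subset_or_subset Metric.isOpen_ball Metric.isClosed_closedBall.isOpen_compl hdisj
        hScover with h' | h'
      · exact Set.disjoint_left.1 hdisj (h' hq₁) hq₁Q
      · exact Set.disjoint_left.1 hdisj hp₁Q (h' hp₁)

theorem exists_closedBall_inter_ball_subset_component {ι : Type*} [Finite ι] {R r : ℝ}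
    {O : ι → EuclideanSpace ℝ (Fin 2)} {Oc x p : EuclideanSpace ℝ (Fin 2)}
    (hp : p ∈ connectedComponentIn
      (Metric.closedBall Oc R \ ⋃ i, Metric.closedBall (O i) r) x) :
    ∃ δ > 0, Metric.closedBall Oc R ∩ Metric.ball p δ ⊆
      connectedComponentIn (Metric.closedBall Oc R \ ⋃ i, Metric.closedBall (O i) r) x := by
  have hp' := connectedComponentIn_subset _ _ hp
  have hopen : IsOpen (⋃ i, Metric.closedBall (O i) r)ᶜ :=
    (isClosed_iUnion_of_finite fun _ => Metric.isClosed_closedBall).isOpen_compl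
  obtain ⟨δ, hδ, hsub⟩ := Metric.isOpen_iff.1 hopen p hp'.2
  refine ⟨δ, hδ, ?_⟩
  rw [connectedComponentIn_eq hp]
  exact ((convex_closedBall _ _).inter (convex_ball _ _)).isPreconnected.subset_connectedComponentIn
    ⟨hp'.1, Metric.mem_ball_self hδ⟩ fun y hy => ⟨hy.1, hsub hy.2⟩

theorem disjoint_component_ball {ι : Type*} {R r : ℝ} {O : ι → EuclideanSpace ℝ (Fin 2)}
    {Oc x : EuclideanSpace ℝ (Fin 2)} (i : ι) :
    Disjoint (connectedComponentIn (Metric.closedBall Oc R \ ⋃ i, Metric.closedBall (O i) r) x)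
      (Metric.ball (O i) r) :=
  Set.disjoint_left.2 fun _ hy hy' => (connectedComponentIn_subset _ _ hy).2
    (Set.mem_iUnion.2 ⟨i, Metric.ball_subset_closedBall hy'⟩)

theorem frontier_component_subset {ι : Type*} [Finite ι] {R r : ℝ}
    {O : ι → EuclideanSpace ℝ (Fin 2)} {Oc x : EuclideanSpace ℝ (Fin 2)} :
    frontier (connectedComponentIn (Metric.closedBall Oc R \ ⋃ i, Metric.closedBall (O i) r) x) ⊆
      Metric.sphere Oc R ∪ ⋃ i, Metric.sphere (O i) r := by
  set S := connectedComponentIn (Metric.closedBall Oc R \ ⋃ i, Metric.closedBall (O i) r) x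
    with hS
  intro p hp
  by_contra hcon
  rw [Set.mem_union, not_or, Set.mem_iUnion, not_exists] at hcon
  have hpR : p ∈ Metric.ball Oc R := by
    have h1 : p ∈ Metric.closedBall Oc R := closure_minimal
      ((connectedComponentIn_subset _ _).trans Set.sdiff_subset) Metric.isClosed_closedBall hp.1
    exact lt_of_le_of_ne h1 hcon.1
  have hpO : p ∈ (⋃ i, Metric.closedBall (O i) r)ᶜ := by
    rw [Set.mem_compl_iff, Set.mem_iUnion, not_exists]
    intro i hi
    exact Set.disjoint_left.1 ((disjoint_component_ball i).closure_left Metric.isOpen_ball) hp.1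
      (lt_of_le_of_ne hi (hcon.2 i))
  have hopen : IsOpen (⋃ i, Metric.closedBall (O i) r)ᶜ :=
    (isClosed_iUnion_of_finite fun _ => Metric.isClosed_closedBall).isOpen_compl
  obtain ⟨δ, hδ, hsub⟩ := Metric.isOpen_iff.1 (Metric.isOpen_ball.inter hopen) p ⟨hpR, hpO⟩
  obtain ⟨z, hzδ, hzS⟩ := mem_closure_iff.1 hp.1 _ Metric.isOpen_ball (Metric.mem_ball_self hδ)
  refine hp.2 (mem_interior.2 ⟨Metric.ball p δ, ?_, Metric.isOpen_ball, Metric.mem_ball_self hδ⟩)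
  rw [hS, connectedComponentIn_eq hzS]
  exact (convex_ball p δ).isPreconnected.subset_connectedComponentIn hzδ fun y hy =>
    ⟨Metric.ball_subset_closedBall (hsub hy).1, (hsub hy).2⟩

theorem volume_thickening_le_of_subset_closedBall {ε : ℝ} (hε : 0 < ε)
    {Γ : Set (EuclideanSpace ℝ (Fin 2))} {Q : EuclideanSpace ℝ (Fin 2)}
    (hΓ : Γ ⊆ Metric.closedBall Q ε) (hlarge : ENNReal.ofReal (6 * Real.pi * ε) ≤ μH[1] Γ) :
    volume (Metric.thickening ε Γ) ≤ ENNReal.ofReal (2 * ε) * μH[1] Γ := by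
  have hsub : Metric.thickening ε Γ ⊆ Metric.ball Q (2 * ε) := by
    intro x hx
    obtain ⟨y, hy, hxy⟩ := Metric.mem_thickening_iff.1 hx
    have := Metric.mem_closedBall.1 (hΓ hy)
    rw [Metric.mem_ball]
    linarith [dist_triangle x y Q]
  calc volume (Metric.thickening ε Γ) ≤ volume (Metric.ball Q (2 * ε)) := measure_mono hsub
    _ = ENNReal.ofReal ((2 * ε) ^ 2 * Real.pi) := by
        rw [EuclideanSpace.volume_ball_fin_two, ENNReal.ofReal_mul (sq_nonneg _),
          ENNReal.ofReal_pow (by positivity)]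
    _ ≤ ENNReal.ofReal (2 * ε * (6 * Real.pi * ε)) := by
        refine ENNReal.ofReal_le_ofReal ?_
        nlinarith [mul_pos Real.pi_pos (mul_pos hε hε)]
    _ = ENNReal.ofReal (2 * ε) * ENNReal.ofReal (6 * Real.pi * ε) :=
        ENNReal.ofReal_mul (by positivity)
    _ ≤ _ := by gcongr

theorem volume_cthickening_le_of_eventually {X : Type*} [PseudoMetricSpace X] [MeasurableSpace X]
    (μ : Measure X) {ε : ℝ} (hε : 0 < ε) {Γ : Set X} {L : ℝ≥0∞}
    (h : ∀ᶠ η in nhdsWithin ε (Set.Ioi ε), μ (Metric.thickening η Γ) ≤ ENNReal.ofReal (2 * η) * L) :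
    μ (Metric.cthickening ε Γ) ≤ ENNReal.ofReal (2 * ε) * L := by
  have hlim : Filter.Tendsto (fun η => ENNReal.ofReal (2 * η) * L) (nhdsWithin ε (Set.Ioi ε))
      (nhds (ENNReal.ofReal (2 * ε) * L)) := by
    refine ENNReal.Tendsto.mul_const (ENNReal.tendsto_ofReal ?_)
      (Or.inl (ENNReal.ofReal_pos.2 (by positivity)).ne')
    exact ((continuous_const.mul continuous_id).tendsto ε).mono_left nhdsWithin_le_nhds
  refine ge_of_tendsto hlim ?_
  filter_upwards [h, self_mem_nhdsWithin] with η hη hεη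
  exact (measure_mono (Metric.cthickening_subset_thickening' (hε.trans hεη) hεη Γ)).trans hη

theorem volume_thickening_frontier_le {ι : Type*} [Fintype ι] {R r ε : ℝ} (hε : 0 < ε)
    (hεR : ε < R) (hεr : ε < r) {O : ι → EuclideanSpace ℝ (Fin 2)}
    {Oc x : EuclideanSpace ℝ (Fin 2)}
    (hfin : ∀ a b : Option ι, a ≠ b →
      (Metric.sphere (a.elim Oc O) (a.elim R fun _ => r) ∩
        Metric.sphere (b.elim Oc O) (b.elim R fun _ => r)).Countable)
    {S : Set (EuclideanSpace ℝ (Fin 2))}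
    (hS : S = connectedComponentIn (Metric.closedBall Oc R \ ⋃ i, Metric.closedBall (O i) r) x)
    (hlarge : ENNReal.ofReal (6 * Real.pi * ε) ≤ μH[1] (frontier S)) :
    volume (Metric.thickening ε (frontier S)) ≤
      ENNReal.ofReal (2 * ε) * μH[1] (frontier S) := by
  by_cases hball : ∃ Q, frontier S ⊆ Metric.closedBall Q ε
  · obtain ⟨Q, hQ⟩ := hball
    exact volume_thickening_le_of_subset_closedBall hε hQ hlarge
  push Not at hball
  subst hS
  refine volume_le_of_two_points hε (fun a : Option ι => a.elim Oc O)
    (fun a => a.elim R fun _ => r) ?_ isClosed_frontier ?_ hfin fun Q hQ => ?_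
  · rintro (_ | i)
    · exact hεR
    · exact hεr
  · intro p hp
    rcases frontier_component_subset hp with h | h
    · exact Set.mem_iUnion.2 ⟨none, h⟩
    · obtain ⟨i, hi⟩ := Set.mem_iUnion.1 h
      exact Set.mem_iUnion.2 ⟨some i, hi⟩
  · obtain ⟨p, hp, hpQ⟩ := Metric.mem_thickening_iff.1 hQ
    obtain ⟨q, hq, hqQ⟩ := Set.not_subset.1 (hball Q)
    rw [Metric.mem_closedBall, not_le] at hqQ
    rw [dist_comm] at hpQ
    exact exists_two_frontier_points hε hεr (hε.trans hεR) isPreconnected_connectedComponentIn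
      ((connectedComponentIn_subset _ _).trans Set.sdiff_subset)
      (fun _ => exists_closedBall_inter_ball_subset_component) disjoint_component_ball
      frontier_component_subset hp hpQ hq hqQ

/-- Lemma on ε-tubes around large components: with the circles
`sphere(O_i, r)` and `sphere(O, r/3)` in general position, `2ε < r/3`, and
`ℛ₂ = closedBall(O, r/3) \ ⋃ᵢ closedBall(O_i, r)`, every connected component `S` of
`ℛ₂` with boundary of length `ℋ¹(frontier S) > 6πε` (a 'large' component) satisfies:
the area of the `ε`-tube around `frontier S` is at most `2ε·ℋ¹(frontier S)`. -/
theorem stmt15 {ι : Type} [Fintype ι] (r ε : ℝ) (hε : 0 < ε) (hεr : 2 * ε < r / 3)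
    (O : ι → EuclideanSpace ℝ (Fin 2)) (Oc : EuclideanSpace ℝ (Fin 2))
    (circ : Option ι → Set (EuclideanSpace ℝ (Fin 2)))
    (hcirc : circ = fun a =>
      a.elim (Metric.sphere Oc (r / 3)) fun i => Metric.sphere (O i) r)
    (hgp₂ : ∀ a b : Option ι, a ≠ b →
      circ a ∩ circ b = ∅ ∨ ∃ x y, x ≠ y ∧ circ a ∩ circ b = {x, y})
    (hgp₃ : ∀ a b c : Option ι, a ≠ b → b ≠ c → a ≠ c →
      circ a ∩ circ b ∩ circ c = ∅)
    (ℛ₂ : Set (EuclideanSpace ℝ (Fin 2)))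
    (hℛ₂ : ℛ₂ = Metric.closedBall Oc (r / 3) \ ⋃ i, Metric.closedBall (O i) r)
    (S : Set (EuclideanSpace ℝ (Fin 2)))
    (hS : ∃ x ∈ ℛ₂, S = connectedComponentIn ℛ₂ x)
    (hlarge : ENNReal.ofReal (6 * Real.pi * ε) < μH[1] (frontier S)) :
    volume (Metric.cthickening ε (frontier S)) ≤
      ENNReal.ofReal (2 * ε) * μH[1] (frontier S) := by
  have key : ∀ᶠ η in nhdsWithin ε (Set.Ioi ε), volume (Metric.thickening η (frontier S)) ≤
      ENNReal.ofReal (2 * η) * μH[1] (frontier S) := by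
    have h1 : ∀ᶠ η in nhds ε, 2 * η < r / 3 :=
      (continuous_const.mul continuous_id).tendsto ε |>.eventually_lt_const hεr
    have h2 : ∀ᶠ η in nhds ε, ENNReal.ofReal (6 * Real.pi * η) < μH[1] (frontier S) :=
      (ENNReal.continuous_ofReal.comp (continuous_const.mul continuous_id)).tendsto ε
        |>.eventually_lt_const hlarge
    filter_upwards [nhdsWithin_le_nhds h1, nhdsWithin_le_nhds h2, self_mem_nhdsWithin]
      with η hη hη' hεη
    have hη0 : 0 < η := hε.trans hεη
    obtain ⟨x, -, hSx⟩ := hS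
    refine volume_thickening_frontier_le hη0 (by linarith) (by linarith) ?_ (hℛ₂ ▸ hSx) hη'.le
    intro a b hab
    have helim : ∀ a : Option ι,
        Metric.sphere (a.elim Oc O) (a.elim (r / 3) fun _ => r) = circ a := by
      rintro (_ | i) <;> rw [hcirc] <;> rfl
    rw [helim, helim]
    rcases hgp₂ a b hab with h | ⟨u, v, -, h⟩
    · rw [h]
      exact Set.countable_empty
    · rw [h]
      exact (Set.toFinite _).countable
  exact volume_cthickening_le_of_eventually volume hε key
end
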